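/- arXiv:1101.4516 — 2 statements merged into one kernel-verified Lean document; each statement's English description precedes it below -/
import Mathlib

section
/- Let n ≥ 2, 0 < r < n, and a, b ≥ 0 be integers. Suppose given homogeneous polynomials p⁰_{a,b−j} : ℂ^{n−1} → (∧_{n−1}†)^{(r)} I of bidegree (a, b−j) for j = 0,…,b, and p¹_{a−i,b} : ℂ^{n−1} → (∧_{n−1}†)^{(r−1)} I of bidegree (a−i, b) for i = 0,…,a, satisfying the compatibility conditions ∂z̃ p⁰_{a,b−j} = 0 for j = 0,…,b and ∂z̃† p¹_{a−i,b} = 0 for i = 0,…,a. Then there exists a unique Hermitean monogenic homogeneous polynomial M_{a,b} : ℂⁿ → (∧_n†)^{(r)} I of bidegree (a,b) such that: (i) M_{a,b}|_{z_n = 0} = p⁰_{a,b} + 𝔣_n† p¹_{a,b}; (ii) (∂^j/∂(z_n^c)^j) M_{a,b}|_{z_n = 0} = p⁰_{a,b−j} − 𝔣_n† ∂z̃† p⁰_{a,b−j+1} for j = 1,…,b; (iii) (∂^i/∂z_n^i) M_{a,b}|_{z_n = 0} = ∂z̃ p¹_{a−i+1,b} + 𝔣_n† p¹_{a−i,b}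 for i = 1,…,a. -/
noncomputable section

/-- The negative definite quadratic form `-∑ vᵢ²` on `K^m`. -/
def negQ (K : Type) [Field K] (m : ℕ) : QuadraticForm K (Fin m → K) :=
  QuadraticMap.weightedSumSquares K (fun _ : Fin m => (-1 : K))

/-- The complex Clifford algebra `ℂ_{2n}`, generated by `e_1, …, e_{2n}` with
`e_α e_β + e_β e_α = -2 δ_{αβ}`. -/
abbrev Cl (n : ℕ) : Type := CliffordAlgebra (negQ ℂ (n + n))

/-- The generators `e_α`, `α = 1, …, 2n`, of `ℂ_{2n}`. -/
def e (n : ℕ) (α : Fin (n + n)) : Cl n := CliffordAlgebra.ι (negQ ℂ (n + n)) (Pi.single α 1)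

/-- The Witt basis element `𝔣_j = ½(e_j - i e_{n+j})`. -/
def ff (n : ℕ) (j : Fin n) : Cl n :=
  (2⁻¹ : ℂ) • (e n (Fin.castAdd n j) - Complex.I • e n (Fin.natAdd n j))

/-- The Witt basis element `𝔣_j† = -½(e_j + i e_{n+j})`. -/
def ffd (n : ℕ) (j : Fin n) : Cl n :=
  -((2⁻¹ : ℂ) • (e n (Fin.castAdd n j) + Complex.I • e n (Fin.natAdd n j)))

/-- `f : ℂ^m → ℂ_{2n}` has directional derivative `d` at `z` in direction `v`
(componentwise, i.e. tested against all linear functionals on the finite-dimensional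
space `ℂ_{2n}`; here `ℂ^m` is regarded as the real vector space `ℝ^{2m}`). -/
def HasDirDeriv {n m : ℕ} (f : (Fin m → ℂ) → Cl n) (z v : Fin m → ℂ) (d : Cl n) : Prop :=
  ∀ φ : Cl n →ₗ[ℂ] ℂ, HasDerivAt (fun t : ℝ => φ (f (z + t • v))) (φ d) 0

/-- The directional derivative of `f` at `z` in direction `v` (junk value if none exists). -/
def dirDeriv {n m : ℕ} (f : (Fin m → ℂ) → Cl n) (v : Fin m → ℂ) (z : Fin m → ℂ) : Cl n :=
  letI : Nonempty (Cl n) := ⟨0⟩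
  Classical.epsilon fun d => HasDirDeriv f z v d

/-- The Cauchy–Riemann operator `∂_{z_j} = ½(∂_{x_j} - i ∂_{y_j})`. -/
def pz {n m : ℕ} (j : Fin m) (f : (Fin m → ℂ) → Cl n) : (Fin m → ℂ) → Cl n := fun z =>
  (2⁻¹ : ℂ) • (dirDeriv f (Pi.single j 1) z - Complex.I • dirDeriv f (Pi.single j Complex.I) z)

/-- The conjugate Cauchy–Riemann operator `∂_{z_j^c} = ½(∂_{x_j} + i ∂_{y_j})`. -/
def pzc {n m : ℕ} (j : Fin m) (f : (Fin m → ℂ) → Cl n) : (Fin m → ℂ) → Cl n := fun z =>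
  (2⁻¹ : ℂ) • (dirDeriv f (Pi.single j 1) z + Complex.I • dirDeriv f (Pi.single j Complex.I) z)

/-- The Hermitean Dirac operator `∂_z g = ∑_j 𝔣_j† ∂_{z_j} g` on functions `ℂ^n → ℂ_{2n}`. -/
def dzFull (n : ℕ) (g : (Fin n → ℂ) → Cl n) (z : Fin n → ℂ) : Cl n :=
  ∑ j : Fin n, ffd n j * pz j g z

/-- The Hermitean Dirac operator `∂_z† g = ∑_j 𝔣_j ∂_{z_j^c} g` on functions `ℂ^n → ℂ_{2n}`. -/
def dzdFull (n : ℕ) (g : (Fin n → ℂ) → Cl n) (z : Fin n → ℂ) : Cl n :=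
  ∑ j : Fin n, ff n j * pzc j g z

/-- `g : ℂ^n → ℂ_{2n}` is Hermitean monogenic (everywhere). -/
def HMonogenic (n : ℕ) (g : (Fin n → ℂ) → Cl n) : Prop :=
  ∀ z, dzFull n g z = 0 ∧ dzdFull n g z = 0

/-- The restricted Hermitean Dirac operator `∂_z̃ g = ∑_{j<n} 𝔣_j† ∂_{z_j} g` on functions
`ℂ^{n-1} → ℂ_{2n}`. -/
def dzT (n : ℕ) (g : (Fin (n - 1) → ℂ) → Cl n) (z : Fin (n - 1) → ℂ) : Cl n :=
  ∑ j : Fin (n - 1), ffd n (Fin.castLE (Nat.sub_le n 1) j) * pz j g z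

/-- The restricted Hermitean Dirac operator `∂_z̃† g = ∑_{j<n} 𝔣_j ∂_{z_j^c} g` on functions
`ℂ^{n-1} → ℂ_{2n}`. -/
def dzdT (n : ℕ) (g : (Fin (n - 1) → ℂ) → Cl n) (z : Fin (n - 1) → ℂ) : Cl n :=
  ∑ j : Fin (n - 1), ff n (Fin.castLE (Nat.sub_le n 1) j) * pzc j g z

/-- `p : ℂ^m → ℂ_{2n}` is a polynomial map (in the underlying real coordinates,
equivalently in `z_j` and their conjugates) with coefficients in `ℂ_{2n}`. -/
def IsPolyMap (n m : ℕ) (p : (Fin m → ℂ) → Cl n) : Prop :=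
  ∃ (N : ℕ) (c : Fin N → Cl n) (dx dy : Fin N → Fin m → ℕ),
    ∀ z, p z = ∑ t, (∏ j, (z j) ^ dx t j * (starRingEnd ℂ) (z j) ^ dy t j) • c t

/-- `p : ℂ^m → ℂ_{2n}` is a homogeneous polynomial of bidegree `(a, b)`:
it is polynomial and `p (c z) = c^a (conj c)^b p(z)`. -/
def IsBihom (n m a b : ℕ) (p : (Fin m → ℂ) → Cl n) : Prop :=
  IsPolyMap n m p ∧ ∀ (c : ℂ) (z : Fin m → ℂ),
    p (c • z) = (c ^ a * (starRingEnd ℂ) c ^ b) • p z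

/-- The idempotent `I = (𝔣_1 𝔣_1†)(𝔣_2 𝔣_2†) ⋯ (𝔣_n 𝔣_n†)`. -/
def Iel (n : ℕ) : Cl n := ((List.finRange n).map (fun j => ff n j * ffd n j)).prod

/-- The element `𝔣_{k_1}† ⋯ 𝔣_{k_r}† I` for `s = {k_1 < ⋯ < k_r}`. -/
def blade (n : ℕ) (s : Finset (Fin n)) : Cl n :=
  ((s.sort (· ≤ ·)).map (ffd n)).prod * Iel n

/-- The homogeneous part `(∧_n†)^{(r)} I` of spinor space. -/
def Lam (n r : ℕ) : Submodule ℂ (Cl n) :=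
  Submodule.span ℂ {x | ∃ s : Finset (Fin n), s.card = r ∧ x = blade n s}

/-- The subspace `(∧_{n-1}†)^{(r)}(𝔣_1†,…,𝔣_{n-1}†) I` (all indices `≤ n-1`). -/
def LamT (n r : ℕ) : Submodule ℂ (Cl n) :=
  Submodule.span ℂ
    {x | ∃ s : Finset (Fin n), s.card = r ∧ (∀ j ∈ s, (j : ℕ) + 1 < n) ∧ x = blade n s}

/-- The subspace `(∧_{n-1}†)^{(r-1)}(𝔣_1†,…,𝔣_{n-1}†) 𝔣_n† I`: the span of the blades
`𝔣_{k_1}† ⋯ 𝔣_{k_{r-1}}† 𝔣_n† I` with `k_1 < ⋯ < k_{r-1} ≤ n-1`, i.e. of the `r`-blades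
whose index set contains `n`. -/
def LamQ (n r : ℕ) : Submodule ℂ (Cl n) :=
  Submodule.span ℂ
    {x | ∃ s : Finset (Fin n), s.card = r ∧ (∃ j ∈ s, (j : ℕ) + 1 = n) ∧ x = blade n s}

/-- The embedding `ℂ^{n-1} ≃ {z ∈ ℂ^n : z_n = 0} ⊆ ℂ^n`. -/
def embC (n : ℕ) (x : Fin (n - 1) → ℂ) : Fin n → ℂ :=
  fun i => if h : (i : ℕ) < n - 1 then x ⟨i, h⟩ else 0

namespace HermCK

/-! ### Clifford relations -/

lemma negQ_apply (m : ℕ) (x : Fin m → ℂ) : negQ ℂ m x = -∑ i, x i * x i := by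
  simp [negQ, QuadraticMap.weightedSumSquares_apply]

lemma polar_negQ (m : ℕ) (x y : Fin m → ℂ) :
    QuadraticMap.polar (negQ ℂ m) x y = -2 * ∑ i, x i * y i := by
  simp only [QuadraticMap.polar, negQ_apply, Pi.add_apply]
  rw [Finset.mul_sum, ← Finset.sum_neg_distrib, ← Finset.sum_neg_distrib, ← Finset.sum_neg_distrib,
    ← Finset.sum_sub_distrib, ← Finset.sum_sub_distrib]
  exact Finset.sum_congr rfl fun i _ => by ring

/-- The vector `α e_j + β e_{n+j}`. -/
def wittVec (n : ℕ) (j : Fin n) (α β : ℂ) : Fin (n + n) → ℂ :=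
  Pi.single (Fin.castAdd n j) α + Pi.single (Fin.natAdd n j) β

lemma ι_wittVec (n : ℕ) (j : Fin n) (α β : ℂ) : CliffordAlgebra.ι (negQ ℂ (n + n))
    (wittVec n j α β) = α • e n (Fin.castAdd n j) + β • e n (Fin.natAdd n j) := by
  have h : wittVec n j α β = α • Pi.single (Fin.castAdd n j) (1 : ℂ) +
      β • Pi.single (Fin.natAdd n j) (1 : ℂ) := by
    ext i; simp [wittVec, Pi.single_apply]
  rw [h, map_add, map_smul, map_smul, e, e]

lemma castAdd_ne_natAdd {n : ℕ} (i j : Fin n) : Fin.castAdd n i ≠ Fin.natAdd n j := by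
  intro h
  have := congrArg Fin.val h
  simp at this
  omega

lemma ι_wittVec_mul (n : ℕ) (j k : Fin n) (α β γ δ : ℂ) :
    CliffordAlgebra.ι (negQ ℂ (n + n)) (wittVec n j α β) *
        CliffordAlgebra.ι (negQ ℂ (n + n)) (wittVec n k γ δ) +
      CliffordAlgebra.ι (negQ ℂ (n + n)) (wittVec n k γ δ) *
        CliffordAlgebra.ι (negQ ℂ (n + n)) (wittVec n j α β) =
    algebraMap ℂ (Cl n) (if j = k then -2 * (α * γ + β * δ) else 0) := by
  rw [CliffordAlgebra.ι_mul_ι_add_swap, polar_negQ, Fin.sum_univ_add]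
  congr 1
  simp only [wittVec, Pi.add_apply, Pi.single_apply, castAdd_ne_natAdd,
    (castAdd_ne_natAdd _ _).symm, Fin.castAdd_inj, Fin.natAdd_inj, if_false, add_zero, zero_add]
  by_cases h : j = k
  · subst h; simp
  · simp [h, Ne.symm h]

lemma ff_eq (n : ℕ) (j : Fin n) : ff n j = CliffordAlgebra.ι (negQ ℂ (n + n))
    (wittVec n j 2⁻¹ (-(2⁻¹ * Complex.I))) := by
  rw [ι_wittVec, ff, smul_sub, smul_smul, neg_smul, sub_eq_add_neg]

lemma ffd_eq (n : ℕ) (j : Fin n) : ffd n j = CliffordAlgebra.ι (negQ ℂ (n + n))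
    (wittVec n j (-2⁻¹) (-(2⁻¹ * Complex.I))) := by
  rw [ι_wittVec, ffd, smul_add, smul_smul, neg_smul, neg_smul, neg_add]

lemma ff_ffd (n : ℕ) (j k : Fin n) :
    ff n j * ffd n k + ffd n k * ff n j = if j = k then 1 else 0 := by
  rw [ff_eq, ffd_eq, ι_wittVec_mul]
  split_ifs
  · rw [← map_one (algebraMap ℂ (Cl n))]
    congr 1
    linear_combination (-2⁻¹ : ℂ) * Complex.I_mul_I
  · simp

lemma ff_ff (n : ℕ) (j k : Fin n) : ff n j * ff n k = -(ff n k * ff n j) := by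
  rw [eq_neg_iff_add_eq_zero, ff_eq, ff_eq, ι_wittVec_mul, ← map_zero (algebraMap ℂ (Cl n))]
  congr 1
  split_ifs
  · linear_combination (-2⁻¹ : ℂ) * Complex.I_mul_I
  · rfl

lemma ffd_ffd (n : ℕ) (j k : Fin n) : ffd n j * ffd n k = -(ffd n k * ffd n j) := by
  rw [eq_neg_iff_add_eq_zero, ffd_eq, ffd_eq, ι_wittVec_mul, ← map_zero (algebraMap ℂ (Cl n))]
  congr 1
  split_ifs
  · linear_combination (-2⁻¹ : ℂ) * Complex.I_mul_I
  · rfl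

/-! ### Directional derivatives of polynomial maps -/

/-- The monomial map `z ↦ (∏ z_j^{d(true,j)} conj(z_j)^{d(false,j)}) c`. -/
def mon {n m : ℕ} (d : Bool × Fin m → ℕ) (c : Cl n) : (Fin m → ℂ) → Cl n := fun z =>
  (∏ j, z j ^ d (true, j) * (starRingEnd ℂ) (z j) ^ d (false, j)) • c

/-- The operators `∂_{z_j}` (first component `true`) and `∂_{z_j^c}` (first component `false`). -/
def pd {n m : ℕ} (p : Bool × Fin m) (f : (Fin m → ℂ) → Cl n) : (Fin m → ℂ) → Cl n :=
  bif p.1 then pz p.2 f else pzc p.2 f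

/-- `f` has Wirtinger derivatives `P true`, `P false` in the variable `z_j` at `z`. -/
def HasCR {n m : ℕ} (f : (Fin m → ℂ) → Cl n) (j : Fin m) (z : Fin m → ℂ)
    (P : Bool → Cl n) : Prop :=
  ∀ v : ℂ, HasDirDeriv f z (Pi.single j v) (v • P true + (starRingEnd ℂ) v • P false)

section deriv

variable {n m : ℕ} {f g : (Fin m → ℂ) → Cl n} {z v : Fin m → ℂ} {j : Fin m}

lemma HasDirDeriv.unique {d d' : Cl n} (h : HasDirDeriv f z v d) (h' : HasDirDeriv f z v d') :
    d = d' := by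
  rw [← sub_eq_zero, ← Module.forall_dual_apply_eq_zero_iff ℂ]
  intro φ
  rw [map_sub, sub_eq_zero]
  exact (h φ).unique (h' φ)

lemma HasDirDeriv.dirDeriv_eq {d : Cl n} (h : HasDirDeriv f z v d) : dirDeriv f v z = d :=
  HasDirDeriv.unique (Classical.epsilon_spec (p := fun d => HasDirDeriv f z v d) ⟨d, h⟩) h

lemma HasDirDeriv.mem {d : Cl n} (h : HasDirDeriv f z v d) {W : Submodule ℂ (Cl n)}
    (hf : ∀ x, f x ∈ W) : d ∈ W := by
  by_contra hd
  obtain ⟨φ, h1, h2⟩ := Submodule.exists_le_ker_of_notMem hd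
  refine h1 ((h φ).unique ?_)
  have : (fun t : ℝ => φ (f (z + t • v))) = fun _ => 0 := by
    ext t; exact h2 (hf _)
  rw [this]
  exact hasDerivAt_const _ _

lemma HasCR.pd_eq {P : Bool → Cl n} (h : HasCR f j z P) (ε : Bool) : pd (ε, j) f z = P ε := by
  have h1 := HasDirDeriv.dirDeriv_eq (h 1)
  have h2 := HasDirDeriv.dirDeriv_eq (h Complex.I)
  have h3 : Complex.I • dirDeriv f (Pi.single j Complex.I) z = P false - P true := by
    rw [h2, smul_add, smul_smul, smul_smul, Complex.conj_I, mul_neg, Complex.I_mul_I]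
    simp only [neg_smul, one_smul, neg_neg]
    abel
  rw [map_one, one_smul, one_smul] at h1
  have h4 : ∀ x : Cl n, (2⁻¹ : ℂ) • (x + x) = x := fun x => by
    rw [← two_smul ℂ x, smul_smul]; norm_num
  cases ε
  · rw [← h4 (P false)]
    change (2⁻¹ : ℂ) • (_ + _) = _
    rw [h3, h1]; congr 1; abel
  · rw [← h4 (P true)]
    change (2⁻¹ : ℂ) • (_ - _) = _
    rw [h3, h1]; congr 1; abel

lemma HasCR.comp {P : Bool → Cl n} (h : HasCR f j z P) (L : Cl n →ₗ[ℂ] Cl n) :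
    HasCR (fun x => L (f x)) j z (fun ε => L (P ε)) := fun v φ => by
  simpa using h v (φ ∘ₗ L)

lemma HasCR.smul {P : Bool → Cl n} (h : HasCR f j z P) (α : ℂ) :
    HasCR (α • f) j z (α • P) := fun v φ => by
  have key := (h v φ).const_mul α
  simp only [← smul_eq_mul, ← map_smul] at key
  refine key.congr_deriv (congrArg φ ?_)
  simp only [Pi.smul_apply, smul_add, smul_comm α]

lemma HasCR.add {P Q : Bool → Cl n} (h : HasCR f j z P) (h' : HasCR g j z Q) :
    HasCR (f + g) j z (P + Q) := fun v φ => by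
  have key := (h v φ).add (h' v φ)
  rw [← map_add] at key
  have e1 : (fun t : ℝ => φ ((f + g) (z + t • (Pi.single j v : Fin m → ℂ)))) =
      (fun t : ℝ => φ (f (z + t • (Pi.single j v : Fin m → ℂ)))) +
        fun t : ℝ => φ (g (z + t • (Pi.single j v : Fin m → ℂ))) := by
    ext t; simp
  rw [e1]
  refine key.congr_deriv (congrArg φ ?_)
  simp only [Pi.add_apply, smul_add]
  abel

lemma HasCR.zero : HasCR (0 : (Fin m → ℂ) → Cl n) j z 0 := fun v φ => by
  simpa using hasDerivAt_const (0 : ℝ) (0 : ℂ)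

lemma HasCR.sum {ι : Type*} (s : Finset ι) {F : ι → (Fin m → ℂ) → Cl n} {P : ι → Bool → Cl n}
    (h : ∀ i ∈ s, HasCR (F i) j z (P i)) : HasCR (∑ i ∈ s, F i) j z (∑ i ∈ s, P i) := by
  classical
  induction s using Finset.induction_on with
  | empty => simpa using HasCR.zero
  | insert i s hi ih =>
    rw [Finset.sum_insert hi, Finset.sum_insert hi]
    exact (h i (Finset.mem_insert_self _ _)).add
      (ih fun k hk => h k (Finset.mem_insert_of_mem hk))

lemma hasDerivAt_pow_mul_conj_pow (w v : ℂ) (p q : ℕ) :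
    HasDerivAt (fun t : ℝ => (w + t • v) ^ p * (starRingEnd ℂ) (w + t • v) ^ q)
      (v * (p * w ^ (p - 1) * (starRingEnd ℂ) w ^ q) +
        (starRingEnd ℂ) v * (q * w ^ p * (starRingEnd ℂ) w ^ (q - 1))) 0 := by
  have h1 : HasDerivAt (fun t : ℝ => w + t • v) v 0 := by
    simpa using ((hasDerivAt_id (0 : ℝ)).smul_const v).const_add w
  have h2 : HasDerivAt (fun t : ℝ => (starRingEnd ℂ) (w + t • v)) ((starRingEnd ℂ) v) 0 := by
    have := ((hasDerivAt_id (0 : ℝ)).smul_const ((starRingEnd ℂ) v)).const_add ((starRingEnd ℂ) w)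
    simpa using this
  refine ((h1.pow p).mul (h2.pow q)).congr_deriv ?_
  simp only [zero_smul, add_zero, Pi.pow_apply]
  ring

/-- The exponent obtained by lowering the exponent of the variable `p` by one. -/
def low (d : Bool × Fin m → ℕ) (p : Bool × Fin m) : Bool × Fin m → ℕ := d - Pi.single p 1

lemma hasCR_mon (d : Bool × Fin m → ℕ) (c : Cl n) (j : Fin m) (z : Fin m → ℂ) :
    HasCR (mon d c) j z (fun ε => ((d (ε, j) : ℂ) • mon (low d (ε, j)) c) z) := fun v φ => by
  have key := ((hasDerivAt_pow_mul_conj_pow (z j) v (d (true, j)) (d (false, j))).mul_const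
    (∏ i ∈ Finset.univ.erase j, z i ^ d (true, i) * (starRingEnd ℂ) (z i) ^ d (false, i))).mul_const
    (φ c)
  have e1 : ∀ x : Fin m → ℂ, mon d c x = (x j ^ d (true, j) * (starRingEnd ℂ) (x j) ^ d (false, j) *
      ∏ i ∈ Finset.univ.erase j, x i ^ d (true, i) * (starRingEnd ℂ) (x i) ^ d (false, i)) • c :=
    fun x => by rw [mon, ← Finset.mul_prod_erase _ _ (Finset.mem_univ j)]
  have e2 : ∀ ε, mon (low d (ε, j)) c z = (z j ^ low d (ε, j) (true, j) *
      (starRingEnd ℂ) (z j) ^ low d (ε, j) (false, j) *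
      ∏ i ∈ Finset.univ.erase j, z i ^ d (true, i) * (starRingEnd ℂ) (z i) ^ d (false, i)) • c := by
    intro ε
    rw [mon, ← Finset.mul_prod_erase _ _ (Finset.mem_univ j)]
    congr 2
    refine Finset.prod_congr rfl fun i hi => ?_
    have : i ≠ j := Finset.ne_of_mem_erase hi
    simp [low, this]
  have e3 : (fun t : ℝ => φ (mon d c (z + t • (Pi.single j v : Fin m → ℂ)))) = fun t : ℝ =>
      (z j + t • v) ^ d (true, j) * (starRingEnd ℂ) (z j + t • v) ^ d (false, j) *
      (∏ i ∈ Finset.univ.erase j, z i ^ d (true, i) * (starRingEnd ℂ) (z i) ^ d (false, i)) *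
        φ c := by
    ext t
    rw [e1, map_smul, smul_eq_mul]
    congr 2
    · simp
    · refine Finset.prod_congr rfl fun i hi => ?_
      simp [Pi.single_eq_of_ne (Finset.ne_of_mem_erase hi)]
  rw [e3]
  refine key.congr_deriv ?_
  simp only [Pi.smul_apply, e2, map_add, map_smul, smul_eq_mul]
  simp [low]
  ring

end deriv

/-! ### Spaces of polynomial maps -/

/-- The space of polynomial maps `ℂ^m → ℂ_{2n}`. -/
def Pol (n m : ℕ) : Submodule ℂ ((Fin m → ℂ) → Cl n) :=
  Submodule.span ℂ (Set.range fun q : (Bool × Fin m → ℕ) × Cl n => mon q.1 q.2)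

/-- The space of polynomial maps of bidegree `(a, b)`; it is zero if `a < 0` or `b < 0`. -/
def PolB (n m : ℕ) (a b : ℤ) : Submodule ℂ ((Fin m → ℂ) → Cl n) :=
  Submodule.span ℂ {f | ∃ (d : Bool × Fin m → ℕ) (c : Cl n),
    ∑ j, (d (true, j) : ℤ) = a ∧ ∑ j, (d (false, j) : ℤ) = b ∧ f = mon d c}

section

variable {n m : ℕ} {f g : (Fin m → ℂ) → Cl n} {z : Fin m → ℂ} {j : Fin m} {a b : ℤ}

lemma mon_mem_Pol (d : Bool × Fin m → ℕ) (c : Cl n) : mon d c ∈ Pol n m :=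
  Submodule.subset_span ⟨(d, c), rfl⟩

lemma mon_mem_PolB (d : Bool × Fin m → ℕ) (c : Cl n) :
    mon d c ∈ PolB n m (∑ j, (d (true, j) : ℤ)) (∑ j, (d (false, j) : ℤ)) :=
  Submodule.subset_span ⟨d, c, rfl, rfl, rfl⟩

lemma PolB_le_Pol : PolB n m a b ≤ Pol n m := by
  refine Submodule.span_le.2 ?_
  rintro _ ⟨d, c, -, -, rfl⟩
  exact mon_mem_Pol d c

lemma PolB_of_neg (h : a < 0 ∨ b < 0) (hf : f ∈ PolB n m a b) : f = 0 := by
  have : PolB n m a b ≤ ⊥ := by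
    refine Submodule.span_le.2 ?_
    rintro _ ⟨d, c, h1, h2, rfl⟩
    have h3 : 0 ≤ a := h1 ▸ Finset.sum_nonneg fun _ _ => by positivity
    have h4 : 0 ≤ b := h2 ▸ Finset.sum_nonneg fun _ _ => by positivity
    omega
  simpa using this hf

lemma exists_hasCR (hf : f ∈ Pol n m) (j : Fin m) (z : Fin m → ℂ) : ∃ P, HasCR f j z P := by
  induction hf using Submodule.span_induction with
  | mem f hf => obtain ⟨q, rfl⟩ := hf; exact ⟨_, hasCR_mon _ _ _ _⟩
  | zero => exact ⟨_, HasCR.zero⟩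
  | add f g _ _ hf hg =>
    obtain ⟨P, hP⟩ := hf
    obtain ⟨Q, hQ⟩ := hg
    exact ⟨_, hP.add hQ⟩
  | smul α f _ hf =>
    obtain ⟨P, hP⟩ := hf
    exact ⟨_, hP.smul α⟩

lemma hasCR_pd (hf : f ∈ Pol n m) (j : Fin m) (z : Fin m → ℂ) :
    HasCR f j z (fun ε => pd (ε, j) f z) := by
  obtain ⟨P, hP⟩ := exists_hasCR hf j z
  have : P = fun ε => pd (ε, j) f z := funext fun ε => (hP.pd_eq ε).symm
  rwa [← this]

lemma pd_add (hf : f ∈ Pol n m) (hg : g ∈ Pol n m) (p : Bool × Fin m) :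
    pd p (f + g) = pd p f + pd p g := by
  ext z
  exact ((hasCR_pd hf p.2 z).add (hasCR_pd hg p.2 z)).pd_eq p.1

lemma pd_map (hf : f ∈ Pol n m) (p : Bool × Fin m) (L : Cl n →ₗ[ℂ] Cl n) :
    pd p (fun x => L (f x)) = fun x => L (pd p f x) := by
  ext z
  exact ((hasCR_pd hf p.2 z).comp L).pd_eq p.1

lemma pd_smul (hf : f ∈ Pol n m) (p : Bool × Fin m) (α : ℂ) :
    pd p (α • f) = α • pd p f := by
  ext z
  exact ((hasCR_pd hf p.2 z).smul α).pd_eq p.1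

lemma pd_zero (p : Bool × Fin m) : pd p (0 : (Fin m → ℂ) → Cl n) = 0 := by
  ext z
  exact HasCR.zero.pd_eq (j := p.2) p.1

lemma pd_mon (p : Bool × Fin m) (d : Bool × Fin m → ℕ) (c : Cl n) :
    pd p (mon d c) = (d p : ℂ) • mon (low d p) c := by
  ext z
  exact (hasCR_mon d c p.2 z).pd_eq p.1

lemma pd_mem (hf : f ∈ Pol n m) (p : Bool × Fin m) : pd p f ∈ Pol n m := by
  induction hf using Submodule.span_induction with
  | mem f hf =>
    obtain ⟨q, rfl⟩ := hf
    rw [pd_mon]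
    exact Submodule.smul_mem _ _ (mon_mem_Pol _ _)
  | zero => rw [pd_zero]; exact Submodule.zero_mem _
  | add f g hf' hg' hf hg => rw [pd_add hf' hg']; exact Submodule.add_mem _ hf hg
  | smul α f hf' hf => rw [pd_smul hf']; exact Submodule.smul_mem _ _ hf

lemma sum_low (d : Bool × Fin m → ℕ) (p : Bool × Fin m) (hp : d p ≠ 0) (ε : Bool) :
    ∑ j, (low d p (ε, j) : ℤ) = ∑ j, (d (ε, j) : ℤ) - if p.1 = ε then 1 else 0 := by
  obtain ⟨δ, i⟩ := p
  have h : ∀ j, (low d (δ, i) (ε, j) : ℤ) =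
      d (ε, j) - if j = i then (if δ = ε then 1 else 0) else 0 := by
    intro j
    simp only [low, Pi.sub_apply, Pi.single_apply, Prod.mk.injEq]
    by_cases h1 : j = i
    · by_cases h2 : δ = ε
      · subst h1 h2
        simp
        omega
      · simp [h2, Ne.symm h2]
    · simp [h1]
  simp_rw [h, Finset.sum_sub_distrib]
  simp

lemma pd_memB (hf : f ∈ PolB n m a b) (p : Bool × Fin m) :
    pd p f ∈ PolB n m (a - if p.1 = true then 1 else 0) (b - if p.1 = false then 1 else 0) := by
  induction hf using Submodule.span_induction with
  | mem f hf =>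
    obtain ⟨d, c, rfl, rfl, rfl⟩ := hf
    rw [pd_mon]
    by_cases hp : d p = 0
    · simp [hp]
    · rw [← sum_low d p hp, ← sum_low d p hp]
      exact Submodule.smul_mem _ _ (mon_mem_PolB _ _)
  | zero => rw [pd_zero]; exact Submodule.zero_mem _
  | add f g hf' hg' hf hg =>
    rw [pd_add (PolB_le_Pol hf') (PolB_le_Pol hg')]; exact Submodule.add_mem _ hf hg
  | smul α f hf' hf => rw [pd_smul (PolB_le_Pol hf')]; exact Submodule.smul_mem _ _ hf

lemma pz_memB (hf : f ∈ PolB n m a b) (j : Fin m) : pz j f ∈ PolB n m (a - 1) b := by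
  have h := pd_memB hf (true, j)
  rwa [if_pos rfl, if_neg (by simp), sub_zero] at h

lemma pzc_memB (hf : f ∈ PolB n m a b) (j : Fin m) : pzc j f ∈ PolB n m a (b - 1) := by
  have h := pd_memB hf (false, j)
  rwa [if_pos rfl, if_neg (by simp), sub_zero] at h

lemma low_comm (d : Bool × Fin m → ℕ) (p q : Bool × Fin m) : low (low d p) q = low (low d q) p :=
  tsub_right_comm

lemma pd_comm (hf : f ∈ Pol n m) (p q : Bool × Fin m) : pd p (pd q f) = pd q (pd p f) := by
  induction hf using Submodule.span_induction with
  | mem f hf =>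
    obtain ⟨⟨d, c⟩, rfl⟩ := hf
    by_cases h : p = q
    · rw [h]
    · have h1 : low d q p = d p := by simp [low, h]
      have h2 : low d p q = d q := by simp [low, Ne.symm h]
      simp only [pd_mon, pd_smul (mon_mem_Pol _ _), h1, h2, smul_smul, low_comm d q p, mul_comm]
  | zero => simp only [pd_zero]
  | add f g hf' hg' hf hg =>
    rw [pd_add hf' hg', pd_add hf' hg', pd_add (pd_mem hf' _) (pd_mem hg' _),
      pd_add (pd_mem hf' _) (pd_mem hg' _), hf, hg]
  | smul α f hf' hf =>
    rw [pd_smul hf', pd_smul hf', pd_smul (pd_mem hf' _), pd_smul (pd_mem hf' _), hf]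

lemma pd_apply_mem (hf : f ∈ Pol n m) (p : Bool × Fin m) {W : Submodule ℂ (Cl n)}
    (hW : ∀ x, f x ∈ W) (z : Fin m → ℂ) : pd p f z ∈ W := by
  have h : ∀ v : ℂ, dirDeriv f (Pi.single p.2 v) z ∈ W := fun v => by
    have h1 := hasCR_pd hf p.2 z v
    rw [HasDirDeriv.dirDeriv_eq h1]
    exact HasDirDeriv.mem h1 hW
  rcases p with ⟨_ | _, j⟩
  · exact W.smul_mem _ (W.add_mem (h 1) (W.smul_mem _ (h Complex.I)))
  · exact W.smul_mem _ (W.sub_mem (h 1) (W.smul_mem _ (h Complex.I)))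

lemma map_memB (hf : f ∈ PolB n m a b) (L : Cl n →ₗ[ℂ] Cl n) :
    (fun x => L (f x)) ∈ PolB n m a b := by
  induction hf using Submodule.span_induction with
  | mem f hf =>
    obtain ⟨d, c, rfl, rfl, rfl⟩ := hf
    have : (fun x => L (mon d c x)) = mon d (L c) := by ext; simp [mon]
    rw [this]
    exact mon_mem_PolB _ _
  | zero => simp only [Pi.zero_apply, map_zero]; exact Submodule.zero_mem (PolB n m a b)
  | add f g _ _ hf hg => simp only [Pi.add_apply, map_add]; exact Submodule.add_mem _ hf hg
  | smul α f _ hf => simp only [Pi.smul_apply, map_smul]; exact Submodule.smul_mem _ α hf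

lemma map_mem (hf : f ∈ Pol n m) (L : Cl n →ₗ[ℂ] Cl n) : (fun x => L (f x)) ∈ Pol n m := by
  induction hf using Submodule.span_induction with
  | mem f hf =>
    obtain ⟨⟨d, c⟩, rfl⟩ := hf
    have : (fun x => L (mon d c x)) = mon d (L c) := by ext; simp [mon]
    rw [this]
    exact mon_mem_Pol _ _
  | zero => simp only [Pi.zero_apply, map_zero]; exact Submodule.zero_mem (Pol n m)
  | add f g _ _ hf hg => simp only [Pi.add_apply, map_add]; exact Submodule.add_mem _ hf hg
  | smul α f _ hf => simp only [Pi.smul_apply, map_smul]; exact Submodule.smul_mem _ α hf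

end

/-! ### Bihomogeneous polynomial maps -/

section

variable {n m : ℕ} {f : (Fin m → ℂ) → Cl n}

lemma eval_eq_zero_of_conj (P : MvPolynomial (Fin 2) ℂ)
    (h : ∀ s : ℂ, MvPolynomial.eval ![s, (starRingEnd ℂ) s] P = 0) : P = 0 := by
  set Q : MvPolynomial (Fin 2) ℂ := MvPolynomial.bind₁
    ![MvPolynomial.X 0 + MvPolynomial.C Complex.I * MvPolynomial.X 1,
      MvPolynomial.X 0 - MvPolynomial.C Complex.I * MvPolynomial.X 1] P with hQ
  have hev : ∀ x : Fin 2 → ℂ, MvPolynomial.eval x Q =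
      MvPolynomial.eval ![x 0 + Complex.I * x 1, x 0 - Complex.I * x 1] P := by
    intro x
    rw [hQ, MvPolynomial.eval, MvPolynomial.eval₂Hom_bind₁]
    congr 2
    ext i
    fin_cases i <;> simp
  have hQ0 : Q = 0 := by
    refine MvPolynomial.funext_set (fun _ => Set.range ((↑) : ℝ → ℂ))
      (fun _ => Set.infinite_range_of_injective Complex.ofReal_injective) fun x hx => ?_
    obtain ⟨u, hu⟩ := hx 0 (Set.mem_univ _)
    obtain ⟨v, hv⟩ := hx 1 (Set.mem_univ _)
    rw [hev, map_zero, ← hu, ← hv]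
    convert h (u + Complex.I * v) using 4
    simp [sub_eq_add_neg]
  refine MvPolynomial.funext fun y => ?_
  have := hev ![(y 0 + y 1) / 2, (y 0 - y 1) / (2 * Complex.I)]
  rw [hQ0, map_zero] at this
  rw [map_zero, this]
  congr 2
  ext i
  fin_cases i
  · simp; field_simp; ring
  · simp; field_simp; ring

lemma sum_filter_eq_of_conj {N : ℕ} (k l : Fin N → ℕ) (α : Fin N → ℂ) (a b : ℕ) (β : ℂ)
    (h : ∀ s : ℂ, ∑ t, s ^ k t * (starRingEnd ℂ) s ^ l t * α t =
      s ^ a * (starRingEnd ℂ) s ^ b * β) :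
    ∑ t with k t = a ∧ l t = b, α t = β := by
  set ex : ℕ → ℕ → Fin 2 →₀ ℕ := fun p q => Finsupp.single 0 p + Finsupp.single 1 q with hex
  have hinj : ∀ p q p' q', ex p q = ex p' q' ↔ p = p' ∧ q = q' := by
    refine fun p q p' q' => ⟨fun h => ?_, fun h => by rw [h.1, h.2]⟩
    have h0 := DFunLike.congr_fun h 0
    have h1 := DFunLike.congr_fun h 1
    simpa [hex] using And.intro h0 h1
  have hP := eval_eq_zero_of_conj
    (∑ t, MvPolynomial.monomial (ex (k t) (l t)) (α t) - MvPolynomial.monomial (ex a b) β) (by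
      intro s
      have he : ∀ p q γ, MvPolynomial.eval ![s, (starRingEnd ℂ) s]
          (MvPolynomial.monomial (ex p q) γ) = s ^ p * (starRingEnd ℂ) s ^ q * γ := by
        intro p q γ
        rw [MvPolynomial.eval_monomial, hex, Finsupp.prod_fintype _ _ (by simp)]
        simp
        ring
      rw [map_sub, map_sum]
      simp only [he]
      rw [h, sub_self])
  have hc := congrArg (MvPolynomial.coeff (ex a b)) hP
  rw [MvPolynomial.coeff_sub, MvPolynomial.coeff_sum] at hc
  simp only [MvPolynomial.coeff_monomial, hinj, if_true, MvPolynomial.coeff_zero] at hc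
  rw [Finset.sum_filter]
  exact sub_eq_zero.1 hc

lemma mon_smul_apply (d : Bool × Fin m → ℕ) (c : Cl n) (s : ℂ) (z : Fin m → ℂ) :
    mon d c (s • z) = (s ^ (∑ j, d (true, j)) * (starRingEnd ℂ) s ^ (∑ j, d (false, j))) •
      mon d c z := by
  rw [mon, mon, smul_smul, ← Finset.prod_pow_eq_pow_sum, ← Finset.prod_pow_eq_pow_sum,
    ← Finset.prod_mul_distrib, ← Finset.prod_mul_distrib]
  congr 1
  refine Finset.prod_congr rfl fun j _ => ?_
  simp only [Pi.smul_apply, smul_eq_mul, map_mul, mul_pow]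
  ring

lemma IsBihom.mem_PolB {a b : ℕ} (hf : IsBihom n m a b f) : f ∈ PolB n m a b := by
  obtain ⟨⟨N, c, dx, dy, hrep⟩, hhom⟩ := hf
  set d : Fin N → Bool × Fin m → ℕ := fun t p => bif p.1 then dx t p.2 else dy t p.2 with hd
  have hrep' : ∀ z, f z = ∑ t, mon (d t) (c t) z := hrep
  have key : f = ∑ t with (∑ j, d t (true, j) = a ∧ ∑ j, d t (false, j) = b), mon (d t) (c t) := by
    ext z
    rw [← sub_eq_zero, ← Module.forall_dual_apply_eq_zero_iff ℂ]
    intro φ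
    rw [map_sub, Finset.sum_apply, map_sum, sub_eq_zero, eq_comm]
    refine sum_filter_eq_of_conj _ _ (fun t => φ (mon (d t) (c t) z)) a b _ fun s => ?_
    have h1 := hhom s z
    rw [hrep'] at h1
    have h2 := congrArg φ h1
    rw [map_sum, map_smul, smul_eq_mul] at h2
    rw [← h2]
    refine Finset.sum_congr rfl fun t _ => ?_
    rw [mon_smul_apply, map_smul, smul_eq_mul]
  rw [key]
  refine Submodule.sum_mem _ fun t ht => ?_
  obtain ⟨h1, h2⟩ := (Finset.mem_filter.1 ht).2
  have := mon_mem_PolB (d t) (c t)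
  rwa [← Nat.cast_sum, ← Nat.cast_sum, h1, h2] at this

lemma isPolyMap_of_mem (hf : f ∈ Pol n m) : IsPolyMap n m f := by
  obtain ⟨N, α, g, rfl⟩ := Submodule.mem_span_set'.1 hf
  choose q hq using fun t => (g t).2
  refine ⟨N, fun t => α t • (q t).2, fun t j => (q t).1 (true, j),
    fun t j => (q t).1 (false, j), fun z => ?_⟩
  rw [Finset.sum_apply]
  refine Finset.sum_congr rfl fun t _ => ?_
  rw [Pi.smul_apply, ← hq t, smul_comm]
  rfl

lemma isBihom_of_mem {a b : ℕ} (hf : f ∈ PolB n m a b) : IsBihom n m a b f := by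
  refine ⟨isPolyMap_of_mem (PolB_le_Pol hf), fun s z => ?_⟩
  induction hf using Submodule.span_induction with
  | mem f hf =>
    obtain ⟨d, c, h1, h2, rfl⟩ := hf
    rw [mon_smul_apply, show ∑ j, d (true, j) = a by exact_mod_cast h1,
      show ∑ j, d (false, j) = b by exact_mod_cast h2]
  | zero => simp
  | add f g _ _ hf hg => simp only [Pi.add_apply, hf, hg, smul_add]
  | smul α f _ hf => simp only [Pi.smul_apply, hf, smul_comm α]

end

/-! ### Spinor spaces -/

section

variable {n : ℕ}

lemma eq_zero_of_eq_neg {x : Cl n} (h : x = -x) : x = 0 := by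
  have h2 : (2 : ℂ) • x = 0 := by rw [two_smul, ← eq_neg_iff_add_eq_zero, ← h]
  simpa using h2

lemma ffd_mul_self (j : Fin n) : ffd n j * ffd n j = 0 :=
  eq_zero_of_eq_neg (ffd_ffd n j j)

lemma ff_mul_self (j : Fin n) : ff n j * ff n j = 0 :=
  eq_zero_of_eq_neg (ff_ff n j j)

lemma ff_mul_ffd_of_ne {j k : Fin n} (h : j ≠ k) : ff n j * ffd n k = -(ffd n k * ff n j) := by
  rw [eq_neg_iff_add_eq_zero, ff_ffd, if_neg h]

lemma ff_mul_ffd_self (j : Fin n) : ff n j * ffd n j = 1 - ffd n j * ff n j := by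
  rw [eq_sub_iff_add_eq, ff_ffd, if_pos rfl]

lemma ff_mul_Iel (j : Fin n) : ff n j * Iel n = 0 := by
  have key : ∀ l : List (Fin n), j ∈ l →
      ff n j * (l.map (fun k => ff n k * ffd n k)).prod = 0 := by
    intro l
    induction l with
    | nil => simp
    | cons k l ih =>
      intro hj
      rw [List.map_cons, List.prod_cons]
      by_cases h : j = k
      · subst h
        rw [← mul_assoc, ← mul_assoc, ff_mul_self, zero_mul, zero_mul]
      · have hl : j ∈ l := by simpa [h] using hj
        have hc : ff n j * (ff n k * ffd n k) = ff n k * ffd n k * ff n j := by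
          rw [← mul_assoc, ff_ff, neg_mul, mul_assoc, ff_mul_ffd_of_ne h, mul_neg, neg_neg,
            mul_assoc]
        rw [← mul_assoc, hc, mul_assoc, ih hl, mul_zero]
  exact key _ (List.mem_finRange j)

/-- The span of the products `𝔣_{k_1}† ⋯ 𝔣_{k_r}† I` whose indices, in any order and possibly
repeated, satisfy `P`. -/
def Spin (n : ℕ) (P : Fin n → Prop) (r : ℕ) : Submodule ℂ (Cl n) :=
  Submodule.span ℂ {x | ∃ l : List (Fin n), l.length = r ∧ (∀ j ∈ l, P j) ∧
    x = (l.map (ffd n)).prod * Iel n}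

lemma LamT_le_Spin (r : ℕ) : LamT n r ≤ Spin n (fun j => (j : ℕ) + 1 < n) r := by
  refine Submodule.span_mono ?_
  rintro _ ⟨s, hs, hP, rfl⟩
  exact ⟨s.sort (· ≤ ·), by simpa using hs, fun j hj => hP j (by simpa using hj), rfl⟩

lemma ffd_mul_prod_of_mem {j : Fin n} (l : List (Fin n)) (h : j ∈ l) :
    ffd n j * (l.map (ffd n)).prod = 0 := by
  induction l with
  | nil => simp at h
  | cons k l ih =>
    rw [List.map_cons, List.prod_cons, ← mul_assoc]
    by_cases hk : j = k
    · rw [hk, ffd_mul_self, zero_mul]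
    · rw [ffd_ffd, neg_mul, mul_assoc, ih (by simpa [hk] using h), mul_zero, neg_zero]

lemma prod_eq_zero_of_not_nodup (l : List (Fin n)) (h : ¬ l.Nodup) :
    (l.map (ffd n)).prod = 0 := by
  induction l with
  | nil => simp at h
  | cons k l ih =>
    rw [List.map_cons, List.prod_cons]
    by_cases hk : k ∈ l
    · exact ffd_mul_prod_of_mem l hk
    · rw [ih (by simpa [hk] using h), mul_zero]

lemma prod_perm {l l' : List (Fin n)} (h : l.Perm l') :
    (l.map (ffd n)).prod = (l'.map (ffd n)).prod ∨
      (l.map (ffd n)).prod = -(l'.map (ffd n)).prod := by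
  induction h with
  | nil => simp
  | cons x _ ih =>
    simp only [List.map_cons, List.prod_cons]
    rcases ih with ih | ih <;> simp [ih]
  | swap x y l =>
    right
    simp only [List.map_cons, List.prod_cons]
    rw [← mul_assoc, ffd_ffd, neg_mul, mul_assoc]
  | trans _ _ ih ih' =>
    rcases ih with ih | ih <;> rcases ih' with ih' | ih' <;> simp [ih, ih']

lemma Spin_le_Lam (P : Fin n → Prop) (r : ℕ) : Spin n P r ≤ Lam n r := by
  refine Submodule.span_le.2 ?_
  rintro _ ⟨l, rfl, -, rfl⟩
  by_cases hl : l.Nodup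
  · have hmem : blade n l.toFinset ∈ Lam n l.length :=
      Submodule.subset_span ⟨_, List.toFinset_card_of_nodup hl, rfl⟩
    have hp : l.Perm (l.toFinset.sort (· ≤ ·)) :=
      List.perm_of_nodup_nodup_toFinset_eq hl (Finset.sort_nodup _ _)
        (Finset.sort_toFinset _ _).symm
    rcases prod_perm hp with h | h
    · rw [h]; exact hmem
    · rw [h, neg_mul]; exact Submodule.neg_mem _ hmem
  · rw [prod_eq_zero_of_not_nodup l hl, zero_mul]
    exact Submodule.zero_mem _

lemma Spin_mono {P Q : Fin n → Prop} (h : ∀ j, P j → Q j) (r : ℕ) : Spin n P r ≤ Spin n Q r := by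
  refine Submodule.span_mono ?_
  rintro _ ⟨l, hl, hP, rfl⟩
  exact ⟨l, hl, fun j hj => h j (hP j hj), rfl⟩

variable {P : Fin n → Prop} {r : ℕ} {x : Cl n}

lemma ffd_mul_mem {j : Fin n} (hj : P j) (hx : x ∈ Spin n P r) :
    ffd n j * x ∈ Spin n P (r + 1) := by
  induction hx using Submodule.span_induction with
  | mem x hx =>
    obtain ⟨l, hl, hP, rfl⟩ := hx
    refine Submodule.subset_span ⟨j :: l, by simp [hl], ?_, ?_⟩
    · simpa [hj] using hP
    · rw [List.map_cons, List.prod_cons, mul_assoc]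
  | zero => rw [mul_zero]; exact Submodule.zero_mem _
  | add x y _ _ hx hy => rw [mul_add]; exact Submodule.add_mem _ hx hy
  | smul α x _ hx => rw [mul_smul_comm]; exact Submodule.smul_mem _ _ hx

lemma ff_mul_mem (j : Fin n) (hx : x ∈ Spin n P (r + 1)) : ff n j * x ∈ Spin n P r := by
  have key : ∀ (l : List (Fin n)) (r : ℕ), l.length = r + 1 → (∀ j ∈ l, P j) →
      ff n j * ((l.map (ffd n)).prod * Iel n) ∈ Spin n P r := by
    intro l
    induction l with
    | nil => simp
    | cons k l ih =>
      intro r hl hP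
      have hk : P k := hP k (by simp)
      have hP' : ∀ j ∈ l, P j := fun j hj => hP j (by simp [hj])
      have hl' : l.length = r := by simpa using hl
      have h1 : ff n j * (((k :: l).map (ffd n)).prod * Iel n) =
          (if j = k then 1 else 0) * ((l.map (ffd n)).prod * Iel n) -
            ffd n k * (ff n j * ((l.map (ffd n)).prod * Iel n)) := by
        rw [← ff_ffd, List.map_cons, List.prod_cons]
        noncomm_ring
      have h2 : (l.map (ffd n)).prod * Iel n ∈ Spin n P r :=
        Submodule.subset_span ⟨l, hl', hP', rfl⟩
      rw [h1]
      refine Submodule.sub_mem _ ?_ ?_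
      · split_ifs
        · rwa [one_mul]
        · rw [zero_mul]; exact Submodule.zero_mem _
      · rcases r with _ | r
        · rw [List.length_eq_zero_iff.1 hl']
          simp [ff_mul_Iel]
        · exact ffd_mul_mem hk (ih r hl' hP')
  induction hx using Submodule.span_induction with
  | mem x hx =>
    obtain ⟨l, hl, hP, rfl⟩ := hx
    exact key l r hl hP
  | zero => rw [mul_zero]; exact Submodule.zero_mem _
  | add x y _ _ hx hy => rw [mul_add]; exact Submodule.add_mem _ hx hy
  | smul α x _ hx => rw [mul_smul_comm]; exact Submodule.smul_mem _ _ hx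

lemma ff_mul_eq_zero {j : Fin n} (hj : ¬ P j) (hx : x ∈ Spin n P r) : ff n j * x = 0 := by
  have key : ∀ l : List (Fin n), (∀ j ∈ l, P j) →
      ff n j * ((l.map (ffd n)).prod * Iel n) = 0 := by
    intro l
    induction l with
    | nil => simp [ff_mul_Iel]
    | cons k l ih =>
      intro hP
      have hk : j ≠ k := fun h => hj (h ▸ hP k (by simp))
      rw [List.map_cons, List.prod_cons, ← mul_assoc, ← mul_assoc, ff_mul_ffd_of_ne hk, neg_mul,
        neg_mul, mul_assoc, mul_assoc, ih fun j hj => hP j (by simp [hj]), mul_zero, neg_zero]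
  induction hx using Submodule.span_induction with
  | mem x hx =>
    obtain ⟨l, hl, hP, rfl⟩ := hx
    exact key l hP
  | zero => rw [mul_zero]
  | add x y _ _ hx hy => rw [mul_add, hx, hy, add_zero]
  | smul α x _ hx => rw [mul_smul_comm, hx, smul_zero]

end

/-! ### The restricted Dirac operators on polynomial maps -/

/-- The last index of `Fin n`. -/
def lst {n : ℕ} (hn : 0 < n) : Fin n := ⟨n - 1, by omega⟩

section

variable {n m : ℕ}

lemma pd_sum {ι : Type*} (s : Finset ι) (p : Bool × Fin m) {F : ι → (Fin m → ℂ) → Cl n}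
    (hF : ∀ i ∈ s, F i ∈ Pol n m) : pd p (∑ i ∈ s, F i) = ∑ i ∈ s, pd p (F i) := by
  ext z
  rw [(HasCR.sum s fun i hi => hasCR_pd (hF i hi) p.2 z).pd_eq p.1]
  simp

lemma pd_mul (p : Bool × Fin m) {g : (Fin m → ℂ) → Cl n} (hg : g ∈ Pol n m) (x : Cl n) :
    pd p (fun z => x * g z) = fun z => x * pd p g z :=
  pd_map hg p (LinearMap.mulLeft ℂ x)

lemma mul_mem {g : (Fin m → ℂ) → Cl n} (hg : g ∈ Pol n m) (x : Cl n) :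
    (fun z => x * g z) ∈ Pol n m :=
  map_mem hg (LinearMap.mulLeft ℂ x)

lemma mul_memB {a b : ℤ} {g : (Fin m → ℂ) → Cl n} (hg : g ∈ PolB n m a b) (x : Cl n) :
    (fun z => x * g z) ∈ PolB n m a b :=
  map_memB hg (LinearMap.mulLeft ℂ x)

/-- The Witt vectors `𝔣_j†` (for `true`) and `𝔣_j` (for `false`). -/
def witt (n : ℕ) (ε : Bool) (j : Fin n) : Cl n := bif ε then ffd n j else ff n j

lemma witt_anticomm (ε : Bool) (j k : Fin n) :
    witt n ε j * witt n ε k = -(witt n ε k * witt n ε j) := by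
  cases ε
  · exact ff_ff n j k
  · exact ffd_ffd n j k

/-- The sum over the first `n - 1` indices `j` of `𝔣_j† ∂_{z_j}` (for `true`) and of
`𝔣_j ∂_{z_j^c}` (for `false`), on functions of `m ≥ n - 1` variables. -/
def tanD (ε : Bool) (h : n - 1 ≤ m) (g : (Fin m → ℂ) → Cl n) : (Fin m → ℂ) → Cl n :=
  ∑ j : Fin (n - 1), fun z => witt n ε (Fin.castLE (Nat.sub_le n 1) j) * pd (ε, Fin.castLE h j) g z

variable {ε : Bool} {h : n - 1 ≤ m} {g : (Fin m → ℂ) → Cl n}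

lemma tanD_apply (z : Fin m → ℂ) : tanD ε h g z = ∑ j : Fin (n - 1),
    witt n ε (Fin.castLE (Nat.sub_le n 1) j) * pd (ε, Fin.castLE h j) g z := by
  simp [tanD]

lemma dzT_eq (g : (Fin (n - 1) → ℂ) → Cl n) : dzT n g = tanD true le_rfl g := by
  ext z; rw [tanD_apply]; rfl

lemma dzdT_eq (g : (Fin (n - 1) → ℂ) → Cl n) : dzdT n g = tanD false le_rfl g := by
  ext z; rw [tanD_apply]; rfl

lemma tanD_zero : tanD ε h (0 : (Fin m → ℂ) → Cl n) = 0 := by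
  ext z; simp [tanD_apply, pd_zero]

lemma tanD_memB {a b : ℤ} (hg : g ∈ PolB n m a b) : tanD ε h g ∈
    PolB n m (a - if ε = true then 1 else 0) (b - if ε = false then 1 else 0) :=
  Submodule.sum_mem _ fun j _ => mul_memB (pd_memB hg (ε, Fin.castLE h j)) _

lemma tanD_mem (hg : g ∈ Pol n m) : tanD ε h g ∈ Pol n m :=
  Submodule.sum_mem _ fun _ _ => mul_mem (pd_mem hg _) _

lemma pd_tanD (hg : g ∈ Pol n m) (p : Bool × Fin m) :
    pd p (tanD ε h g) = tanD ε h (pd p g) := by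
  rw [tanD, pd_sum _ _ fun _ _ => mul_mem (pd_mem hg _) _]
  refine Finset.sum_congr rfl fun j _ => ?_
  rw [pd_mul _ (pd_mem hg _), pd_comm hg]

lemma tanD_neg (hg : g ∈ Pol n m) : tanD ε h (-g) = -tanD ε h g := by
  ext z
  have := fun p => pd_smul hg p (-1)
  simp only [neg_smul, one_smul] at this
  simp [tanD_apply, this]

lemma tanD_add {g' : (Fin m → ℂ) → Cl n} (hg : g ∈ Pol n m) (hg' : g' ∈ Pol n m) :
    tanD ε h (g + g') = tanD ε h g + tanD ε h g' := by
  ext z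
  simp [tanD_apply, pd_add hg hg', mul_add, Finset.sum_add_distrib]

lemma tanD_mul (hg : g ∈ Pol n m) {x : Cl n}
    (hx : ∀ j : Fin (n - 1), witt n ε (Fin.castLE (Nat.sub_le n 1) j) * x =
      -(x * witt n ε (Fin.castLE (Nat.sub_le n 1) j))) :
    tanD ε h (fun z => x * g z) = fun z => -(x * tanD ε h g z) := by
  ext z
  rw [tanD_apply, tanD_apply, Finset.mul_sum, ← Finset.sum_neg_distrib]
  refine Finset.sum_congr rfl fun j _ => ?_
  rw [pd_mul _ hg, ← mul_assoc, hx, neg_mul, mul_assoc]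

lemma tanD_tanD (hg : g ∈ Pol n m) : tanD ε h (tanD ε h g) = 0 := by
  ext z
  refine eq_zero_of_eq_neg ?_
  simp_rw [tanD_apply, pd_tanD hg, tanD_apply, Finset.mul_sum]
  conv_lhs => rw [Finset.sum_comm]
  simp_rw [← Finset.sum_neg_distrib]
  refine Finset.sum_congr rfl fun j _ => Finset.sum_congr rfl fun k _ => ?_
  rw [← mul_assoc, ← mul_assoc, witt_anticomm, neg_mul, pd_comm hg]

lemma tanD_true_apply_mem (hg : g ∈ Pol n m) {r : ℕ}
    (hW : ∀ z, g z ∈ Spin n (fun j => (j : ℕ) + 1 < n) r) (z : Fin m → ℂ) :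
    tanD true h g z ∈ Spin n (fun j => (j : ℕ) + 1 < n) (r + 1) := by
  rw [tanD_apply]
  refine Submodule.sum_mem _ fun j _ => ffd_mul_mem ?_ (pd_apply_mem hg _ hW z)
  have := j.2
  simp only [Fin.val_castLE]
  omega

lemma tanD_false_apply_mem (hg : g ∈ Pol n m) {r : ℕ}
    (hW : ∀ z, g z ∈ Spin n (fun j => (j : ℕ) + 1 < n) (r + 1)) (z : Fin m → ℂ) :
    tanD false h g z ∈ Spin n (fun j => (j : ℕ) + 1 < n) r := by
  rw [tanD_apply]
  exact Submodule.sum_mem _ fun j _ => ff_mul_mem _ (pd_apply_mem hg _ hW z)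

lemma sum_castLE (hn : 0 < n) {M : Type*} [AddCommMonoid M] (F : Fin n → M) :
    ∑ j, F j = ∑ j : Fin (n - 1), F (Fin.castLE (Nat.sub_le n 1) j) + F (lst hn) := by
  obtain ⟨n, rfl⟩ := Nat.exists_eq_succ_of_ne_zero hn.ne'
  exact Fin.sum_univ_castSucc F

end

/-! ### Taylor polynomials in the last variable -/

section

variable {n : ℕ} {hn : 0 < n} {g : (Fin (n - 1) → ℂ) → Cl n} {k l : ℕ} {ε : Bool}

lemma lst_ne_castLE (j : Fin (n - 1)) : lst hn ≠ Fin.castLE (Nat.sub_le n 1) j := by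
  have := j.2
  simp only [lst, ne_eq, Fin.ext_iff, Fin.val_castLE]
  omega

/-- The projection `ℂ^n → ℂ^{n-1}` forgetting the last coordinate. -/
def res (z : Fin n → ℂ) : Fin (n - 1) → ℂ := fun j => z (Fin.castLE (Nat.sub_le n 1) j)

lemma res_embC (x : Fin (n - 1) → ℂ) : res (embC n x) = x := by
  ext j; simp [res, embC]

lemma embC_lst (x : Fin (n - 1) → ℂ) : embC n x (lst hn) = 0 := by
  simp [embC, lst]

/-- The map `z ↦ z_n^k conj(z_n)^l / (k! l!) g(z_1, …, z_{n-1})`. -/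
def term (hn : 0 < n) (k l : ℕ) (g : (Fin (n - 1) → ℂ) → Cl n) : (Fin n → ℂ) → Cl n := fun z =>
  (z (lst hn) ^ k * (starRingEnd ℂ) (z (lst hn)) ^ l *
    ((k.factorial : ℂ)⁻¹ * (l.factorial : ℂ)⁻¹)) • g (res z)

lemma hasCR_term_lst (z : Fin n → ℂ) : HasCR (term hn k l g) (lst hn) z (fun ε =>
    ((bif ε then k * z (lst hn) ^ (k - 1) * (starRingEnd ℂ) (z (lst hn)) ^ l
      else l * z (lst hn) ^ k * (starRingEnd ℂ) (z (lst hn)) ^ (l - 1)) *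
      ((k.factorial : ℂ)⁻¹ * (l.factorial : ℂ)⁻¹)) • g (res z)) := fun v φ => by
  have key := ((hasDerivAt_pow_mul_conj_pow (z (lst hn)) v k l).mul_const
    ((k.factorial : ℂ)⁻¹ * (l.factorial : ℂ)⁻¹)).mul_const (φ (g (res z)))
  have e (t : ℝ) : res (z + t • (Pi.single (lst hn) v : Fin n → ℂ)) = res z := by
    ext j; simp [res, Pi.single_eq_of_ne (lst_ne_castLE (hn := hn) j).symm]
  have e' : (fun t : ℝ => φ (term hn k l g (z + t • (Pi.single (lst hn) v : Fin n → ℂ)))) =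
      fun t : ℝ => (z (lst hn) + t • v) ^ k * (starRingEnd ℂ) (z (lst hn) + t • v) ^ l *
        ((k.factorial : ℂ)⁻¹ * (l.factorial : ℂ)⁻¹) * φ (g (res z)) := by
    ext t
    rw [term, map_smul, e, smul_eq_mul]
    simp
  rw [e']
  refine key.congr_deriv ?_
  simp only [map_add, map_smul, smul_eq_mul, cond_true, cond_false]
  ring

lemma hasCR_term_castLE (hg : g ∈ Pol n (n - 1)) (j : Fin (n - 1)) (z : Fin n → ℂ) :
    HasCR (term hn k l g) (Fin.castLE (Nat.sub_le n 1) j) z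
      (fun ε => term hn k l (pd (ε, j) g) z) := fun v φ => by
  have key := (hasCR_pd hg j (res z) v φ).const_mul
    (z (lst hn) ^ k * (starRingEnd ℂ) (z (lst hn)) ^ l *
      ((k.factorial : ℂ)⁻¹ * (l.factorial : ℂ)⁻¹))
  have e (t : ℝ) : res (z + t • (Pi.single (Fin.castLE (Nat.sub_le n 1) j) v : Fin n → ℂ)) =
      res z + t • (Pi.single j v : Fin (n - 1) → ℂ) := by
    ext i; simp [res, Pi.single_apply, Fin.ext_iff]
  have e' : (fun t : ℝ => φ (term hn k l g
      (z + t • (Pi.single (Fin.castLE (Nat.sub_le n 1) j) v : Fin n → ℂ)))) =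
      fun t : ℝ => (z (lst hn) ^ k * (starRingEnd ℂ) (z (lst hn)) ^ l *
        ((k.factorial : ℂ)⁻¹ * (l.factorial : ℂ)⁻¹)) *
          φ (g (res z + t • (Pi.single j v : Fin (n - 1) → ℂ))) := by
    ext t
    rw [term, map_smul, e, smul_eq_mul]
    simp [Pi.single_eq_of_ne (lst_ne_castLE (hn := hn) j)]
  rw [e']
  refine key.congr_deriv ?_
  simp only [term, map_add, map_smul, smul_eq_mul]
  ring

lemma pd_term_castLE (hg : g ∈ Pol n (n - 1)) (j : Fin (n - 1)) :
    pd (ε, Fin.castLE (Nat.sub_le n 1) j) (term hn k l g) = term hn k l (pd (ε, j) g) := by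
  ext z
  exact (hasCR_term_castLE hg j z).pd_eq ε

lemma pd_true_term_zero : pd (true, lst hn) (term hn 0 l g) = 0 := by
  ext z
  rw [(hasCR_term_lst z).pd_eq]
  simp

lemma pd_false_term_zero : pd (false, lst hn) (term hn k 0 g) = 0 := by
  ext z
  rw [(hasCR_term_lst z).pd_eq]
  simp

lemma pd_true_term_succ : pd (true, lst hn) (term hn (k + 1) l g) = term hn k l g := by
  ext z
  rw [(hasCR_term_lst z).pd_eq, term]
  have : (k : ℂ) + 1 ≠ 0 := by exact_mod_cast k.succ_ne_zero
  congr 1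
  simp only [cond_true, Nat.factorial_succ, Nat.cast_mul, Nat.cast_add, Nat.cast_one,
    Nat.add_sub_cancel]
  field_simp

lemma pd_false_term_succ : pd (false, lst hn) (term hn k (l + 1) g) = term hn k l g := by
  ext z
  rw [(hasCR_term_lst z).pd_eq, term]
  have : (l : ℂ) + 1 ≠ 0 := by exact_mod_cast l.succ_ne_zero
  congr 1
  simp only [cond_false, Nat.factorial_succ, Nat.cast_mul, Nat.cast_add, Nat.cast_one,
    Nat.add_sub_cancel]
  field_simp

lemma term_zero : term hn k l 0 = 0 := by
  ext z; simp [term]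

lemma term_add (f g : (Fin (n - 1) → ℂ) → Cl n) :
    term hn k l (f + g) = term hn k l f + term hn k l g := by
  ext z; simp [term]

lemma term_smul (α : ℂ) (g : (Fin (n - 1) → ℂ) → Cl n) :
    term hn k l (α • g) = α • term hn k l g := by
  ext z; simp [term, smul_comm α]

lemma term_memB {a b : ℤ} (hg : g ∈ PolB n (n - 1) a b) :
    term hn k l g ∈ PolB n n (a + k) (b + l) := by
  induction hg using Submodule.span_induction with
  | mem g hg =>
    obtain ⟨d, c, rfl, rfl, rfl⟩ := hg
    let d' : Bool × Fin n → ℕ := fun p =>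
      if h : (p.2 : ℕ) < n - 1 then d (p.1, ⟨p.2, h⟩) else bif p.1 then k else l
    have h1 (ε : Bool) (j : Fin (n - 1)) : d' (ε, Fin.castLE (Nat.sub_le n 1) j) = d (ε, j) := by
      simp [d']
    have h2 (ε : Bool) : d' (ε, lst hn) = bif ε then k else l := by
      simp [d', lst]
    have h3 : term hn k l (mon d c) =
        ((k.factorial : ℂ)⁻¹ * (l.factorial : ℂ)⁻¹) • mon d' c := by
      ext z
      have : ∏ j, z j ^ d' (true, j) * (starRingEnd ℂ) (z j) ^ d' (false, j) =
          (∏ j, res z j ^ d (true, j) * (starRingEnd ℂ) (res z j) ^ d (false, j)) *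
            (z (lst hn) ^ k * (starRingEnd ℂ) (z (lst hn)) ^ l) := by
        have := sum_castLE (M := Additive ℂ) hn
          (fun j => z j ^ d' (true, j) * (starRingEnd ℂ) (z j) ^ d' (false, j))
        simp only [h1, h2] at this
        exact this
      rw [Pi.smul_apply, mon, this, term, mon, smul_smul, smul_smul]
      congr 1
      ring
    have h4 := mon_mem_PolB d' c
    rw [sum_castLE hn, sum_castLE hn (fun j => (d' (false, j) : ℤ))] at h4
    simp only [h1, h2, cond_true, cond_false] at h4
    rw [h3]
    exact Submodule.smul_mem _ _ h4
  | zero => rw [term_zero]; exact Submodule.zero_mem _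
  | add f g _ _ hf hg =>
    rw [term_add]; exact Submodule.add_mem _ hf hg
  | smul α f _ hf =>
    rw [term_smul]; exact Submodule.smul_mem _ _ hf

end

section

variable {n : ℕ} {hn : 0 < n} {a b : ℕ} {C : ℕ → ℕ → (Fin (n - 1) → ℂ) → Cl n}

/-- The map `∑_{k ≤ a} ∑_{l ≤ b} z_n^k conj(z_n)^l / (k! l!) C_{k,l}(z_1, …, z_{n-1})`. -/
def taylor (hn : 0 < n) (a b : ℕ) (C : ℕ → ℕ → (Fin (n - 1) → ℂ) → Cl n) : (Fin n → ℂ) → Cl n :=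
  ∑ k ∈ Finset.range (a + 1), ∑ l ∈ Finset.range (b + 1), term hn k l (C k l)

/-- The families of polynomial maps vanishing outside `[0, a] × [0, b]`. -/
def IsFam (a b : ℕ) (C : ℕ → ℕ → (Fin (n - 1) → ℂ) → Cl n) : Prop :=
  ∀ k l, C k l ∈ Pol n (n - 1) ∧ (a < k ∨ b < l → C k l = 0)

lemma term_mem {k l : ℕ} {g : (Fin (n - 1) → ℂ) → Cl n} (hg : g ∈ Pol n (n - 1)) :
    term hn k l g ∈ Pol n n := by
  induction hg using Submodule.span_induction with
  | mem g hg =>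
    obtain ⟨⟨d, c⟩, rfl⟩ := hg
    exact PolB_le_Pol (term_memB (mon_mem_PolB d c))
  | zero => rw [term_zero]; exact Submodule.zero_mem _
  | add f g _ _ hf hg =>
    rw [term_add]; exact Submodule.add_mem _ hf hg
  | smul α f _ hf =>
    rw [term_smul]; exact Submodule.smul_mem _ _ hf

lemma pd_taylor (hC : ∀ k l, C k l ∈ Pol n (n - 1)) (p : Bool × Fin n) :
    pd p (taylor hn a b C) = ∑ k ∈ Finset.range (a + 1), ∑ l ∈ Finset.range (b + 1),
      pd p (term hn k l (C k l)) := by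
  rw [taylor, pd_sum _ _ fun k _ => Submodule.sum_mem _ fun l _ => term_mem (hC k l)]
  exact Finset.sum_congr rfl fun k _ => pd_sum _ _ fun l _ => term_mem (hC k l)

lemma pd_true_taylor (hC : IsFam a b C) : pd (true, lst hn) (taylor hn a b C) =
    taylor hn a b fun k l => C (k + 1) l := by
  rw [pd_taylor fun k l => (hC k l).1, taylor, Finset.sum_range_succ',
    Finset.sum_range_succ _ a]
  simp [pd_true_term_zero, pd_true_term_succ, (hC (a + 1) _).2, term_zero]

lemma pd_false_taylor (hC : IsFam a b C) : pd (false, lst hn) (taylor hn a b C) =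
    taylor hn a b fun k l => C k (l + 1) := by
  rw [pd_taylor fun k l => (hC k l).1, taylor]
  refine Finset.sum_congr rfl fun k _ => ?_
  rw [Finset.sum_range_succ', Finset.sum_range_succ _ b]
  simp [pd_false_term_zero, pd_false_term_succ, (hC _ (b + 1)).2, term_zero]

lemma IsFam.shift (hC : IsFam a b C) (i j : ℕ) : IsFam a b fun k l => C (k + i) (l + j) :=
  fun k l => ⟨(hC _ _).1, fun h => (hC _ _).2 (by omega)⟩

lemma iterate_pz_taylor (hC : IsFam a b C) (i : ℕ) : (pz (lst hn))^[i] (taylor hn a b C) =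
    taylor hn a b fun k l => C (k + i) l := by
  induction i with
  | zero => rfl
  | succ i ih =>
    rw [Function.iterate_succ_apply', ih]
    refine (pd_true_taylor (hC.shift i 0)).trans ?_
    simp only [add_right_comm _ 1 i, add_zero, add_assoc]

lemma iterate_pzc_taylor (hC : IsFam a b C) (i : ℕ) : (pzc (lst hn))^[i] (taylor hn a b C) =
    taylor hn a b fun k l => C k (l + i) := by
  induction i with
  | zero => rfl
  | succ i ih =>
    rw [Function.iterate_succ_apply', ih]
    refine (pd_false_taylor (hC.shift 0 i)).trans ?_
    simp only [add_right_comm _ 1 i, add_zero, add_assoc]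

lemma taylor_embC (x : Fin (n - 1) → ℂ) : taylor hn a b C (embC n x) = C 0 0 x := by
  simp only [taylor, Finset.sum_range_succ', term, Finset.sum_apply, Pi.add_apply, embC_lst,
    res_embC]
  simp

lemma taylor_memB (hC : ∀ k l : ℕ, C k l ∈ PolB n (n - 1) (a - k) (b - l)) :
    taylor hn a b C ∈ PolB n n a b := by
  refine Submodule.sum_mem _ fun k _ => Submodule.sum_mem _ fun l _ => ?_
  have := term_memB (hn := hn) (k := k) (l := l) (hC k l)
  rwa [sub_add_cancel, sub_add_cancel] at this

lemma taylor_apply_mem {W : Submodule ℂ (Cl n)} (hC : ∀ k l x, C k l x ∈ W) (z : Fin n → ℂ) :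
    taylor hn a b C z ∈ W := by
  simp only [taylor, Finset.sum_apply, term]
  exact Submodule.sum_mem _ fun k _ => Submodule.sum_mem _ fun l _ => W.smul_mem _ (hC k l _)

lemma sum_witt_mul_pd_taylor (hC : IsFam a b C) (ε : Bool) (z : Fin n → ℂ) :
    ∑ j, witt n ε j * pd (ε, j) (taylor hn a b C) z = taylor hn a b (fun k l x =>
      tanD ε le_rfl (C k l) x + witt n ε (lst hn) * (bif ε then C (k + 1) l else C k (l + 1)) x)
      z := by
  have h1 (j : Fin (n - 1)) : pd (ε, Fin.castLE (Nat.sub_le n 1) j) (taylor hn a b C) z =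
      taylor hn a b (fun k l => pd (ε, j) (C k l)) z := by
    rw [pd_taylor fun k l => (hC k l).1, taylor]
    simp only [pd_term_castLE (hC _ _).1]
  have h2 : pd (ε, lst hn) (taylor hn a b C) z =
      taylor hn a b (fun k l => bif ε then C (k + 1) l else C k (l + 1)) z := by
    cases ε
    · rw [pd_false_taylor hC]; rfl
    · rw [pd_true_taylor hC]; rfl
  rw [sum_castLE hn]
  change _ + witt n ε (lst hn) * pd (ε, lst hn) (taylor hn a b C) z = _
  simp_rw [h1, h2]
  simp only [taylor, Finset.sum_apply, term, tanD_apply, Finset.mul_sum, smul_add,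
    Finset.sum_add_distrib, Finset.smul_sum, mul_smul_comm]
  congr 1
  rw [Finset.sum_comm]
  refine Finset.sum_congr rfl fun k _ => ?_
  rw [Finset.sum_comm]
  rfl

end

/-! ### Existence -/

section

variable {n : ℕ} {q0 q1 : ℕ → (Fin (n - 1) → ℂ) → Cl n}

/-- The components in `ker 𝔣_n` of the Taylor coefficients of the extension. -/
def coeffA (q0 q1 : ℕ → (Fin (n - 1) → ℂ) → Cl n) : ℕ → ℕ → (Fin (n - 1) → ℂ) → Cl n
  | 0, l => q0 l
  | k + 1, 0 => tanD true le_rfl (q1 k)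
  | k + 1, l + 1 => tanD true le_rfl (-tanD false le_rfl (coeffA q0 q1 k l))

/-- The maps `B` such that `𝔣_n† B` are the components in `ker 𝔣_n†` of the Taylor coefficients
of the extension. -/
def coeffB (q0 q1 : ℕ → (Fin (n - 1) → ℂ) → Cl n) : ℕ → ℕ → (Fin (n - 1) → ℂ) → Cl n
  | k, 0 => q1 k
  | k, l + 1 => -tanD false le_rfl (coeffA q0 q1 k l)

lemma coeffA_succ (k l : ℕ) : coeffA q0 q1 (k + 1) l = tanD true le_rfl (coeffB q0 q1 k l) := by
  cases l <;> rfl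

lemma coeffB_succ (k l : ℕ) : coeffB q0 q1 k (l + 1) = -tanD false le_rfl (coeffA q0 q1 k l) :=
  rfl

lemma coeffB_memB_of {a b : ℤ} (h1 : ∀ k : ℕ, q1 k ∈ PolB n (n - 1) (a - k) b) {k : ℕ}
    (h : ∀ l : ℕ, coeffA q0 q1 k l ∈ PolB n (n - 1) (a - k) (b - l)) (l : ℕ) :
    coeffB q0 q1 k l ∈ PolB n (n - 1) (a - k) (b - l) := by
  cases l with
  | zero => simpa [coeffB] using h1 k
  | succ l =>
    have := tanD_memB (ε := false) (h := le_rfl) (h l)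
    rw [if_neg (by simp), if_pos rfl, sub_zero, sub_sub] at this
    rw [coeffB_succ, Nat.cast_succ]
    exact Submodule.neg_mem _ this

lemma coeffA_memB {a b : ℤ} (h0 : ∀ l : ℕ, q0 l ∈ PolB n (n - 1) a (b - l))
    (h1 : ∀ k : ℕ, q1 k ∈ PolB n (n - 1) (a - k) b) (k l : ℕ) :
    coeffA q0 q1 k l ∈ PolB n (n - 1) (a - k) (b - l) := by
  induction k generalizing l with
  | zero => simpa [coeffA] using h0 l
  | succ k ih =>
    have := tanD_memB (ε := true) (h := le_rfl) (coeffB_memB_of h1 ih l)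
    rw [if_pos rfl, if_neg (by simp), sub_zero, sub_sub] at this
    rwa [coeffA_succ, Nat.cast_succ]

lemma coeffB_apply_mem_of {r k : ℕ}
    (h1 : ∀ k z, q1 k z ∈ Spin n (fun j => (j : ℕ) + 1 < n) r)
    (hA : ∀ l, coeffA q0 q1 k l ∈ Pol n (n - 1))
    (h : ∀ l z, coeffA q0 q1 k l z ∈ Spin n (fun j => (j : ℕ) + 1 < n) (r + 1)) (l : ℕ)
    (z : Fin (n - 1) → ℂ) : coeffB q0 q1 k l z ∈ Spin n (fun j => (j : ℕ) + 1 < n) r := by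
  cases l with
  | zero => exact h1 k z
  | succ l => exact Submodule.neg_mem _ (tanD_false_apply_mem (hA l) (h l) z)

lemma coeffA_apply_mem {r : ℕ} (h0 : ∀ k z, q0 k z ∈ Spin n (fun j => (j : ℕ) + 1 < n) (r + 1))
    (h1 : ∀ k z, q1 k z ∈ Spin n (fun j => (j : ℕ) + 1 < n) r)
    (hA : ∀ k l, coeffA q0 q1 k l ∈ Pol n (n - 1)) (hB : ∀ k l, coeffB q0 q1 k l ∈ Pol n (n - 1))
    (k l : ℕ) (z : Fin (n - 1) → ℂ) :
    coeffA q0 q1 k l z ∈ Spin n (fun j => (j : ℕ) + 1 < n) (r + 1) := by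
  induction k generalizing l z with
  | zero => exact h0 l z
  | succ k ih =>
    rw [coeffA_succ]
    exact tanD_true_apply_mem (hB k l) (fun z => coeffB_apply_mem_of h1 (hA k) ih l z) z

lemma tanD_coeffA (h0 : ∀ l, tanD true le_rfl (q0 l) = 0)
    (hB : ∀ k l, coeffB q0 q1 k l ∈ Pol n (n - 1)) (k l : ℕ) :
    tanD true le_rfl (coeffA q0 q1 k l) = 0 := by
  cases k with
  | zero => exact h0 l
  | succ k => rw [coeffA_succ, tanD_tanD (hB k l)]

lemma tanD_coeffB (h1 : ∀ k, tanD false le_rfl (q1 k) = 0)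
    (hA : ∀ k l, coeffA q0 q1 k l ∈ Pol n (n - 1)) (k l : ℕ) :
    tanD false le_rfl (coeffB q0 q1 k l) = 0 := by
  cases l with
  | zero => exact h1 k
  | succ l => rw [coeffB_succ, tanD_neg (tanD_mem (hA k l)), tanD_tanD (hA k l), neg_zero]

lemma exists_extension (hn : 0 < n) {r a b : ℕ}
    (h0 : ∀ l : ℕ, q0 l ∈ PolB n (n - 1) a (b - l))
    (h1 : ∀ k : ℕ, q1 k ∈ PolB n (n - 1) (a - k) b)
    (h0' : ∀ l z, q0 l z ∈ Spin n (fun j => (j : ℕ) + 1 < n) (r + 1))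
    (h1' : ∀ k z, q1 k z ∈ Spin n (fun j => (j : ℕ) + 1 < n) r)
    (hD0 : ∀ l, tanD true le_rfl (q0 l) = 0) (hD1 : ∀ k, tanD false le_rfl (q1 k) = 0) :
    ∃ M ∈ PolB n n a b, (∀ z, M z ∈ Lam n (r + 1)) ∧ HMonogenic n M ∧
      (∀ x, M (embC n x) = q0 0 x + ffd n (lst hn) * q1 0 x) ∧
      (∀ j x, (pzc (lst hn))^[j + 1] M (embC n x) =
        q0 (j + 1) x - ffd n (lst hn) * tanD false le_rfl (q0 j) x) ∧
      (∀ i x, (pz (lst hn))^[i + 1] M (embC n x) =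
        tanD true le_rfl (q1 i) x + ffd n (lst hn) * q1 (i + 1) x) := by
  have hA := coeffA_memB h0 h1
  have hB := fun k => coeffB_memB_of h1 (hA k)
  have hA' := coeffA_apply_mem h0' h1' (fun k l => PolB_le_Pol (hA k l))
    fun k l => PolB_le_Pol (hB k l)
  have hB' := fun k => coeffB_apply_mem_of h1' (fun l => PolB_le_Pol (hA k l)) (hA' k)
  have hDA := tanD_coeffA hD0 fun k l => PolB_le_Pol (hB k l)
  have hDB := tanD_coeffB hD1 fun k l => PolB_le_Pol (hA k l)
  have hlst : ¬ ((lst hn : Fin n) : ℕ) + 1 < n := by simp only [lst]; omega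
  set C : ℕ → ℕ → (Fin (n - 1) → ℂ) → Cl n := fun k l =>
    coeffA q0 q1 k l + fun x => ffd n (lst hn) * coeffB q0 q1 k l x with hC
  have hCm (k l : ℕ) : C k l ∈ PolB n (n - 1) (a - k) (b - l) :=
    Submodule.add_mem _ (hA k l) (mul_memB (hB k l) _)
  have hfam : IsFam a b C := fun k l =>
    ⟨PolB_le_Pol (hCm k l), fun h => PolB_of_neg (by omega) (hCm k l)⟩
  have hDC (ε : Bool) (hε : ∀ j : Fin (n - 1),
      witt n ε (Fin.castLE (Nat.sub_le n 1) j) * ffd n (lst hn) =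
        -(ffd n (lst hn) * witt n ε (Fin.castLE (Nat.sub_le n 1) j))) (k l : ℕ)
      (x : Fin (n - 1) → ℂ) : tanD ε le_rfl (C k l) x = tanD ε le_rfl (coeffA q0 q1 k l) x -
        ffd n (lst hn) * tanD ε le_rfl (coeffB q0 q1 k l) x := by
    rw [hC, tanD_add (PolB_le_Pol (hA k l)) (mul_mem (PolB_le_Pol (hB k l)) _),
      tanD_mul (PolB_le_Pol (hB k l)) hε, Pi.add_apply, sub_eq_add_neg]
  refine ⟨taylor hn a b C, taylor_memB hCm, taylor_apply_mem fun k l x => ?_,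
    fun z => ⟨?_, ?_⟩, fun x => ?_, fun j x => ?_, fun i x => ?_⟩
  · refine Submodule.add_mem _ (Spin_le_Lam _ _ (hA' k l x))
      (Spin_le_Lam (fun _ => True) _ (ffd_mul_mem trivial ?_))
    exact Spin_mono (fun _ _ => trivial) _ (hB' k l x)
  · refine (sum_witt_mul_pd_taylor hfam true z).trans ?_
    rw [show (fun k l x => _) = fun _ _ => (0 : (Fin (n - 1) → ℂ) → Cl n) from ?_]
    · simp [taylor, term_zero]
    · ext k l x
      rw [hDC true fun j => ffd_ffd n _ _, hDA]
      simp only [hC, witt, cond_true, Pi.add_apply, coeffA_succ, mul_add, ← mul_assoc,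
        ffd_mul_self, Pi.zero_apply]
      simp
  · refine (sum_witt_mul_pd_taylor hfam false z).trans ?_
    rw [show (fun k l x => _) = fun _ _ => (0 : (Fin (n - 1) → ℂ) → Cl n) from ?_]
    · simp [taylor, term_zero]
    · ext k l x
      rw [hDC false fun j => ff_mul_ffd_of_ne (lst_ne_castLE j).symm, hDB]
      simp only [hC, witt, cond_false, Pi.add_apply, mul_add, ← mul_assoc,
        ff_mul_ffd_self, Pi.zero_apply, sub_mul, one_mul, mul_zero]
      rw [mul_assoc, ff_mul_eq_zero hlst (hA' k (l + 1) x), ff_mul_eq_zero hlst (hB' k (l + 1) x),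
        coeffB_succ]
      simp
  · exact taylor_embC x
  · rw [iterate_pzc_taylor hfam, taylor_embC, zero_add]
    simp [hC, coeffB_succ, coeffA, sub_eq_add_neg]
  · rw [iterate_pz_taylor hfam, taylor_embC, zero_add]
    simp [hC, coeffA, coeffB]

end

/-! ### Uniqueness -/

section

variable {n : ℕ} {hn : 0 < n} {g N : (Fin n → ℂ) → Cl n}

lemma embC_add_smul (x v : Fin (n - 1) → ℂ) (t : ℝ) :
    embC n (x + t • v) = embC n x + t • embC n v := by
  ext i
  simp only [embC, Pi.add_apply, Pi.smul_apply]
  split_ifs <;> simp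

lemma embC_single (j : Fin (n - 1)) (v : ℂ) :
    embC n (Pi.single j v) = Pi.single (Fin.castLE (Nat.sub_le n 1) j) v := by
  ext i
  have := j.2
  simp only [embC, Pi.single_apply, Fin.ext_iff, Fin.val_castLE]
  split_ifs <;> first | rfl | omega

lemma pd_castLE_embC (hg : g ∈ Pol n n) (p : Bool × Fin (n - 1)) (x : Fin (n - 1) → ℂ) :
    pd (p.1, Fin.castLE (Nat.sub_le n 1) p.2) g (embC n x) = pd p (fun x => g (embC n x)) x := by
  have h : HasCR (fun x => g (embC n x)) p.2 x
      (fun ε => pd (ε, Fin.castLE (Nat.sub_le n 1) p.2) g (embC n x)) := fun v φ => by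
    simpa only [embC_add_smul, embC_single] using
      hasCR_pd hg (Fin.castLE (Nat.sub_le n 1) p.2) (embC n x) v φ
  exact (h.pd_eq p.1).symm

lemma tanD_embC_eq_zero (hg : g ∈ Pol n n) (h : ∀ x, g (embC n x) = 0) (ε : Bool)
    (x : Fin (n - 1) → ℂ) : tanD ε (Nat.sub_le n 1) g (embC n x) = 0 := by
  have h0 : (fun x => g (embC n x)) = 0 := funext h
  rw [tanD_apply]
  refine Finset.sum_eq_zero fun j _ => ?_
  rw [pd_castLE_embC hg (ε, j), h0, pd_zero, Pi.zero_apply, mul_zero]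

lemma eq_embC_add (z : Fin n → ℂ) : z = embC n (res z) + Pi.single (lst hn) (z (lst hn)) := by
  ext i
  by_cases h : (i : ℕ) < n - 1
  · have : i ≠ lst hn := fun h' => by simp [h', lst] at h
    simp [embC, h, res, this]
  · have : i = lst hn := by ext; simp only [lst]; omega
    subst this
    simp [embC, h]

lemma eq_zero_of_pd_lst_eq_zero (hN : N ∈ Pol n n) (h1 : ∀ ε, pd (ε, lst hn) N = 0)
    (h0 : ∀ x, N (embC n x) = 0) : N = 0 := by
  ext z
  rw [Pi.zero_apply, ← Module.forall_dual_apply_eq_zero_iff ℂ]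
  intro φ
  set v : Fin n → ℂ := Pi.single (lst hn) (z (lst hn)) with hv
  have key (t : ℝ) : HasDerivAt (fun t : ℝ => φ (N (embC n (res z) + t • v))) 0 t := by
    have h2 := hasCR_pd hN (lst hn) (embC n (res z) + t • v) (z (lst hn)) φ
    simp only [h1, Pi.zero_apply, smul_zero, add_zero, map_zero] at h2
    rw [← sub_self t] at h2
    have h3 := h2.comp_sub_const t t
    simp only [← hv, add_assoc, ← add_smul, add_sub_cancel] at h3
    exact h3
  have h4 := is_const_of_deriv_eq_zero (fun t => (key t).differentiableAt)
    (fun t => (key t).deriv) 1 0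
  simp only [one_smul, zero_smul, add_zero, h0, map_zero] at h4
  rwa [hv, ← eq_embC_add] at h4

lemma iterate_pd_mem (hN : N ∈ Pol n n) (p : Bool × Fin n) (k : ℕ) : (pd p)^[k] N ∈ Pol n n := by
  induction k with
  | zero => exact hN
  | succ k ih => rw [Function.iterate_succ_apply']; exact pd_mem ih p

lemma iterate_pz_memB {a b : ℤ} (hN : N ∈ PolB n n a b) (j : Fin n) (k : ℕ) :
    (pz j)^[k] N ∈ PolB n n (a - k) b := by
  induction k with
  | zero => simpa using hN
  | succ k ih =>
    rw [Function.iterate_succ_apply', Nat.cast_succ, ← sub_sub]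
    exact pz_memB ih j

lemma iterate_pzc_memB {a b : ℤ} (hN : N ∈ PolB n n a b) (j : Fin n) (k : ℕ) :
    (pzc j)^[k] N ∈ PolB n n a (b - k) := by
  induction k with
  | zero => simpa using hN
  | succ k ih =>
    rw [Function.iterate_succ_apply', Nat.cast_succ, ← sub_sub]
    exact pzc_memB ih j

lemma pd_sub {M : (Fin n → ℂ) → Cl n} (hM : M ∈ Pol n n) (hN : N ∈ Pol n n)
    (p : Bool × Fin n) : pd p (M - N) = pd p M - pd p N := by
  have := pd_smul hN p (-1)
  simp only [neg_smul, one_smul] at this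
  rw [sub_eq_add_neg, pd_add hM (Submodule.neg_mem _ hN), this, sub_eq_add_neg]

lemma iterate_pd_sub {M : (Fin n → ℂ) → Cl n} (hM : M ∈ Pol n n) (hN : N ∈ Pol n n)
    (p : Bool × Fin n) (k : ℕ) : (pd p)^[k] (M - N) = (pd p)^[k] M - (pd p)^[k] N := by
  induction k with
  | zero => rfl
  | succ k ih =>
    simp only [Function.iterate_succ_apply']
    rw [ih, pd_sub (iterate_pd_mem hM p k) (iterate_pd_mem hN p k)]

lemma pd_iterate_comm (hN : N ∈ Pol n n) (p q : Bool × Fin n) (k : ℕ) :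
    pd p ((pd q)^[k] N) = (pd q)^[k] (pd p N) := by
  induction k with
  | zero => rfl
  | succ k ih =>
    rw [Function.iterate_succ_apply', Function.iterate_succ_apply',
      pd_comm (iterate_pd_mem hN q k), ih]

lemma eq_zero_of_iterate_pd_eq_zero {a b : ℤ} (hN : N ∈ PolB n n a b)
    (h : ∀ k l x, (pd (true, lst hn))^[k] ((pd (false, lst hn))^[l] N) (embC n x) = 0) :
    N = 0 := by
  obtain ⟨d, hd⟩ : ∃ d : ℕ, a + b < d := ⟨(a + b + 1).toNat, by omega⟩
  induction d generalizing a b N with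
  | zero =>
    exact PolB_of_neg (by simp only [Nat.cast_zero] at hd; omega) hN
  | succ d ih =>
    have hP := PolB_le_Pol hN
    refine eq_zero_of_pd_lst_eq_zero (hn := hn) hP (fun ε => ?_) (h 0 0)
    cases ε
    · refine ih (pzc_memB hN _) (fun k l x => ?_) (by push_cast at hd; omega)
      exact h k (l + 1) x
    · refine ih (pz_memB hN _) (fun k l x => ?_) (by push_cast at hd; omega)
      have := h (k + 1) l x
      rwa [Function.iterate_succ_apply, pd_iterate_comm hP] at this

/-- The operators `∂_z` (for `true`) and `∂_z†` (for `false`), split into the contribution of the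
first `n - 1` variables and that of the last one. -/
def fullD (hn : 0 < n) (ε : Bool) (N : (Fin n → ℂ) → Cl n) : (Fin n → ℂ) → Cl n :=
  tanD ε (Nat.sub_le n 1) N + fun z => witt n ε (lst hn) * pd (ε, lst hn) N z

lemma dzFull_eq (N : (Fin n → ℂ) → Cl n) : dzFull n N = fullD hn true N := by
  ext z
  rw [fullD, Pi.add_apply, tanD_apply]
  exact sum_castLE hn _

lemma dzdFull_eq (N : (Fin n → ℂ) → Cl n) : dzdFull n N = fullD hn false N := by
  ext z
  rw [fullD, Pi.add_apply, tanD_apply]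
  exact sum_castLE hn _

lemma fullD_sub {M : (Fin n → ℂ) → Cl n} (hM : M ∈ Pol n n) (hN : N ∈ Pol n n) (ε : Bool) :
    fullD hn ε (M - N) = fullD hn ε M - fullD hn ε N := by
  ext z
  simp only [fullD, Pi.add_apply, Pi.sub_apply, tanD_apply, pd_sub hM hN, mul_sub,
    Finset.sum_sub_distrib]
  abel

lemma pd_fullD (hN : N ∈ Pol n n) (ε : Bool) (p : Bool × Fin n) :
    pd p (fullD hn ε N) = fullD hn ε (pd p N) := by
  rw [fullD, pd_add (tanD_mem hN) (mul_mem (pd_mem hN _) _), pd_tanD hN, pd_mul _ (pd_mem hN _),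
    pd_comm hN, fullD]

lemma iterate_pd_fullD (hN : N ∈ Pol n n) (ε : Bool) (p : Bool × Fin n) (k : ℕ) :
    (pd p)^[k] (fullD hn ε N) = fullD hn ε ((pd p)^[k] N) := by
  induction k with
  | zero => rfl
  | succ k ih =>
    rw [Function.iterate_succ_apply', Function.iterate_succ_apply', ih,
      pd_fullD (iterate_pd_mem hN p k)]

lemma iterate_pd_zero (p : Bool × Fin n) (k : ℕ) : (pd p)^[k] (0 : (Fin n → ℂ) → Cl n) = 0 :=
  Function.iterate_fixed (pd_zero p) k

lemma pd_pd_embC_eq_zero (hN : N ∈ Pol n n) (hD : ∀ ε, fullD hn ε N = 0)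
    (h : ∀ ε x, pd (ε, lst hn) N (embC n x) = 0) (x : Fin (n - 1) → ℂ) :
    pd (true, lst hn) (pd (false, lst hn) N) (embC n x) = 0 := by
  have key (ε : Bool) :
      witt n ε (lst hn) * pd (true, lst hn) (pd (false, lst hn) N) (embC n x) = 0 := by
    have h1 : fullD hn ε (pd (!ε, lst hn) N) (embC n x) = 0 := by
      rw [← pd_fullD hN, hD, pd_zero, Pi.zero_apply]
    rw [fullD, Pi.add_apply, tanD_embC_eq_zero (pd_mem hN _) (h _), zero_add] at h1
    cases ε
    · rwa [pd_comm hN]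
    · exact h1
  have h2 := ff_ffd n (lst hn) (lst hn)
  have h3 := congrArg (· * pd (true, lst hn) (pd (false, lst hn) N) (embC n x)) h2
  simp only [if_true, one_mul, add_mul, mul_assoc] at h3
  rw [← h3]
  have h4 := key true
  have h5 := key false
  simp only [witt, cond_true, cond_false] at h4 h5
  rw [h4, h5, mul_zero, mul_zero, add_zero]

lemma eq_zero_of_fullD_eq_zero {a b : ℤ} (hN : N ∈ PolB n n a b) (hD : ∀ ε, fullD hn ε N = 0)
    (h : ∀ ε k x, (pd (ε, lst hn))^[k] N (embC n x) = 0) : N = 0 := by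
  have hP := PolB_le_Pol hN
  refine eq_zero_of_iterate_pd_eq_zero (hn := hn) hN fun k => ?_
  induction k with
  | zero => exact h false
  | succ k ihk =>
    intro l
    induction l with
    | zero => exact h true (k + 1)
    | succ l ihl =>
      set G := (pd (true, lst hn))^[k] ((pd (false, lst hn))^[l] N) with hG
      have hG1 : pd (true, lst hn) G =
          (pd (true, lst hn))^[k + 1] ((pd (false, lst hn))^[l] N) := by
        rw [Function.iterate_succ_apply']
      have hG2 : pd (false, lst hn) G =
          (pd (true, lst hn))^[k] ((pd (false, lst hn))^[l + 1] N) := by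
        rw [Function.iterate_succ_apply', hG, pd_iterate_comm (iterate_pd_mem hP _ _)]
      have hGP : G ∈ Pol n n := iterate_pd_mem (iterate_pd_mem hP _ _) _ _
      rw [Function.iterate_succ_apply', ← hG2]
      refine pd_pd_embC_eq_zero hGP (fun ε => ?_) fun ε x => ?_
      · rw [hG, ← iterate_pd_fullD (iterate_pd_mem hP _ _), ← iterate_pd_fullD hP, hD,
          iterate_pd_zero, iterate_pd_zero]
      · cases ε
        · rw [hG2]; exact ihk (l + 1) x
        · rw [hG1]; exact ihl x

end

end HermCK

/-- **The Cauchy–Kovalevskaya extension theorem in Hermitean Clifford analysis (Theorem 3).**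
Given homogeneous polynomials `p⁰_{a,b-j} : ℂ^{n-1} → (∧_{n-1}†)^{(r)} I` (`0 ≤ j ≤ b`) and
`p¹_{a-i,b} : ℂ^{n-1} → (∧_{n-1}†)^{(r-1)} I` (`0 ≤ i ≤ a`) satisfying the compatibility
conditions `∂_z̃ p⁰_{a,b-j} = 0` and `∂_z̃† p¹_{a-i,b} = 0`, there is a unique Hermitean
monogenic homogeneous polynomial `M_{a,b} : ℂⁿ → (∧_n†)^{(r)} I` of bidegree `(a,b)` with
(i) `M|_{z_n=0} = p⁰_{a,b} + 𝔣_n† p¹_{a,b}`;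
(ii) `∂_{z_n^c}^j M|_{z_n=0} = p⁰_{a,b-j} - 𝔣_n† ∂_z̃† p⁰_{a,b-j+1}` for `1 ≤ j ≤ b`;
(iii) `∂_{z_n}^i M|_{z_n=0} = ∂_z̃ p¹_{a-i+1,b} + 𝔣_n† p¹_{a-i,b}` for `1 ≤ i ≤ a`.
Here `p0 j` denotes `p⁰_{a,b-j}` and `p1 i` denotes `p¹_{a-i,b}`. -/
theorem ck_extension_hermitean (n : ℕ) (hn : 2 ≤ n) (r : ℕ) (hr0 : 0 < r) (hrn : r < n)
    (a b : ℕ)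
    (p0 : ℕ → (Fin (n - 1) → ℂ) → Cl n)
    (p1 : ℕ → (Fin (n - 1) → ℂ) → Cl n)
    (hp0 : ∀ j ≤ b, IsBihom n (n - 1) a (b - j) (p0 j) ∧
      (∀ x, p0 j x ∈ LamT n r) ∧ (∀ x, dzT n (p0 j) x = 0))
    (hp1 : ∀ i ≤ a, IsBihom n (n - 1) (a - i) b (p1 i) ∧
      (∀ x, p1 i x ∈ LamT n (r - 1)) ∧ (∀ x, dzdT n (p1 i) x = 0)) :
    ∃! M : (Fin n → ℂ) → Cl n,
      IsBihom n n a b M ∧ (∀ z, M z ∈ Lam n r) ∧ HMonogenic n M ∧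
      (∀ x, M (embC n x) = p0 0 x + ffd n ⟨n - 1, by omega⟩ * p1 0 x) ∧
      (∀ j, 1 ≤ j → j ≤ b → ∀ x, (pzc (⟨n - 1, by omega⟩ : Fin n))^[j] M (embC n x) =
        p0 j x - ffd n ⟨n - 1, by omega⟩ * dzdT n (p0 (j - 1)) x) ∧
      (∀ i, 1 ≤ i → i ≤ a → ∀ x, (pz (⟨n - 1, by omega⟩ : Fin n))^[i] M (embC n x) =
        dzT n (p1 (i - 1)) x + ffd n ⟨n - 1, by omega⟩ * p1 i x) := by
  obtain ⟨s, rfl⟩ : ∃ s, r = s + 1 := ⟨r - 1, by omega⟩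
  rw [Nat.add_sub_cancel] at hp1
  have hn0 : 0 < n := by omega
  set q0 : ℕ → (Fin (n - 1) → ℂ) → Cl n := fun l => if l ≤ b then p0 l else 0
  set q1 : ℕ → (Fin (n - 1) → ℂ) → Cl n := fun k => if k ≤ a then p1 k else 0
  have e0 (l : ℕ) (hl : l ≤ b) : q0 l = p0 l := if_pos hl
  have e1 (k : ℕ) (hk : k ≤ a) : q1 k = p1 k := if_pos hk
  have h0 (l : ℕ) : q0 l ∈ HermCK.PolB n (n - 1) a (b - l) ∧
      (∀ z, q0 l z ∈ HermCK.Spin n (fun j => (j : ℕ) + 1 < n) (s + 1)) ∧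
      HermCK.tanD true le_rfl (q0 l) = 0 := by
    by_cases hl : l ≤ b
    · obtain ⟨h1, h2, h3⟩ := hp0 l hl
      rw [e0 l hl, ← HermCK.dzT_eq]
      refine ⟨?_, fun z => HermCK.LamT_le_Spin _ (h2 z), funext h3⟩
      have := HermCK.IsBihom.mem_PolB h1
      rwa [Nat.cast_sub hl] at this
    · rw [show q0 l = 0 from if_neg hl]
      exact ⟨Submodule.zero_mem _, fun _ => Submodule.zero_mem _, HermCK.tanD_zero⟩
  have h1 (k : ℕ) : q1 k ∈ HermCK.PolB n (n - 1) (a - k) b ∧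
      (∀ z, q1 k z ∈ HermCK.Spin n (fun j => (j : ℕ) + 1 < n) s) ∧
      HermCK.tanD false le_rfl (q1 k) = 0 := by
    by_cases hk : k ≤ a
    · obtain ⟨h1, h2, h3⟩ := hp1 k hk
      rw [e1 k hk, ← HermCK.dzdT_eq]
      refine ⟨?_, fun z => HermCK.LamT_le_Spin _ (h2 z), funext h3⟩
      have := HermCK.IsBihom.mem_PolB h1
      rwa [Nat.cast_sub hk] at this
    · rw [show q1 k = 0 from if_neg hk]
      exact ⟨Submodule.zero_mem _, fun _ => Submodule.zero_mem _, HermCK.tanD_zero⟩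
  obtain ⟨M, hM, hML, hMm, hM0, hMc, hMz⟩ := HermCK.exists_extension hn0 (fun l => (h0 l).1)
    (fun k => (h1 k).1) (fun l => (h0 l).2.1) (fun k => (h1 k).2.1) (fun l => (h0 l).2.2)
    (fun k => (h1 k).2.2)
  have hM0' : ∀ x, M (embC n x) = p0 0 x + ffd n (HermCK.lst hn0) * p1 0 x := fun x => by
    rw [hM0, e0 0 b.zero_le, e1 0 a.zero_le]
  have hMc' : ∀ j, 1 ≤ j → j ≤ b → ∀ x, (pzc (HermCK.lst hn0))^[j] M (embC n x) =
      p0 j x - ffd n (HermCK.lst hn0) * dzdT n (p0 (j - 1)) x := by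
    intro j hj hjb x
    obtain ⟨j, rfl⟩ := Nat.exists_eq_add_of_le' hj
    rw [hMc, e0 _ hjb, e0 j (by omega), HermCK.dzdT_eq, Nat.add_sub_cancel]
  have hMz' : ∀ i, 1 ≤ i → i ≤ a → ∀ x, (pz (HermCK.lst hn0))^[i] M (embC n x) =
      dzT n (p1 (i - 1)) x + ffd n (HermCK.lst hn0) * p1 i x := by
    intro i hi hia x
    obtain ⟨i, rfl⟩ := Nat.exists_eq_add_of_le' hi
    rw [hMz, e1 _ hia, e1 i (by omega), HermCK.dzT_eq, Nat.add_sub_cancel]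
  refine ⟨M, ⟨HermCK.isBihom_of_mem hM, hML, hMm, hM0', hMc', hMz'⟩, ?_⟩
  rintro M' ⟨hB, -, hm, hi, hii, hiii⟩
  have hM' := HermCK.IsBihom.mem_PolB hB
  have hP := HermCK.PolB_le_Pol hM
  have hP' := HermCK.PolB_le_Pol hM'
  have hNB := Submodule.sub_mem _ hM' hM
  rw [← sub_eq_zero]
  refine HermCK.eq_zero_of_fullD_eq_zero (hn := hn0) hNB (fun ε => ?_) fun ε k x => ?_
  · rw [HermCK.fullD_sub hP' hP]
    cases ε
    · rw [← HermCK.dzdFull_eq, ← HermCK.dzdFull_eq, funext fun z => (hm z).2,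
        funext fun z => (hMm z).2, sub_self]
    · rw [← HermCK.dzFull_eq, ← HermCK.dzFull_eq, funext fun z => (hm z).1,
        funext fun z => (hMm z).1, sub_self]
  · rcases k with _ | k
    · exact sub_eq_zero.2 ((hi x).trans (hM0' x).symm)
    cases ε
    · by_cases hk : k + 1 ≤ b
      · rw [HermCK.iterate_pd_sub hP' hP]
        exact sub_eq_zero.2 ((hii _ k.succ_pos hk x).trans (hMc' _ k.succ_pos hk x).symm)
      · exact congrFun (HermCK.PolB_of_neg (by omega)
          (HermCK.iterate_pzc_memB hNB (HermCK.lst hn0) (k + 1))) _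
    · by_cases hk : k + 1 ≤ a
      · rw [HermCK.iterate_pd_sub hP' hP]
        exact sub_eq_zero.2 ((hiii _ k.succ_pos hk x).trans (hMz' _ k.succ_pos hk x).symm)
      · exact congrFun (HermCK.PolB_of_neg (by omega)
          (HermCK.iterate_pz_memB hNB (HermCK.lst hn0) (k + 1))) _
end
end

section
/- Let n ≥ 2, 0 < r < n, and a, b ≥ 0 be integers. Given a homogeneous polynomial p⁰_{a,b} : ℂ^{n−1} → (∧_{n−1}†)^{(r)} I of bidegree (a,b) satisfying ∂z̃ p⁰_{a,b} = 0, there exists a unique Hermitean monogenic homogeneous polynomial M⁰_{a,b} : ℂⁿ → (∧_n†)^{(r)} I of bidegree (a,b) such that: (i) M⁰_{a,b}|_{z_n = 0} = p⁰_{a,b}; (ii) ∂_{z_n^c} M⁰_{a,b}|_{z_n = 0} = −𝔣_n† ∂z̃† p⁰_{a,b}; (iii) ∂^j_{z_n^c} M⁰_{a,b}|_{z_n = 0} = 0 for j = 2,…,b; (iv) ∂^i_{z_n} M⁰_{a,b}|_{z_n = 0} = 0 for i = 1,…,a. -/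
noncomputable section

section Clifford

lemma polar_negQ (m : ℕ) (x y : Fin m → ℂ) :
    QuadraticMap.polar (negQ ℂ m) x y = -2 * ∑ i, x i * y i := by
  simp only [QuadraticMap.polar, negQ, QuadraticMap.weightedSumSquares_apply, Pi.add_apply,
    smul_eq_mul, Finset.mul_sum, ← Finset.sum_sub_distrib]
  exact Finset.sum_congr rfl fun i _ => by ring

/-- The vector of `ℂ^{2n}` underlying `𝔣_j`. -/
def ffVec (n : ℕ) (j : Fin n) : Fin (n + n) → ℂ :=
  (2⁻¹ : ℂ) • (Pi.single (Fin.castAdd n j) 1 - Complex.I • Pi.single (Fin.natAdd n j) 1)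

/-- The vector of `ℂ^{2n}` underlying `𝔣_j†`. -/
def ffdVec (n : ℕ) (j : Fin n) : Fin (n + n) → ℂ :=
  -((2⁻¹ : ℂ) • (Pi.single (Fin.castAdd n j) 1 + Complex.I • Pi.single (Fin.natAdd n j) 1))

lemma ff_eq_ι (n : ℕ) (j : Fin n) : ff n j = CliffordAlgebra.ι (negQ ℂ (n + n)) (ffVec n j) := by
  simp [ff, e, ffVec]

lemma ffd_eq_ι (n : ℕ) (j : Fin n) :
    ffd n j = CliffordAlgebra.ι (negQ ℂ (n + n)) (ffdVec n j) := by
  simp [ffd, e, ffdVec]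

lemma sum_ffVec (n : ℕ) (j : Fin n) (y : Fin (n + n) → ℂ) :
    ∑ i, ffVec n j i * y i =
      2⁻¹ * (y (Fin.castAdd n j) - Complex.I * y (Fin.natAdd n j)) := by
  simp [ffVec, mul_assoc, sub_mul, Pi.single_apply, Finset.sum_sub_distrib, ← Finset.mul_sum]

lemma sum_ffdVec (n : ℕ) (j : Fin n) (y : Fin (n + n) → ℂ) :
    ∑ i, ffdVec n j i * y i =
      -(2⁻¹ * (y (Fin.castAdd n j) + Complex.I * y (Fin.natAdd n j))) := by
  simp [ffdVec, mul_assoc, add_mul, Pi.single_apply, Finset.sum_add_distrib]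
  ring

lemma castAdd_ne_natAdd {n : ℕ} (j k : Fin n) : Fin.castAdd n j ≠ Fin.natAdd n k := fun h => by
  have := congrArg Fin.val h
  simp only [Fin.val_castAdd, Fin.val_natAdd] at this
  omega

lemma ffVec_castAdd (n : ℕ) (j k : Fin n) :
    ffVec n j (Fin.castAdd n k) = if k = j then 2⁻¹ else 0 := by
  have h := castAdd_ne_natAdd k j
  simp only [ffVec, Pi.smul_apply, Pi.sub_apply, Pi.single_apply, h, if_false, Fin.castAdd_inj]
  split_ifs <;> simp

lemma ffVec_natAdd (n : ℕ) (j k : Fin n) :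
    ffVec n j (Fin.natAdd n k) = if k = j then -(2⁻¹ * Complex.I) else 0 := by
  have h := (castAdd_ne_natAdd j k).symm
  simp only [ffVec, Pi.smul_apply, Pi.sub_apply, Pi.single_apply, h, if_false, Fin.natAdd_inj]
  split_ifs <;> simp

lemma ffdVec_castAdd (n : ℕ) (j k : Fin n) :
    ffdVec n j (Fin.castAdd n k) = if k = j then -2⁻¹ else 0 := by
  have h := castAdd_ne_natAdd k j
  simp only [ffdVec, Pi.neg_apply, Pi.smul_apply, Pi.add_apply, Pi.single_apply, h,
    if_false, Fin.castAdd_inj]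
  split_ifs <;> simp

lemma ffdVec_natAdd (n : ℕ) (j k : Fin n) :
    ffdVec n j (Fin.natAdd n k) = if k = j then -(2⁻¹ * Complex.I) else 0 := by
  have h := (castAdd_ne_natAdd j k).symm
  simp only [ffdVec, Pi.neg_apply, Pi.smul_apply, Pi.add_apply, Pi.single_apply, h,
    if_false, Fin.natAdd_inj]
  split_ifs <;> simp

lemma ff_mul_ff (n : ℕ) (j k : Fin n) : ff n j * ff n k = -(ff n k * ff n j) := by
  rw [eq_neg_iff_add_eq_zero, ff_eq_ι, ff_eq_ι, CliffordAlgebra.ι_mul_ι_add_swap, polar_negQ,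
    sum_ffVec, ffVec_castAdd, ffVec_natAdd, map_eq_zero_iff _ (algebraMap ℂ (Cl n)).injective]
  split_ifs
  · linear_combination 2⁻¹ * (-1 : ℂ) * Complex.I_mul_I
  · simp

lemma ffd_mul_ffd (n : ℕ) (j k : Fin n) : ffd n j * ffd n k = -(ffd n k * ffd n j) := by
  rw [eq_neg_iff_add_eq_zero, ffd_eq_ι, ffd_eq_ι, CliffordAlgebra.ι_mul_ι_add_swap, polar_negQ,
    sum_ffdVec, ffdVec_castAdd, ffdVec_natAdd, map_eq_zero_iff _ (algebraMap ℂ (Cl n)).injective]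
  split_ifs
  · linear_combination 2⁻¹ * (-1 : ℂ) * Complex.I_mul_I
  · simp

lemma ff_mul_ffd (n : ℕ) (j k : Fin n) :
    ff n j * ffd n k + ffd n k * ff n j = if j = k then 1 else 0 := by
  rw [ff_eq_ι, ffd_eq_ι, CliffordAlgebra.ι_mul_ι_add_swap, polar_negQ, sum_ffVec, ffdVec_castAdd,
    ffdVec_natAdd]
  split_ifs
  · rw [← map_one (algebraMap ℂ (Cl n))]
    congr 1
    linear_combination (-2⁻¹ : ℂ) * Complex.I_mul_I
  · simp

lemma ff_mul_ffd_of_ne {n : ℕ} {j k : Fin n} (h : j ≠ k) :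
    ff n j * ffd n k = -(ffd n k * ff n j) := by
  rw [eq_neg_iff_add_eq_zero, ff_mul_ffd, if_neg h]

lemma eq_zero_of_eq_neg_self {E : Type*} [AddCommGroup E] [Module ℂ E] {x : E} (h : x = -x) :
    x = 0 := by
  have h2 : (2 : ℂ) • x = 0 := by
    rw [two_smul]; nth_rewrite 2 [h]; exact add_neg_cancel x
  exact (smul_eq_zero.1 h2).resolve_left two_ne_zero

lemma ff_mul_self (n : ℕ) (j : Fin n) : ff n j * ff n j = 0 :=
  eq_zero_of_eq_neg_self (ff_mul_ff n j j)

lemma ffd_mul_self (n : ℕ) (j : Fin n) : ffd n j * ffd n j = 0 :=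
  eq_zero_of_eq_neg_self (ffd_mul_ffd n j j)

lemma ff_mul_Iel (n : ℕ) (j : Fin n) : ff n j * Iel n = 0 := by
  suffices H : ∀ l : List (Fin n), j ∈ l → ff n j * (l.map fun k => ff n k * ffd n k).prod = 0 from
    H _ (List.mem_finRange j)
  intro l hl
  induction l with
  | nil => simp at hl
  | cons k l ih =>
    rw [List.map_cons, List.prod_cons]
    by_cases h : j = k
    · subst h
      rw [← mul_assoc, ← mul_assoc, ff_mul_self, zero_mul, zero_mul]
    · have hc : ff n j * (ff n k * ffd n k) = (ff n k * ffd n k) * ff n j := by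
        rw [← mul_assoc, ff_mul_ff n j k, neg_mul, mul_assoc, ff_mul_ffd_of_ne h, mul_neg, neg_neg,
          mul_assoc]
      rw [← mul_assoc, hc, mul_assoc, ih ((List.mem_cons.1 hl).resolve_left h), mul_zero]

lemma prod_map_ffd_perm (n : ℕ) {l l' : List (Fin n)} (h : l.Perm l') :
    ∃ ε : ℂ, (l.map (ffd n)).prod = ε • (l'.map (ffd n)).prod := by
  induction h with
  | nil => exact ⟨1, by simp⟩
  | cons x _ ih =>
    obtain ⟨ε, hε⟩ := ih
    exact ⟨ε, by simp [hε]⟩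
  | swap x y l =>
    refine ⟨-1, ?_⟩
    simp only [List.map_cons, List.prod_cons, ← mul_assoc, ffd_mul_ffd n y x]
    simp
  | trans _ _ ih ih' =>
    obtain ⟨ε, hε⟩ := ih
    obtain ⟨ε', hε'⟩ := ih'
    exact ⟨ε * ε', by rw [hε, hε', smul_smul]⟩

lemma sort_insert_perm {n : ℕ} {j : Fin n} {s : Finset (Fin n)} (h : j ∉ s) :
    ((insert j s).sort (· ≤ ·)).Perm (j :: s.sort (· ≤ ·)) := by
  refine (List.perm_ext_iff_of_nodup (Finset.sort_nodup _ _) ?_).2 ?_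
  · simp [h]
  · simp

lemma blade_insert {n : ℕ} {j : Fin n} {s : Finset (Fin n)} (h : j ∉ s) :
    ∃ ε : ℂ, blade n (insert j s) = ε • (ffd n j * blade n s) := by
  obtain ⟨ε, hε⟩ := prod_map_ffd_perm n (sort_insert_perm h)
  exact ⟨ε, by simp [blade, hε, mul_assoc]⟩

lemma ffd_mul_blade {n : ℕ} {j : Fin n} {s : Finset (Fin n)} (h : j ∉ s) :
    ∃ ε : ℂ, ffd n j * blade n s = ε • blade n (insert j s) := by
  obtain ⟨ε, hε⟩ := prod_map_ffd_perm n (sort_insert_perm h).symm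
  refine ⟨ε, ?_⟩
  rw [List.map_cons, List.prod_cons] at hε
  rw [blade, blade, ← mul_assoc, hε, smul_mul_assoc]

lemma ffd_mul_blade_of_mem {n : ℕ} {j : Fin n} {s : Finset (Fin n)} (h : j ∈ s) :
    ffd n j * blade n s = 0 := by
  obtain ⟨ε, hε⟩ := blade_insert (Finset.notMem_erase j s)
  rw [Finset.insert_erase h] at hε
  rw [hε, mul_smul_comm, ← mul_assoc, ffd_mul_self, zero_mul, smul_zero]

lemma ff_mul_blade_of_notMem {n : ℕ} {j : Fin n} {s : Finset (Fin n)} (h : j ∉ s) :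
    ff n j * blade n s = 0 := by
  suffices H : ∀ l : List (Fin n), j ∉ l → ff n j * ((l.map (ffd n)).prod * Iel n) = 0 from
    H _ (by simpa using h)
  intro l hl
  induction l with
  | nil => simp [ff_mul_Iel]
  | cons k l ih =>
    rw [List.mem_cons, not_or] at hl
    rw [List.map_cons, List.prod_cons, mul_assoc, ← mul_assoc, ff_mul_ffd_of_ne hl.1, neg_mul,
      mul_assoc, ih hl.2, mul_zero, neg_zero]

lemma ff_mul_blade {n : ℕ} {j : Fin n} {s : Finset (Fin n)} (h : j ∈ s) :
    ∃ ε : ℂ, ff n j * blade n s = ε • blade n (s.erase j) := by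
  obtain ⟨ε, hε⟩ := blade_insert (Finset.notMem_erase j s)
  rw [Finset.insert_erase h] at hε
  refine ⟨ε, ?_⟩
  have h1 := ff_mul_ffd n j j
  rw [if_pos rfl, ← eq_sub_iff_add_eq] at h1
  rw [hε, mul_smul_comm, ← mul_assoc, h1, sub_mul, one_mul, mul_assoc,
    ff_mul_blade_of_notMem (Finset.notMem_erase j s), mul_zero, sub_zero]

lemma LamT_le_Lam (n r : ℕ) : LamT n r ≤ Lam n r :=
  Submodule.span_mono fun _ ⟨s, hs, _, hx⟩ => ⟨s, hs, hx⟩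

lemma ff_mul_mem_LamT {n r : ℕ} (j : Fin n) {x : Cl n} (hx : x ∈ LamT n (r + 1)) :
    ff n j * x ∈ LamT n r := by
  suffices H : LamT n (r + 1) ≤ (LamT n r).comap (LinearMap.mulLeft ℂ (ff n j)) from H hx
  refine Submodule.span_le.2 ?_
  rintro _ ⟨s, hs, hlt, rfl⟩
  simp only [Submodule.comap_coe, Set.mem_preimage, LinearMap.mulLeft_apply, SetLike.mem_coe]
  by_cases h : j ∈ s
  · obtain ⟨ε, hε⟩ := ff_mul_blade h
    rw [hε]
    refine Submodule.smul_mem _ _ (Submodule.subset_span ⟨_, ?_, ?_, rfl⟩)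
    · rw [Finset.card_erase_of_mem h, hs, Nat.add_sub_cancel]
    · exact fun i hi => hlt i (Finset.mem_of_mem_erase hi)
  · rw [ff_mul_blade_of_notMem h]
    exact Submodule.zero_mem _

lemma ffd_mul_mem_LamT {n r : ℕ} {j : Fin n} (hj : (j : ℕ) + 1 < n) {x : Cl n}
    (hx : x ∈ LamT n r) : ffd n j * x ∈ LamT n (r + 1) := by
  suffices H : LamT n r ≤ (LamT n (r + 1)).comap (LinearMap.mulLeft ℂ (ffd n j)) from H hx
  refine Submodule.span_le.2 ?_
  rintro _ ⟨s, hs, hlt, rfl⟩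
  simp only [Submodule.comap_coe, Set.mem_preimage, LinearMap.mulLeft_apply, SetLike.mem_coe]
  by_cases h : j ∈ s
  · rw [ffd_mul_blade_of_mem h]
    exact Submodule.zero_mem _
  · obtain ⟨ε, hε⟩ := ffd_mul_blade h
    rw [hε]
    refine Submodule.smul_mem _ _ (Submodule.subset_span ⟨_, ?_, ?_, rfl⟩)
    · rw [Finset.card_insert_of_notMem h, hs]
    · intro i hi
      rcases Finset.mem_insert.1 hi with rfl | hi
      exacts [hj, hlt i hi]

lemma ffd_mul_mem_Lam {n r : ℕ} (j : Fin n) {x : Cl n} (hx : x ∈ Lam n r) :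
    ffd n j * x ∈ Lam n (r + 1) := by
  suffices H : Lam n r ≤ (Lam n (r + 1)).comap (LinearMap.mulLeft ℂ (ffd n j)) from H hx
  refine Submodule.span_le.2 ?_
  rintro _ ⟨s, hs, rfl⟩
  simp only [Submodule.comap_coe, Set.mem_preimage, LinearMap.mulLeft_apply, SetLike.mem_coe]
  by_cases h : j ∈ s
  · rw [ffd_mul_blade_of_mem h]
    exact Submodule.zero_mem _
  · obtain ⟨ε, hε⟩ := ffd_mul_blade h
    rw [hε]
    exact Submodule.smul_mem _ _
      (Submodule.subset_span ⟨_, by rw [Finset.card_insert_of_notMem h, hs], rfl⟩)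

lemma ff_last_mul_of_mem_LamT {m r : ℕ} {x : Cl (m + 1)} (hx : x ∈ LamT (m + 1) r) :
    ff (m + 1) (Fin.last m) * x = 0 := by
  suffices H : LamT (m + 1) r ≤ LinearMap.ker (LinearMap.mulLeft ℂ (ff (m + 1) (Fin.last m))) from
    H hx
  refine Submodule.span_le.2 ?_
  rintro _ ⟨s, _, hlt, rfl⟩
  exact ff_mul_blade_of_notMem fun h => by simpa using hlt _ h

end Clifford

section FormalPolynomials

open ComplexConjugate

/-- Exponents of the monomials `z^α (z^c)^β` on `ℂ^m`. -/
abbrev BiExp (m : ℕ) : Type := (Fin m → ℕ) × (Fin m → ℕ)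

/-- The monomial `z ↦ z^α (z^c)^β`, as a multiplicative map. -/
def biMonomial {m : ℕ} (p : BiExp m) : (Fin m → ℂ) →* ℂ where
  toFun z := ∏ j, (z j) ^ p.1 j * conj (z j) ^ p.2 j
  map_one' := by simp
  map_mul' z w := by
    rw [← Finset.prod_mul_distrib]
    exact Finset.prod_congr rfl fun j _ => by simp only [Pi.mul_apply, map_mul, mul_pow]; ring

lemma biMonomial_apply {m : ℕ} (p : BiExp m) (z : Fin m → ℂ) :
    biMonomial p z = ∏ j, (z j) ^ p.1 j * conj (z j) ^ p.2 j := rfl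

lemma pow_mul_conj_pow_injective {k l k' l' : ℕ}
    (h : ∀ c : ℂ, c ^ k * conj c ^ l = c ^ k' * conj c ^ l') : k = k' ∧ l = l' := by
  have h1 : k + l = k' + l' := by
    have h2 := h 2
    simp only [map_ofNat, ← pow_add] at h2
    have h3 : (2 : ℕ) ^ (k + l) = 2 ^ (k' + l') := by exact_mod_cast h2
    exact Nat.pow_right_injective le_rfl h3
  have h2 : ((k : ℤ) + l' : ℤ) = k' + l := by
    have h3 := h (Complex.exp Complex.I)
    rw [← Complex.exp_conj, Complex.conj_I, ← Complex.exp_nat_mul, ← Complex.exp_nat_mul,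
      ← Complex.exp_nat_mul, ← Complex.exp_nat_mul, ← Complex.exp_add, ← Complex.exp_add,
      Complex.exp_eq_exp_iff_exists_int] at h3
    obtain ⟨N, hN⟩ := h3
    have h4 : (((k + l' - (k' + l) : ℤ) : ℝ) : ℂ) * Complex.I =
        ((2 * N * Real.pi : ℝ) : ℂ) * Complex.I := by
      push_cast
      linear_combination hN
    have h5 : ((k + l' - (k' + l) : ℤ) : ℝ) = 2 * N * Real.pi := by
      exact_mod_cast mul_right_cancel₀ Complex.I_ne_zero h4
    by_cases hN0 : N = 0
    · subst hN0
      have h6 : (k + l' - (k' + l) : ℤ) = 0 := by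
        have : ((k + l' - (k' + l) : ℤ) : ℝ) = 0 := by rw [h5]; simp
        exact_mod_cast this
      omega
    · exfalso
      refine (irrational_pi.intCast_mul (m := 2 * N) (by simpa using hN0)) ⟨k + l' - (k' + l), ?_⟩
      push_cast at h5 ⊢
      exact h5
  omega

lemma biMonomial_injective (m : ℕ) :
    Function.Injective (biMonomial : BiExp m → ((Fin m → ℂ) →* ℂ)) := by
  intro p q h
  have key : ∀ j, p.1 j = q.1 j ∧ p.2 j = q.2 j := by
    intro j
    refine pow_mul_conj_pow_injective fun c => ?_
    have h1 := DFunLike.congr_fun h (Pi.mulSingle j c)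
    rw [biMonomial_apply, biMonomial_apply, Fintype.prod_eq_single j,
      Fintype.prod_eq_single j] at h1
    · simpa using h1
    all_goals
      intro i hi
      simp [Pi.mulSingle_eq_of_ne hi]
  exact Prod.ext (funext fun j => (key j).1) (funext fun j => (key j).2)

variable {E : Type*} [AddCommGroup E] [Module ℂ E] {F : Type*} [AddCommGroup F] [Module ℂ F]

/-- Evaluation of formal polynomials in `z`, `z^c` with coefficients in `E`. -/
def evalP (E : Type*) [AddCommGroup E] [Module ℂ E] (m : ℕ) :
    (BiExp m →₀ E) →ₗ[ℂ] ((Fin m → ℂ) → E) :=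
  Finsupp.lsum ℂ fun p => LinearMap.pi fun z => biMonomial p z • LinearMap.id

lemma evalP_single {m : ℕ} (p : BiExp m) (c : E) (z : Fin m → ℂ) :
    evalP E m (Finsupp.single p c) z = biMonomial p z • c := by
  simp [evalP]

lemma evalP_apply {m : ℕ} (t : BiExp m →₀ E) (z : Fin m → ℂ) :
    evalP E m t z = t.sum fun p c => biMonomial p z • c := by
  simp [evalP, Finsupp.sum, Finset.sum_apply]

lemma evalP_mapRange {m : ℕ} (φ : E →ₗ[ℂ] F) (t : BiExp m →₀ E) (z : Fin m → ℂ) :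
    evalP F m (Finsupp.mapRange.linearMap φ t) z = φ (evalP E m t z) := by
  induction t using Finsupp.induction_linear with
  | zero => simp
  | add s t hs ht => simp only [map_add, Pi.add_apply, hs, ht]
  | single p c => simp [evalP_single]

lemma evalP_injective (m : ℕ) : Function.Injective (evalP E m) := by
  have hlin : LinearIndependent ℂ fun p : BiExp m => (biMonomial p : (Fin m → ℂ) → ℂ) :=
    (linearIndependent_monoidHom (Fin m → ℂ) ℂ).comp _ (biMonomial_injective m)
  refine (injective_iff_map_eq_zero _).2 fun t ht => Finsupp.ext fun p => ?_
  refine (Module.forall_dual_apply_eq_zero_iff ℂ _).1 fun φ => ?_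
  have h0 : Finsupp.mapRange.linearMap φ t = 0 := by
    refine (linearIndependent_iff.1 hlin) _ (funext fun z => ?_)
    have h1 := evalP_mapRange φ t z
    rw [ht, evalP_apply] at h1
    simpa [Finsupp.linearCombination_apply, Finsupp.sum, Finset.sum_apply, mul_comm] using h1
  simpa using DFunLike.congr_fun h0 p

lemma coeff_mem_of_evalP_mem {m : ℕ} (W : Submodule ℂ E) {t : BiExp m →₀ E}
    (h : ∀ z, evalP E m t z ∈ W) (p : BiExp m) : t p ∈ W := by
  have h0 : Finsupp.mapRange.linearMap W.mkQ t = 0 := by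
    refine evalP_injective m (funext fun z => ?_)
    rw [evalP_mapRange]
    simpa using h z
  simpa using DFunLike.congr_fun h0 p

lemma evalP_mem_of_coeff_mem {m : ℕ} (W : Submodule ℂ E) {t : BiExp m →₀ E}
    (h : ∀ p, t p ∈ W) (z : Fin m → ℂ) : evalP E m t z ∈ W := by
  rw [evalP_apply]
  exact W.sum_mem fun p _ => W.smul_mem _ (h p)

/-- The formal polynomials of bidegree `(a, b)`; the zero module unless `a, b ≥ 0`. -/
def bihomP (E : Type*) [AddCommGroup E] [Module ℂ E] (m : ℕ) (a b : ℤ) :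
    Submodule ℂ (BiExp m →₀ E) :=
  Finsupp.supported E ℂ
    {p | ((∑ j, p.1 j : ℕ) : ℤ) = a ∧ ((∑ j, p.2 j : ℕ) : ℤ) = b}

lemma biMonomial_smul {m : ℕ} (p : BiExp m) (c : ℂ) (z : Fin m → ℂ) :
    biMonomial p (c • z) = c ^ (∑ j, p.1 j) * conj c ^ (∑ j, p.2 j) * biMonomial p z := by
  simp only [biMonomial_apply, ← Finset.prod_pow_eq_pow_sum, ← Finset.prod_mul_distrib]
  exact Finset.prod_congr rfl fun j _ => by
    simp only [Pi.smul_apply, smul_eq_mul, map_mul, mul_pow]; ring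

lemma mem_bihomP {m : ℕ} {a b : ℤ} {t : BiExp m →₀ E} :
    t ∈ bihomP E m a b ↔ ∀ p, t p ≠ 0 →
      ((∑ j, p.1 j : ℕ) : ℤ) = a ∧ ((∑ j, p.2 j : ℕ) : ℤ) = b := by
  simp [bihomP, Finsupp.mem_supported, Set.subset_def]

lemma mem_bihomP_of_evalP {m : ℕ} {a b : ℕ} {t : BiExp m →₀ E}
    (h : ∀ (c : ℂ) z, evalP E m t (c • z) = (c ^ a * conj c ^ b) • evalP E m t z) :
    t ∈ bihomP E m a b := by
  refine mem_bihomP.2 fun p hp => ?_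
  have key : ∀ c : ℂ, c ^ (∑ j, p.1 j) * conj c ^ (∑ j, p.2 j) = c ^ a * conj c ^ b := by
    intro c
    let S : Module.End ℂ (BiExp m →₀ E) := Finsupp.lsum ℂ fun q : BiExp m =>
      (c ^ (∑ j, q.1 j) * conj c ^ (∑ j, q.2 j)) • Finsupp.lsingle q
    have hS : ∀ (q : BiExp m) (x : E), S (Finsupp.single q x) =
        (c ^ (∑ j, q.1 j) * conj c ^ (∑ j, q.2 j)) • Finsupp.single q x := fun q x => by simp [S]
    have h1 : S t = (c ^ a * conj c ^ b) • t := by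
      refine evalP_injective m (funext fun z => ?_)
      rw [map_smul, Pi.smul_apply, ← h c z]
      clear h hp
      induction t using Finsupp.induction_linear with
      | zero => simp
      | add s t hs ht => simp only [map_add, Pi.add_apply, hs, ht]
      | single q x =>
        rw [hS, map_smul, Pi.smul_apply, evalP_single, evalP_single, biMonomial_smul, smul_smul]
    have h2 : ∀ q : BiExp m, S t q = (c ^ (∑ j, q.1 j) * conj c ^ (∑ j, q.2 j)) • t q := by
      intro q
      clear h hp h1
      induction t using Finsupp.induction_linear with
      | zero => simp
      | add s t hs ht => simp only [map_add, Finsupp.add_apply, hs, ht, smul_add]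
      | single q' x =>
        rw [hS, Finsupp.smul_apply]
        by_cases hq : q' = q
        · subst hq; simp
        · simp [Finsupp.single_eq_of_ne' hq]
    have h3 := h2 p
    rw [h1, Finsupp.smul_apply] at h3
    exact (smul_left_injective ℂ hp h3).symm
  obtain ⟨h1, h2⟩ := pow_mul_conj_pow_injective key
  exact ⟨by rw [h1], by rw [h2]⟩

lemma evalP_smul_of_mem_bihomP {m : ℕ} {a b : ℕ} {t : BiExp m →₀ E} (h : t ∈ bihomP E m a b)
    (c : ℂ) (z : Fin m → ℂ) :
    evalP E m t (c • z) = (c ^ a * conj c ^ b) • evalP E m t z := by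
  rw [evalP_apply, evalP_apply, Finsupp.sum, Finsupp.sum, Finset.smul_sum]
  refine Finset.sum_congr rfl fun p hp => ?_
  obtain ⟨h1, h2⟩ := mem_bihomP.1 h p (Finsupp.mem_support_iff.1 hp)
  rw [biMonomial_smul, Nat.cast_injective h1, Nat.cast_injective h2, mul_smul]

lemma isPolyMap_iff_exists_evalP {n m : ℕ} {f : (Fin m → ℂ) → Cl n} :
    IsPolyMap n m f ↔ ∃ t, evalP (Cl n) m t = f := by
  constructor
  · rintro ⟨N, c, dx, dy, h⟩
    refine ⟨∑ i, Finsupp.single (dx i, dy i) (c i), funext fun z => ?_⟩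
    rw [h, map_sum, Finset.sum_apply]
    simp [evalP_single, biMonomial_apply]
  · rintro ⟨t, rfl⟩
    refine ⟨t.support.card, fun i => t (t.support.equivFin.symm i),
      fun i => (t.support.equivFin.symm i : BiExp m).1,
      fun i => (t.support.equivFin.symm i : BiExp m).2, fun z => ?_⟩
    rw [evalP_apply, Finsupp.sum, ← Finset.sum_coe_sort]
    exact (Equiv.sum_comp t.support.equivFin.symm
      fun p => biMonomial (p : BiExp m) z • t p).symm

lemma isBihom_iff_exists_evalP {n m a b : ℕ} {f : (Fin m → ℂ) → Cl n} :
    IsBihom n m a b f ↔ ∃ t ∈ bihomP (Cl n) m a b, evalP (Cl n) m t = f := by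
  rw [IsBihom, isPolyMap_iff_exists_evalP]
  constructor
  · rintro ⟨⟨t, rfl⟩, h⟩
    exact ⟨t, mem_bihomP_of_evalP h, rfl⟩
  · rintro ⟨t, ht, rfl⟩
    exact ⟨⟨t, rfl⟩, evalP_smul_of_mem_bihomP ht⟩

/-- The formal derivative `∂_{z_j}`. -/
def dzP (E : Type*) [AddCommGroup E] [Module ℂ E] {m : ℕ} (j : Fin m) :
    Module.End ℂ (BiExp m →₀ E) :=
  Finsupp.lsum ℂ fun p => (p.1 j : ℂ) • Finsupp.lsingle (p.1 - Pi.single j 1, p.2)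

/-- The formal derivative `∂_{z_j^c}`. -/
def dzcP (E : Type*) [AddCommGroup E] [Module ℂ E] {m : ℕ} (j : Fin m) :
    Module.End ℂ (BiExp m →₀ E) :=
  Finsupp.lsum ℂ fun p => (p.2 j : ℂ) • Finsupp.lsingle (p.1, p.2 - Pi.single j 1)

lemma dzP_single {m : ℕ} (j : Fin m) (p : BiExp m) (c : E) :
    dzP E j (Finsupp.single p c) =
      (p.1 j : ℂ) • Finsupp.single (p.1 - Pi.single j 1, p.2) c := by
  simp [dzP]

lemma dzcP_single {m : ℕ} (j : Fin m) (p : BiExp m) (c : E) :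
    dzcP E j (Finsupp.single p c) =
      (p.2 j : ℂ) • Finsupp.single (p.1, p.2 - Pi.single j 1) c := by
  simp [dzcP]

lemma sub_single_eq_iff {m : ℕ} {j : Fin m} {α β : Fin m → ℕ} (h : α j ≠ 0) :
    α - Pi.single j 1 = β ↔ α = β + Pi.single j 1 := by
  have h1 : Pi.single j 1 ≤ α := by
    intro i
    by_cases hi : i = j
    · subst hi; simpa using Nat.one_le_iff_ne_zero.2 h
    · simp [hi]
  exact tsub_eq_iff_eq_add_of_le h1

lemma dzP_apply {m : ℕ} (j : Fin m) (t : BiExp m →₀ E) (α β : Fin m → ℕ) :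
    dzP E j t (α, β) = ((α j : ℂ) + 1) • t (α + Pi.single j 1, β) := by
  induction t using Finsupp.induction_linear with
  | zero => simp
  | add s t hs ht => simp only [map_add, Finsupp.add_apply, hs, ht, smul_add]
  | single q c =>
    obtain ⟨α', β'⟩ := q
    rw [dzP_single, Finsupp.smul_apply]
    by_cases h0 : α' j = 0
    · have : (α', β') ≠ (α + Pi.single j 1, β) := by
        rintro h
        have := congrFun (congrArg Prod.fst h) j
        simp [h0] at this
      simp [h0, Finsupp.single_eq_of_ne' this]
    · by_cases h : α' = α + Pi.single j 1 ∧ β' = β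
      · obtain ⟨rfl, rfl⟩ := h
        simp
      · have h1 : (α', β') ≠ (α + Pi.single j 1, β) := fun hh => h (Prod.ext_iff.1 hh)
        have h2 : (α' - Pi.single j 1, β') ≠ (α, β) := fun hh =>
          h ⟨(sub_single_eq_iff h0).1 (Prod.ext_iff.1 hh).1, (Prod.ext_iff.1 hh).2⟩
        simp [Finsupp.single_eq_of_ne' h1, Finsupp.single_eq_of_ne' h2]

lemma dzcP_apply {m : ℕ} (j : Fin m) (t : BiExp m →₀ E) (α β : Fin m → ℕ) :
    dzcP E j t (α, β) = ((β j : ℂ) + 1) • t (α, β + Pi.single j 1) := by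
  induction t using Finsupp.induction_linear with
  | zero => simp
  | add s t hs ht => simp only [map_add, Finsupp.add_apply, hs, ht, smul_add]
  | single q c =>
    obtain ⟨α', β'⟩ := q
    rw [dzcP_single, Finsupp.smul_apply]
    by_cases h0 : β' j = 0
    · have : (α', β') ≠ (α, β + Pi.single j 1) := by
        rintro h
        have := congrFun (congrArg Prod.snd h) j
        simp [h0] at this
      simp [h0, Finsupp.single_eq_of_ne' this]
    · by_cases h : α' = α ∧ β' = β + Pi.single j 1
      · obtain ⟨rfl, rfl⟩ := h
        simp
      · have h1 : (α', β') ≠ (α, β + Pi.single j 1) := fun hh => h (Prod.ext_iff.1 hh)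
        have h2 : (α', β' - Pi.single j 1) ≠ (α, β) := fun hh =>
          h ⟨(Prod.ext_iff.1 hh).1, (sub_single_eq_iff h0).1 (Prod.ext_iff.1 hh).2⟩
        simp [Finsupp.single_eq_of_ne' h1, Finsupp.single_eq_of_ne' h2]

lemma commute_dzP {m : ℕ} (j k : Fin m) : Commute (dzP E j) (dzP E k) := by
  refine LinearMap.ext fun t => Finsupp.ext fun ⟨α, β⟩ => ?_
  simp only [Module.End.mul_apply, dzP_apply, smul_smul, Pi.add_apply, Pi.single_apply]
  rw [add_right_comm]
  congr 1
  by_cases h : j = k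
  · subst h; simp
  · simp [h, Ne.symm h, mul_comm]

lemma commute_dzcP {m : ℕ} (j k : Fin m) : Commute (dzcP E j) (dzcP E k) := by
  refine LinearMap.ext fun t => Finsupp.ext fun ⟨α, β⟩ => ?_
  simp only [Module.End.mul_apply, dzcP_apply, smul_smul, Pi.add_apply, Pi.single_apply]
  rw [add_right_comm]
  congr 1
  by_cases h : j = k
  · subst h; simp
  · simp [h, Ne.symm h, mul_comm]

lemma dzP_mem_bihomP {m : ℕ} {a b : ℤ} (j : Fin m) {t : BiExp m →₀ E} (h : t ∈ bihomP E m a b) :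
    dzP E j t ∈ bihomP E m (a - 1) b := by
  refine mem_bihomP.2 fun ⟨α, β⟩ hp => ?_
  rw [dzP_apply] at hp
  obtain ⟨h1, h2⟩ := mem_bihomP.1 h _ (right_ne_zero_of_smul hp)
  simp only [Pi.add_apply, Finset.sum_add_distrib, Finset.sum_pi_single', Finset.mem_univ,
    if_true] at h1
  exact ⟨by push_cast at h1 ⊢; linarith, h2⟩

lemma dzcP_mem_bihomP {m : ℕ} {a b : ℤ} (j : Fin m) {t : BiExp m →₀ E} (h : t ∈ bihomP E m a b) :
    dzcP E j t ∈ bihomP E m a (b - 1) := by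
  refine mem_bihomP.2 fun ⟨α, β⟩ hp => ?_
  rw [dzcP_apply] at hp
  obtain ⟨h1, h2⟩ := mem_bihomP.1 h _ (right_ne_zero_of_smul hp)
  simp only [Pi.add_apply, Finset.sum_add_distrib, Finset.sum_pi_single', Finset.mem_univ,
    if_true] at h2
  exact ⟨h1, by push_cast at h2 ⊢; linarith⟩

lemma eq_zero_of_mem_bihomP_of_neg {m : ℕ} {a b : ℤ} (ha : a < 0) {t : BiExp m →₀ E}
    (h : t ∈ bihomP E m a b) : t = 0 := by
  refine Finsupp.ext fun p => ?_
  by_contra hp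
  have := (mem_bihomP.1 h p hp).1
  omega

end FormalPolynomials

section DirectionalDerivatives

open ComplexConjugate

lemma HasDirDeriv.unique {n m : ℕ} {f : (Fin m → ℂ) → Cl n} {z v : Fin m → ℂ} {d d' : Cl n}
    (h : HasDirDeriv f z v d) (h' : HasDirDeriv f z v d') : d = d' := by
  rw [← sub_eq_zero]
  refine (Module.forall_dual_apply_eq_zero_iff ℂ _).1 fun φ => ?_
  rw [map_sub, (h φ).unique (h' φ), sub_self]

lemma HasDirDeriv.dirDeriv_eq {n m : ℕ} {f : (Fin m → ℂ) → Cl n} {z v : Fin m → ℂ} {d : Cl n}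
    (h : HasDirDeriv f z v d) : dirDeriv f v z = d :=
  HasDirDeriv.unique (Classical.epsilon_spec ⟨d, h⟩) h

lemma hasDerivAt_biMonomial_line {m : ℕ} (p : BiExp m) (z : Fin m → ℂ) (j : Fin m) (u : ℂ) :
    HasDerivAt (fun t : ℝ => biMonomial p (z + t • (Pi.single j u : Fin m → ℂ)))
      (u * (p.1 j * biMonomial (p.1 - Pi.single j 1, p.2) z) +
        conj u * (p.2 j * biMonomial (p.1, p.2 - Pi.single j 1) z)) 0 := by
  have hlin : HasDerivAt (fun t : ℝ => z j + (t : ℂ) * u) u 0 := by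
    simpa using (((hasDerivAt_id (0 : ℝ)).ofReal_comp).mul_const u).const_add (z j)
  have hconj : HasDerivAt (fun t : ℝ => conj (z j + (t : ℂ) * u)) (conj u) 0 := by
    have h := (((hasDerivAt_id (0 : ℝ)).ofReal_comp).mul_const (conj u)).const_add (conj (z j))
    simpa using h
  have hprod : ∀ (q : BiExp m) (w : Fin m → ℂ), biMonomial q w =
      (w j ^ q.1 j * conj (w j) ^ q.2 j) *
        ∏ i ∈ Finset.univ.erase j, (w i ^ q.1 i * conj (w i) ^ q.2 i) := fun q w => by
    exact (Finset.mul_prod_erase _ (fun i => w i ^ q.1 i * conj (w i) ^ q.2 i)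
      (Finset.mem_univ j)).symm
  have hfun : (fun t : ℝ => biMonomial p (z + t • (Pi.single j u : Fin m → ℂ))) = fun t : ℝ =>
      ((z j + (t : ℂ) * u) ^ p.1 j * conj (z j + (t : ℂ) * u) ^ p.2 j) *
        ∏ i ∈ Finset.univ.erase j, (z i ^ p.1 i * conj (z i) ^ p.2 i) := by
    funext t
    rw [hprod]
    congr 1
    · simp
    · refine Finset.prod_congr rfl fun i hi => ?_
      simp [Finset.ne_of_mem_erase hi]
  have herase : ∀ α β : Fin m → ℕ, (∀ i ≠ j, α i = p.1 i) → (∀ i ≠ j, β i = p.2 i) →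
      ∏ i ∈ Finset.univ.erase j, (z i ^ α i * conj (z i) ^ β i) =
        ∏ i ∈ Finset.univ.erase j, (z i ^ p.1 i * conj (z i) ^ p.2 i) := fun α β hα hβ =>
    Finset.prod_congr rfl fun i hi => by
      rw [hα i (Finset.ne_of_mem_erase hi), hβ i (Finset.ne_of_mem_erase hi)]
  rw [hfun, hprod, hprod,
    herase (p.1 - Pi.single j 1) p.2 (fun i hi => by simp [hi]) (fun i _ => rfl),
    herase p.1 (p.2 - Pi.single j 1) (fun i _ => rfl) (fun i hi => by simp [hi])]
  refine (((hlin.pow (p.1 j)).mul (hconj.pow (p.2 j))).mul_const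
    (∏ i ∈ Finset.univ.erase j, (z i ^ p.1 i * conj (z i) ^ p.2 i))).congr_deriv ?_
  simp
  ring

lemma hasDirDeriv_evalP {n m : ℕ} (t : BiExp m →₀ Cl n) (z : Fin m → ℂ) (j : Fin m) (u : ℂ) :
    HasDirDeriv (evalP (Cl n) m t) z (Pi.single j u)
      (u • evalP (Cl n) m (dzP (Cl n) j t) z + conj u • evalP (Cl n) m (dzcP (Cl n) j t) z) := by
  intro φ
  induction t using Finsupp.induction_linear with
  | zero => simpa using hasDerivAt_const (0 : ℝ) (0 : ℂ)
  | add s t hs ht =>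
    have h := hs.add ht
    simp only [map_add, Pi.add_apply, smul_add] at h ⊢
    exact h.congr_deriv (by ring)
  | single p c =>
    have h := (hasDerivAt_biMonomial_line p z j u).mul_const (φ c)
    simp only [dzP_single, dzcP_single, map_smul, Pi.smul_apply, evalP_single, map_add, smul_eq_mul]
    exact h.congr_deriv (by ring)

lemma pz_evalP {n m : ℕ} (j : Fin m) (t : BiExp m →₀ Cl n) :
    pz j (evalP (Cl n) m t) = evalP (Cl n) m (dzP (Cl n) j t) := by
  funext z
  rw [pz, (hasDirDeriv_evalP t z j 1).dirDeriv_eq, (hasDirDeriv_evalP t z j Complex.I).dirDeriv_eq]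
  simp only [Complex.conj_I, map_one, smul_add, smul_smul, mul_neg, Complex.I_mul_I]
  module

lemma pzc_evalP {n m : ℕ} (j : Fin m) (t : BiExp m →₀ Cl n) :
    pzc j (evalP (Cl n) m t) = evalP (Cl n) m (dzcP (Cl n) j t) := by
  funext z
  rw [pzc, (hasDirDeriv_evalP t z j 1).dirDeriv_eq,
    (hasDirDeriv_evalP t z j Complex.I).dirDeriv_eq]
  simp only [Complex.conj_I, map_one, smul_add, smul_smul, mul_neg, Complex.I_mul_I]
  module

lemma pz_iterate_evalP {n m : ℕ} (j : Fin m) (i : ℕ) (t : BiExp m →₀ Cl n) :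
    (pz j)^[i] (evalP (Cl n) m t) = evalP (Cl n) m ((dzP (Cl n) j)^[i] t) := by
  induction i generalizing t with
  | zero => rfl
  | succ i ih => rw [Function.iterate_succ_apply, Function.iterate_succ_apply, pz_evalP, ih]

lemma pzc_iterate_evalP {n m : ℕ} (j : Fin m) (i : ℕ) (t : BiExp m →₀ Cl n) :
    (pzc j)^[i] (evalP (Cl n) m t) = evalP (Cl n) m ((dzcP (Cl n) j)^[i] t) := by
  induction i generalizing t with
  | zero => rfl
  | succ i ih => rw [Function.iterate_succ_apply, Function.iterate_succ_apply, pzc_evalP, ih]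

end DirectionalDerivatives

section LastVariable

variable {E : Type*} [AddCommGroup E] [Module ℂ E] {F : Type*} [AddCommGroup F] [Module ℂ F]

/-- Extension of formal polynomials on `ℂ^m` to `ℂ^{m+1}`, with multiplication by
`z_{m+1}^k (z_{m+1}^c)^l / (k! l!)`. -/
def liftP (E : Type*) [AddCommGroup E] [Module ℂ E] {m : ℕ} (k l : ℕ) :
    (BiExp m →₀ E) →ₗ[ℂ] (BiExp (m + 1) →₀ E) :=
  Finsupp.lsum ℂ fun p => ((k.factorial : ℂ)⁻¹ * (l.factorial : ℂ)⁻¹) •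
    Finsupp.lsingle ((Fin.snoc p.1 k : Fin (m + 1) → ℕ), (Fin.snoc p.2 l : Fin (m + 1) → ℕ))

lemma liftP_single {m : ℕ} (k l : ℕ) (p : BiExp m) (c : E) :
    liftP E k l (Finsupp.single p c) = ((k.factorial : ℂ)⁻¹ * (l.factorial : ℂ)⁻¹) •
      Finsupp.single
        ((Fin.snoc p.1 k : Fin (m + 1) → ℕ), (Fin.snoc p.2 l : Fin (m + 1) → ℕ)) c := by
  simp [liftP]

lemma snoc_sub_single_last {m : ℕ} (α : Fin m → ℕ) (k : ℕ) :
    (Fin.snoc α k : Fin (m + 1) → ℕ) - Pi.single (Fin.last m) 1 = Fin.snoc α (k - 1) := by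
  funext i
  refine Fin.lastCases ?_ (fun i => ?_) i
  · simp
  · simp [Fin.castSucc_ne_last]

lemma snoc_sub_single_castSucc {m : ℕ} (α : Fin m → ℕ) (k : ℕ) (j : Fin m) :
    (Fin.snoc α k : Fin (m + 1) → ℕ) - Pi.single j.castSucc 1 =
      Fin.snoc (α - Pi.single j 1) k := by
  funext i
  refine Fin.lastCases ?_ (fun i => ?_) i
  · simp [(Fin.castSucc_ne_last j).symm]
  · simp [Pi.single_apply]

lemma dzP_castSucc_liftP {m : ℕ} (j : Fin m) (k l : ℕ) (t : BiExp m →₀ E) :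
    dzP E j.castSucc (liftP E k l t) = liftP E k l (dzP E j t) := by
  induction t using Finsupp.induction_linear with
  | zero => simp
  | add s t hs ht => simp only [map_add, hs, ht]
  | single p c =>
    simp only [liftP_single, dzP_single, map_smul, snoc_sub_single_castSucc, Fin.snoc_castSucc]
    rw [smul_comm]

lemma dzcP_castSucc_liftP {m : ℕ} (j : Fin m) (k l : ℕ) (t : BiExp m →₀ E) :
    dzcP E j.castSucc (liftP E k l t) = liftP E k l (dzcP E j t) := by
  induction t using Finsupp.induction_linear with
  | zero => simp
  | add s t hs ht => simp only [map_add, hs, ht]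
  | single p c =>
    simp only [liftP_single, dzcP_single, map_smul, snoc_sub_single_castSucc, Fin.snoc_castSucc]
    rw [smul_comm]

lemma dzP_last_liftP_zero {m : ℕ} (l : ℕ) (t : BiExp m →₀ E) :
    dzP E (Fin.last m) (liftP E 0 l t) = 0 := by
  induction t using Finsupp.induction_linear with
  | zero => simp
  | add s t hs ht => simp only [map_add, hs, ht, add_zero]
  | single p c => simp [liftP_single, dzP_single]

lemma dzcP_last_liftP_zero {m : ℕ} (k : ℕ) (t : BiExp m →₀ E) :
    dzcP E (Fin.last m) (liftP E k 0 t) = 0 := by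
  induction t using Finsupp.induction_linear with
  | zero => simp
  | add s t hs ht => simp only [map_add, hs, ht, add_zero]
  | single p c => simp [liftP_single, dzcP_single]

lemma inv_factorial_succ (k : ℕ) :
    ((k + 1).factorial : ℂ)⁻¹ * ((k + 1 : ℕ) : ℂ) = (k.factorial : ℂ)⁻¹ := by
  have h : ((k + 1 : ℕ) : ℂ) ≠ 0 := Nat.cast_ne_zero.2 k.succ_ne_zero
  rw [Nat.factorial_succ, Nat.cast_mul, mul_inv, mul_comm, ← mul_assoc, mul_inv_cancel₀ h, one_mul]

lemma dzP_last_liftP_succ {m : ℕ} (k l : ℕ) (t : BiExp m →₀ E) :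
    dzP E (Fin.last m) (liftP E (k + 1) l t) = liftP E k l t := by
  induction t using Finsupp.induction_linear with
  | zero => simp
  | add s t hs ht => simp only [map_add, hs, ht]
  | single p c =>
    simp only [liftP_single, dzP_single, map_smul, snoc_sub_single_last, Fin.snoc_last, smul_smul,
      Nat.add_sub_cancel]
    rw [mul_right_comm, inv_factorial_succ]

lemma dzcP_last_liftP_succ {m : ℕ} (k l : ℕ) (t : BiExp m →₀ E) :
    dzcP E (Fin.last m) (liftP E k (l + 1) t) = liftP E k l t := by
  induction t using Finsupp.induction_linear with
  | zero => simp
  | add s t hs ht => simp only [map_add, hs, ht]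
  | single p c =>
    simp only [liftP_single, dzcP_single, map_smul, snoc_sub_single_last, Fin.snoc_last, smul_smul,
      Nat.add_sub_cancel]
    rw [mul_assoc, inv_factorial_succ]

lemma mapRange_liftP {m : ℕ} (φ : E →ₗ[ℂ] F) (k l : ℕ) (t : BiExp m →₀ E) :
    Finsupp.mapRange.linearMap φ (liftP E k l t) =
      liftP F k l (Finsupp.mapRange.linearMap φ t) := by
  induction t using Finsupp.induction_linear with
  | zero => simp
  | add s t hs ht => simp only [map_add, hs, ht]
  | single p c => simp [liftP_single]

lemma mapRange_dzP {m : ℕ} (φ : E →ₗ[ℂ] F) (j : Fin m) (t : BiExp m →₀ E) :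
    Finsupp.mapRange.linearMap φ (dzP E j t) = dzP F j (Finsupp.mapRange.linearMap φ t) := by
  ext ⟨α, β⟩
  simp [dzP_apply]

lemma mapRange_dzcP {m : ℕ} (φ : E →ₗ[ℂ] F) (j : Fin m) (t : BiExp m →₀ E) :
    Finsupp.mapRange.linearMap φ (dzcP E j t) = dzcP F j (Finsupp.mapRange.linearMap φ t) := by
  ext ⟨α, β⟩
  simp [dzcP_apply]

lemma mapRange_mem_bihomP {m : ℕ} (φ : E →ₗ[ℂ] F) {a b : ℤ} {t : BiExp m →₀ E}
    (h : t ∈ bihomP E m a b) : Finsupp.mapRange.linearMap φ t ∈ bihomP F m a b := by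
  refine mem_bihomP.2 fun p hp => mem_bihomP.1 h p fun h0 => hp ?_
  simp [h0]

lemma liftP_mem_bihomP {m : ℕ} {a b : ℤ} (k l : ℕ) {t : BiExp m →₀ E} (h : t ∈ bihomP E m a b) :
    liftP E k l t ∈ bihomP E (m + 1) (a + k) (b + l) := by
  rw [← Finsupp.sum_single t, Finsupp.sum, map_sum]
  refine Submodule.sum_mem _ fun p hp => ?_
  rw [liftP_single]
  refine Submodule.smul_mem _ _ (Finsupp.single_mem_supported ℂ _ ?_)
  obtain ⟨h1, h2⟩ := mem_bihomP.1 h p (Finsupp.mem_support_iff.1 hp)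
  simp [Fin.sum_univ_castSucc, ← h1, ← h2]

lemma coeff_liftP_mem {m : ℕ} (W : Submodule ℂ E) (k l : ℕ) {t : BiExp m →₀ E}
    (h : ∀ p, t p ∈ W) (q : BiExp (m + 1)) : liftP E k l t q ∈ W := by
  have h0 : Finsupp.mapRange.linearMap W.mkQ t = 0 := by ext p; simpa using h p
  have h1 := mapRange_liftP W.mkQ k l t
  rw [h0, map_zero] at h1
  simpa using DFunLike.congr_fun h1 q

/-- Restriction of formal polynomials on `ℂ^{m+1}` to `z_{m+1} = 0`. -/
def restrictP (E : Type*) [AddCommGroup E] [Module ℂ E] (m : ℕ) :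
    (BiExp (m + 1) →₀ E) →ₗ[ℂ] (BiExp m →₀ E) :=
  Finsupp.lsum ℂ fun p => if p.1 (Fin.last m) = 0 ∧ p.2 (Fin.last m) = 0 then
    Finsupp.lsingle (Fin.init p.1, Fin.init p.2) else 0

lemma restrictP_single {m : ℕ} (p : BiExp (m + 1)) (c : E) :
    restrictP E m (Finsupp.single p c) = if p.1 (Fin.last m) = 0 ∧ p.2 (Fin.last m) = 0 then
      Finsupp.single (Fin.init p.1, Fin.init p.2) c else 0 := by
  simp only [restrictP, Finsupp.lsum_single]
  split_ifs <;> simp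

lemma embC_eq_snoc {m : ℕ} (x : Fin m → ℂ) : embC (m + 1) x = (Fin.snoc x 0 : Fin (m + 1) → ℂ) := by
  funext i
  refine Fin.lastCases ?_ (fun i => ?_) i
  · simp [embC]
  · simp [embC]

lemma evalP_embC {m : ℕ} (t : BiExp (m + 1) →₀ E) (x : Fin m → ℂ) :
    evalP E (m + 1) t (embC (m + 1) x) = evalP E m (restrictP E m t) x := by
  rw [embC_eq_snoc]
  induction t using Finsupp.induction_linear with
  | zero => simp
  | add s t hs ht => simp only [map_add, Pi.add_apply, hs, ht]
  | single p c =>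
    rw [restrictP_single, evalP_single, biMonomial_apply, Fin.prod_univ_castSucc]
    split_ifs with h
    · simp [evalP_single, biMonomial_apply, h.1, h.2, Fin.init]
    · rcases not_and_or.1 h with h | h <;> simp [h]

lemma restrictP_apply {m : ℕ} (t : BiExp (m + 1) →₀ E) {α β : Fin (m + 1) → ℕ}
    (hα : α (Fin.last m) = 0) (hβ : β (Fin.last m) = 0) :
    restrictP E m t (Fin.init α, Fin.init β) = t (α, β) := by
  induction t using Finsupp.induction_linear with
  | zero => simp
  | add s t hs ht => simp only [map_add, Finsupp.add_apply, hs, ht]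
  | single p c =>
    obtain ⟨α', β'⟩ := p
    rw [restrictP_single]
    have hinit : ∀ {γ δ : Fin (m + 1) → ℕ}, γ (Fin.last m) = 0 → δ (Fin.last m) = 0 →
        (Fin.init γ : Fin m → ℕ) = Fin.init δ → γ = δ := fun {γ δ} hγ hδ h => by
      rw [← Fin.snoc_init_self γ, ← Fin.snoc_init_self δ, h, hγ, hδ]
    split_ifs with h
    · by_cases he : (α', β') = (α, β)
      · obtain ⟨rfl, rfl⟩ := Prod.ext_iff.1 he
        simp
      · rw [Finsupp.single_eq_of_ne' he, Finsupp.single_eq_of_ne']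
        intro hh
        obtain ⟨h1, h2⟩ := Prod.ext_iff.1 hh
        exact he (Prod.ext (hinit h.1 hα h1) (hinit h.2 hβ h2))
    · rw [Finsupp.zero_apply, Finsupp.single_eq_of_ne']
      intro hh
      obtain ⟨rfl, rfl⟩ := Prod.ext_iff.1 hh
      exact h ⟨hα, hβ⟩

lemma restrictP_liftP {m : ℕ} (k l : ℕ) (t : BiExp m →₀ E) :
    restrictP E m (liftP E k l t) = if k = 0 ∧ l = 0 then t else 0 := by
  induction t using Finsupp.induction_linear with
  | zero => simp
  | add s t hs ht => simp only [map_add, hs, ht]; split_ifs <;> simp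
  | single p c =>
    rw [liftP_single, map_smul, restrictP_single]
    simp only [Fin.snoc_last, Fin.init_snoc]
    split_ifs with h
    · simp [h.1, h.2]
    · simp

lemma restrictP_dzcP_iterate_liftP {m : ℕ} (j k l : ℕ) (t : BiExp m →₀ E) :
    restrictP E m ((dzcP E (Fin.last m))^[j] (liftP E k l t)) = if k = 0 ∧ l = j then t else 0 := by
  induction j generalizing l with
  | zero => exact restrictP_liftP k l t
  | succ j ih =>
    rw [Function.iterate_succ_apply]
    cases l with
    | zero => rw [dzcP_last_liftP_zero, iterate_map_zero, map_zero]; simp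
    | succ l => rw [dzcP_last_liftP_succ, ih]; simp

lemma restrictP_dzP_iterate_liftP {m : ℕ} (i k l : ℕ) (t : BiExp m →₀ E) :
    restrictP E m ((dzP E (Fin.last m))^[i] (liftP E k l t)) = if k = i ∧ l = 0 then t else 0 := by
  induction i generalizing k with
  | zero => exact restrictP_liftP k l t
  | succ i ih =>
    rw [Function.iterate_succ_apply]
    cases k with
    | zero => rw [dzP_last_liftP_zero, iterate_map_zero, map_zero]; simp
    | succ k => rw [dzP_last_liftP_succ, ih]; simp

lemma restrictP_mapRange {m : ℕ} (φ : E →ₗ[ℂ] F) (t : BiExp (m + 1) →₀ E) :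
    restrictP F m (Finsupp.mapRange.linearMap φ t) =
      Finsupp.mapRange.linearMap φ (restrictP E m t) := by
  refine evalP_injective m (funext fun x => ?_)
  rw [← evalP_embC, evalP_mapRange, evalP_mapRange, evalP_embC]

lemma coeff_eq_zero_of_dzP_iterate {m : ℕ} (j : Fin m) (i : ℕ) {t : BiExp m →₀ E}
    {α β : Fin m → ℕ} (h : (dzP E j)^[i] t (α, β) = 0) : t (α + Pi.single j i, β) = 0 := by
  induction i generalizing t with
  | zero => simpa using h
  | succ i ih =>
    have h1 := ih (t := dzP E j t) h
    rw [dzP_apply, add_assoc, ← Pi.single_add] at h1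
    exact (smul_eq_zero.1 h1).resolve_left (Nat.cast_add_one_ne_zero _)

lemma coeff_eq_zero_of_dzcP_iterate {m : ℕ} (j : Fin m) (i : ℕ) {t : BiExp m →₀ E}
    {α β : Fin m → ℕ} (h : (dzcP E j)^[i] t (α, β) = 0) : t (α, β + Pi.single j i) = 0 := by
  induction i generalizing t with
  | zero => simpa using h
  | succ i ih =>
    have h1 := ih (t := dzcP E j t) h
    rw [dzcP_apply, add_assoc, ← Pi.single_add] at h1
    exact (smul_eq_zero.1 h1).resolve_left (Nat.cast_add_one_ne_zero _)

end LastVariable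

section HermiteanDirac

/-- Left multiplication of the coefficients of a formal polynomial by `x`. -/
def leftMulP {n m : ℕ} (x : Cl n) : Module.End ℂ (BiExp m →₀ Cl n) :=
  Finsupp.mapRange.linearMap (LinearMap.mulLeft ℂ x)

lemma leftMulP_apply {n m : ℕ} (x : Cl n) (t : BiExp m →₀ Cl n) (p : BiExp m) :
    leftMulP x t p = x * t p := by
  simp [leftMulP]

lemma dzP_leftMulP {n m : ℕ} (x : Cl n) (j : Fin m) (t : BiExp m →₀ Cl n) :
    dzP (Cl n) j (leftMulP x t) = leftMulP x (dzP (Cl n) j t) :=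
  (mapRange_dzP _ j t).symm

lemma dzcP_leftMulP {n m : ℕ} (x : Cl n) (j : Fin m) (t : BiExp m →₀ Cl n) :
    dzcP (Cl n) j (leftMulP x t) = leftMulP x (dzcP (Cl n) j t) :=
  (mapRange_dzcP _ j t).symm

/-- The formal Dirac operator `∑_j x_j d_j`. -/
def diracP {n m : ℕ} (x : Fin m → Cl n) (d : Fin m → Module.End ℂ (BiExp m →₀ Cl n)) :
    Module.End ℂ (BiExp m →₀ Cl n) :=
  ∑ j, leftMulP (x j) * d j

lemma diracP_apply {n m : ℕ} (x : Fin m → Cl n) (d : Fin m → Module.End ℂ (BiExp m →₀ Cl n))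
    (t : BiExp m →₀ Cl n) : diracP x d t = ∑ j, leftMulP (x j) (d j t) := by
  simp [diracP]

lemma diracP_diracP {n m : ℕ} {x : Fin m → Cl n} {d : Fin m → Module.End ℂ (BiExp m →₀ Cl n)}
    (hx : ∀ j k, x j * x k = -(x k * x j)) (hd : ∀ j k, Commute (d j) (d k))
    (hc : ∀ y j t, d j (leftMulP y t) = leftMulP y (d j t)) (t : BiExp m →₀ Cl n) :
    diracP x d (diracP x d t) = 0 := by
  apply eq_zero_of_eq_neg_self
  simp only [diracP_apply, map_sum, hc]
  conv_lhs => rw [Finset.sum_comm]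
  rw [← Finset.sum_neg_distrib]
  refine Finset.sum_congr rfl fun j _ => ?_
  rw [← Finset.sum_neg_distrib]
  refine Finset.sum_congr rfl fun k _ => Finsupp.ext fun p => ?_
  have h : d k (d j t) = d j (d k t) := LinearMap.congr_fun (hd k j).eq t
  rw [Finsupp.neg_apply, leftMulP_apply, leftMulP_apply, leftMulP_apply, leftMulP_apply,
    ← mul_assoc, ← mul_assoc, hx k j, neg_mul, neg_neg, h]

lemma dzFull_evalP {n : ℕ} (t : BiExp n →₀ Cl n) (z : Fin n → ℂ) :
    dzFull n (evalP (Cl n) n t) z =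
      evalP (Cl n) n (diracP (ffd n) (dzP (Cl n)) t) z := by
  rw [dzFull, diracP_apply, map_sum, Finset.sum_apply]
  refine Finset.sum_congr rfl fun j _ => ?_
  rw [pz_evalP, leftMulP, evalP_mapRange, LinearMap.mulLeft_apply]

lemma dzdFull_evalP {n : ℕ} (t : BiExp n →₀ Cl n) (z : Fin n → ℂ) :
    dzdFull n (evalP (Cl n) n t) z =
      evalP (Cl n) n (diracP (ff n) (dzcP (Cl n)) t) z := by
  rw [dzdFull, diracP_apply, map_sum, Finset.sum_apply]
  refine Finset.sum_congr rfl fun j _ => ?_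
  rw [pzc_evalP, leftMulP, evalP_mapRange, LinearMap.mulLeft_apply]

lemma dzT_evalP {m : ℕ} (t : BiExp m →₀ Cl (m + 1)) (x : Fin m → ℂ) :
    dzT (m + 1) (evalP (Cl (m + 1)) m t) x =
      evalP (Cl (m + 1)) m
        (diracP (fun j => ffd (m + 1) (Fin.castSucc j)) (dzP (Cl (m + 1))) t) x := by
  rw [diracP_apply, map_sum, Finset.sum_apply]
  refine Finset.sum_congr rfl fun j _ => ?_
  rw [leftMulP, evalP_mapRange, LinearMap.mulLeft_apply, ← pz_evalP]
  rfl

lemma dzdT_evalP {m : ℕ} (t : BiExp m →₀ Cl (m + 1)) (x : Fin m → ℂ) :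
    dzdT (m + 1) (evalP (Cl (m + 1)) m t) x =
      evalP (Cl (m + 1)) m
        (diracP (fun j => ff (m + 1) (Fin.castSucc j)) (dzcP (Cl (m + 1))) t) x := by
  rw [diracP_apply, map_sum, Finset.sum_apply]
  refine Finset.sum_congr rfl fun j _ => ?_
  rw [leftMulP, evalP_mapRange, LinearMap.mulLeft_apply, ← pzc_evalP]
  rfl

lemma hMonogenic_evalP_iff {n : ℕ} (t : BiExp n →₀ Cl n) :
    HMonogenic n (evalP (Cl n) n t) ↔
      diracP (ffd n) (dzP (Cl n)) t = 0 ∧ diracP (ff n) (dzcP (Cl n)) t = 0 := by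
  simp only [HMonogenic, dzFull_evalP, dzdFull_evalP]
  constructor
  · intro h
    exact ⟨evalP_injective n (by funext z; simpa using (h z).1),
      evalP_injective n (by funext z; simpa using (h z).2)⟩
  · rintro ⟨h1, h2⟩ z
    simp [h1, h2]

end HermiteanDirac

section Extension

variable {m : ℕ}

lemma diracP_dzP_liftP (k l : ℕ) (t : BiExp m →₀ Cl (m + 1)) :
    diracP (ffd (m + 1)) (dzP (Cl (m + 1))) (liftP (Cl (m + 1)) k l t) =
      liftP (Cl (m + 1)) k l
          (diracP (fun j => ffd (m + 1) (Fin.castSucc j)) (dzP (Cl (m + 1))) t) +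
        leftMulP (ffd (m + 1) (Fin.last m))
          (dzP (Cl (m + 1)) (Fin.last m) (liftP (Cl (m + 1)) k l t)) := by
  rw [diracP_apply, diracP_apply, Fin.sum_univ_castSucc, map_sum]
  simp only [dzP_castSucc_liftP, leftMulP, mapRange_liftP]

lemma diracP_dzcP_liftP (k l : ℕ) {t : BiExp m →₀ Cl (m + 1)}
    (ht : leftMulP (ff (m + 1) (Fin.last m)) t = 0) :
    diracP (ff (m + 1)) (dzcP (Cl (m + 1))) (liftP (Cl (m + 1)) k l t) =
      liftP (Cl (m + 1)) k l
          (diracP (fun j => ff (m + 1) (Fin.castSucc j)) (dzcP (Cl (m + 1))) t) := by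
  rw [diracP_apply, diracP_apply, Fin.sum_univ_castSucc, map_sum]
  have h : leftMulP (ff (m + 1) (Fin.last m))
      (dzcP (Cl (m + 1)) (Fin.last m) (liftP (Cl (m + 1)) k l t)) = 0 := by
    rw [leftMulP] at ht ⊢
    rw [mapRange_dzcP, mapRange_liftP, ht, map_zero, map_zero]
  rw [h, add_zero]
  simp only [dzcP_castSucc_liftP, leftMulP, mapRange_liftP]

lemma diracP_dzP_leftMulP {n : ℕ} (k : Fin n) (s : BiExp n →₀ Cl n) :
    diracP (ffd n) (dzP (Cl n)) (leftMulP (ffd n k) s) =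
      -leftMulP (ffd n k) (diracP (ffd n) (dzP (Cl n)) s) := by
  rw [diracP_apply, diracP_apply, map_sum, ← Finset.sum_neg_distrib]
  refine Finset.sum_congr rfl fun j _ => Finsupp.ext fun p => ?_
  simp only [dzP_leftMulP, Finsupp.neg_apply, leftMulP_apply, ← mul_assoc]
  rw [ffd_mul_ffd, neg_mul]

lemma diracP_dzcP_leftMulP {n : ℕ} (k : Fin n) (s : BiExp n →₀ Cl n) :
    diracP (ff n) (dzcP (Cl n)) (leftMulP (ffd n k) s) =
      dzcP (Cl n) k s - leftMulP (ffd n k) (diracP (ff n) (dzcP (Cl n)) s) := by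
  have h : ∀ j, leftMulP (ff n j) (leftMulP (ffd n k) (dzcP (Cl n) j s)) +
      leftMulP (ffd n k) (leftMulP (ff n j) (dzcP (Cl n) j s)) =
        if j = k then dzcP (Cl n) j s else 0 := fun j => Finsupp.ext fun p => by
    rw [Finsupp.add_apply, leftMulP_apply, leftMulP_apply, leftMulP_apply, leftMulP_apply,
      ← mul_assoc, ← mul_assoc, ← add_mul, ff_mul_ffd]
    split_ifs <;> simp
  rw [eq_sub_iff_add_eq, diracP_apply, diracP_apply, map_sum, ← Finset.sum_add_distrib]
  simp [dzcP_leftMulP, h]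

lemma diracP_dzP_mem_bihomP {n : ℕ} {a b : ℤ} (x : Fin m → Cl n) {t : BiExp m →₀ Cl n}
    (h : t ∈ bihomP (Cl n) m a b) : diracP x (dzP (Cl n)) t ∈ bihomP (Cl n) m (a - 1) b := by
  rw [diracP_apply]
  exact Submodule.sum_mem _ fun j _ => mapRange_mem_bihomP _ (dzP_mem_bihomP j h)

lemma diracP_dzcP_mem_bihomP {n : ℕ} {a b : ℤ} (x : Fin m → Cl n) {t : BiExp m →₀ Cl n}
    (h : t ∈ bihomP (Cl n) m a b) : diracP x (dzcP (Cl n)) t ∈ bihomP (Cl n) m a (b - 1) := by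
  rw [diracP_apply]
  exact Submodule.sum_mem _ fun j _ => mapRange_mem_bihomP _ (dzcP_mem_bihomP j h)

lemma coeff_diracP_dzP_mem {n : ℕ} {V W : Submodule ℂ (Cl n)} {x : Fin m → Cl n}
    (hx : ∀ j, ∀ y ∈ V, x j * y ∈ W) {t : BiExp m →₀ Cl n} (h : ∀ p, t p ∈ V) (p : BiExp m) :
    diracP x (dzP (Cl n)) t p ∈ W := by
  rw [diracP_apply, Finsupp.finsetSum_apply]
  refine W.sum_mem fun j _ => ?_
  rw [leftMulP_apply, dzP_apply]
  exact hx j _ (V.smul_mem _ (h _))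

lemma coeff_diracP_dzcP_mem {n : ℕ} {V W : Submodule ℂ (Cl n)} {x : Fin m → Cl n}
    (hx : ∀ j, ∀ y ∈ V, x j * y ∈ W) {t : BiExp m →₀ Cl n} (h : ∀ p, t p ∈ V) (p : BiExp m) :
    diracP x (dzcP (Cl n)) t p ∈ W := by
  rw [diracP_apply, Finsupp.finsetSum_apply]
  refine W.sum_mem fun j _ => ?_
  rw [leftMulP_apply, dzcP_apply]
  exact hx j _ (V.smul_mem _ (h _))

/-- The formal operator `∂z̃`, acting on polynomials on `ℂ^m` with values in `ℂ_{2(m+1)}`. -/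
def dzTP (m : ℕ) : Module.End ℂ (BiExp m →₀ Cl (m + 1)) :=
  diracP (fun j => ffd (m + 1) (Fin.castSucc j)) (dzP (Cl (m + 1)))

/-- The formal operator `∂z̃†`, acting on polynomials on `ℂ^m` with values in `ℂ_{2(m+1)}`. -/
def dzdTP (m : ℕ) : Module.End ℂ (BiExp m →₀ Cl (m + 1)) :=
  diracP (fun j => ff (m + 1) (Fin.castSucc j)) (dzcP (Cl (m + 1)))

lemma dzTP_dzTP (t : BiExp m →₀ Cl (m + 1)) : dzTP m (dzTP m t) = 0 :=
  diracP_diracP (fun _ _ => ffd_mul_ffd _ _ _) commute_dzP dzP_leftMulP t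

lemma dzdTP_dzdTP (t : BiExp m →₀ Cl (m + 1)) : dzdTP m (dzdTP m t) = 0 :=
  diracP_diracP (fun _ _ => ff_mul_ff _ _ _) commute_dzcP dzcP_leftMulP t

/-- The coefficient `(-∂z̃ ∂z̃†)^k t` of `z_{m+1}^k (z_{m+1}^c)^k / (k! k!)` in the
CK-extension of `t`. -/
def ckCoeff (t : BiExp m →₀ Cl (m + 1)) (k : ℕ) : BiExp m →₀ Cl (m + 1) :=
  (fun s => -dzTP m (dzdTP m s))^[k] t

lemma ckCoeff_zero (t : BiExp m →₀ Cl (m + 1)) : ckCoeff t 0 = t := rfl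

lemma ckCoeff_succ (t : BiExp m →₀ Cl (m + 1)) (k : ℕ) :
    ckCoeff t (k + 1) = -dzTP m (dzdTP m (ckCoeff t k)) :=
  Function.iterate_succ_apply' _ _ _

lemma dzTP_ckCoeff {t : BiExp m →₀ Cl (m + 1)} (h : dzTP m t = 0) (k : ℕ) :
    dzTP m (ckCoeff t k) = 0 := by
  cases k with
  | zero => exact h
  | succ k => rw [ckCoeff_succ, map_neg, dzTP_dzTP, neg_zero]

lemma ckCoeff_mem_bihomP {a b : ℤ} {t : BiExp m →₀ Cl (m + 1)}
    (h : t ∈ bihomP (Cl (m + 1)) m a b) (k : ℕ) :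
    ckCoeff t k ∈ bihomP (Cl (m + 1)) m (a - k) (b - k) := by
  induction k with
  | zero => simpa [ckCoeff_zero] using h
  | succ k ih =>
    rw [ckCoeff_succ]
    have h1 := Submodule.neg_mem _ (diracP_dzP_mem_bihomP (fun j => ffd (m + 1) (Fin.castSucc j))
      (diracP_dzcP_mem_bihomP (fun j => ff (m + 1) (Fin.castSucc j)) ih))
    rw [sub_sub, sub_sub] at h1
    exact_mod_cast h1

lemma coeff_dzdTP_mem {q : ℕ} {t : BiExp m →₀ Cl (m + 1)}
    (h : ∀ p, t p ∈ LamT (m + 1) (q + 1)) (p : BiExp m) : dzdTP m t p ∈ LamT (m + 1) q :=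
  coeff_diracP_dzcP_mem (fun _ _ hy => ff_mul_mem_LamT _ hy) h p

lemma coeff_ckCoeff_mem {q : ℕ} {t : BiExp m →₀ Cl (m + 1)}
    (h : ∀ p, t p ∈ LamT (m + 1) (q + 1)) (k : ℕ) (p : BiExp m) :
    ckCoeff t k p ∈ LamT (m + 1) (q + 1) := by
  induction k generalizing p with
  | zero => exact h p
  | succ k ih =>
    rw [ckCoeff_succ, Finsupp.neg_apply]
    exact Submodule.neg_mem _ (coeff_diracP_dzP_mem
      (fun j _ hy => ffd_mul_mem_LamT (by simp) hy) (coeff_dzdTP_mem ih) p)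

/-- The term of index `k` of the CK-extension of `t`. -/
def ckTerm (t : BiExp m →₀ Cl (m + 1)) (k : ℕ) : BiExp (m + 1) →₀ Cl (m + 1) :=
  liftP (Cl (m + 1)) k k (ckCoeff t k) -
    leftMulP (ffd (m + 1) (Fin.last m)) (liftP (Cl (m + 1)) k (k + 1) (dzdTP m (ckCoeff t k)))

/-- The CK-extension of a formal polynomial `t` of degree `a` in `z`. -/
def ckExt (a : ℕ) (t : BiExp m →₀ Cl (m + 1)) : BiExp (m + 1) →₀ Cl (m + 1) :=
  ∑ k ∈ Finset.range (a + 1), ckTerm t k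

lemma ckExt_mem_bihomP {a : ℕ} {b : ℤ} {t : BiExp m →₀ Cl (m + 1)}
    (h : t ∈ bihomP (Cl (m + 1)) m a b) : ckExt a t ∈ bihomP (Cl (m + 1)) (m + 1) a b := by
  refine Submodule.sum_mem _ fun k _ => Submodule.sub_mem _ ?_ (mapRange_mem_bihomP _ ?_)
  · have h1 := liftP_mem_bihomP k k (ckCoeff_mem_bihomP h k)
    rwa [sub_add_cancel, sub_add_cancel] at h1
  · have h1 := liftP_mem_bihomP k (k + 1) (diracP_dzcP_mem_bihomP
      (fun j => ff (m + 1) (Fin.castSucc j)) (ckCoeff_mem_bihomP h k))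
    rw [sub_add_cancel, sub_sub] at h1
    push_cast at h1
    rwa [sub_add_cancel] at h1

lemma coeff_ckExt_mem {q : ℕ} (a : ℕ) {t : BiExp m →₀ Cl (m + 1)}
    (h : ∀ p, t p ∈ LamT (m + 1) (q + 1)) (p : BiExp (m + 1)) :
    ckExt a t p ∈ Lam (m + 1) (q + 1) := by
  rw [ckExt, Finsupp.finsetSum_apply]
  refine Submodule.sum_mem _ fun k _ => ?_
  rw [ckTerm, Finsupp.sub_apply, leftMulP_apply]
  have hA := coeff_ckCoeff_mem h k
  exact Submodule.sub_mem _ (LamT_le_Lam _ _ (coeff_liftP_mem _ _ _ hA p))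
    (ffd_mul_mem_Lam _ (LamT_le_Lam _ _ (coeff_liftP_mem _ _ _ (coeff_dzdTP_mem hA) p)))

lemma leftMulP_ff_last_eq_zero {r : ℕ} {t : BiExp m →₀ Cl (m + 1)}
    (h : ∀ p, t p ∈ LamT (m + 1) r) : leftMulP (ff (m + 1) (Fin.last m)) t = 0 :=
  Finsupp.ext fun p => by
    rw [leftMulP_apply, ff_last_mul_of_mem_LamT (h p), Finsupp.zero_apply]

lemma diracP_dzcP_ckTerm {q : ℕ} {t : BiExp m →₀ Cl (m + 1)}
    (h : ∀ p, t p ∈ LamT (m + 1) (q + 1)) (k : ℕ) :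
    diracP (ff (m + 1)) (dzcP (Cl (m + 1))) (ckTerm t k) = 0 := by
  have hA := coeff_ckCoeff_mem h k
  have hB := diracP_dzcP_liftP k (k + 1) (leftMulP_ff_last_eq_zero (coeff_dzdTP_mem hA))
  rw [← dzdTP, dzdTP_dzdTP, map_zero] at hB
  rw [ckTerm, map_sub, diracP_dzcP_liftP k k (leftMulP_ff_last_eq_zero hA), diracP_dzcP_leftMulP,
    hB, map_zero, dzcP_last_liftP_succ, sub_zero, ← dzdTP, sub_self]

lemma diracP_dzP_ckTerm {t : BiExp m →₀ Cl (m + 1)} (h : dzTP m t = 0) (k : ℕ) :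
    diracP (ffd (m + 1)) (dzP (Cl (m + 1))) (ckTerm t k) =
      leftMulP (ffd (m + 1) (Fin.last m)) (dzP (Cl (m + 1)) (Fin.last m)
        (liftP (Cl (m + 1)) k k (ckCoeff t k))) -
      leftMulP (ffd (m + 1) (Fin.last m)) (dzP (Cl (m + 1)) (Fin.last m)
        (liftP (Cl (m + 1)) (k + 1) (k + 1) (ckCoeff t (k + 1)))) := by
  have h0 : ∀ s : BiExp (m + 1) →₀ Cl (m + 1), leftMulP (ffd (m + 1) (Fin.last m))
      (leftMulP (ffd (m + 1) (Fin.last m)) s) = 0 := fun s => Finsupp.ext fun p => by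
    rw [leftMulP_apply, leftMulP_apply, ← mul_assoc, ffd_mul_self, zero_mul, Finsupp.zero_apply]
  rw [ckTerm, map_sub, diracP_dzP_liftP, diracP_dzP_leftMulP, diracP_dzP_liftP, ← dzTP,
    dzTP_ckCoeff h, map_zero, zero_add, map_add, h0, add_zero, dzP_last_liftP_succ, ckCoeff_succ,
    map_neg, map_neg]

lemma diracP_dzP_ckExt {a : ℕ} {b : ℤ} {t : BiExp m →₀ Cl (m + 1)}
    (hmem : t ∈ bihomP (Cl (m + 1)) m a b) (h : dzTP m t = 0) :
    diracP (ffd (m + 1)) (dzP (Cl (m + 1))) (ckExt a t) = 0 := by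
  rw [ckExt, map_sum, Finset.sum_congr rfl fun k _ => diracP_dzP_ckTerm h k,
    Finset.sum_range_sub', dzP_last_liftP_zero,
    eq_zero_of_mem_bihomP_of_neg (by push_cast; omega) (ckCoeff_mem_bihomP hmem (a + 1))]
  simp

lemma restrictP_dzcP_iterate_ckTerm (j k : ℕ) (t : BiExp m →₀ Cl (m + 1)) :
    restrictP (Cl (m + 1)) m ((dzcP (Cl (m + 1)) (Fin.last m))^[j] (ckTerm t k)) =
      (if k = 0 ∧ k = j then ckCoeff t k else 0) - leftMulP (ffd (m + 1) (Fin.last m))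
        (if k = 0 ∧ k + 1 = j then dzdTP m (ckCoeff t k) else 0) := by
  have hcomm := fun (x : Cl (m + 1)) =>
    Function.Commute.iterate_left (fun s => dzcP_leftMulP x (Fin.last m) s) j
  rw [ckTerm, ← Module.End.pow_apply, map_sub, Module.End.pow_apply, Module.End.pow_apply,
    (hcomm _).eq, map_sub, restrictP_dzcP_iterate_liftP, leftMulP, restrictP_mapRange,
    restrictP_dzcP_iterate_liftP]
  rfl

lemma restrictP_dzP_iterate_ckTerm (i k : ℕ) (t : BiExp m →₀ Cl (m + 1)) :
    restrictP (Cl (m + 1)) m ((dzP (Cl (m + 1)) (Fin.last m))^[i] (ckTerm t k)) =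
      if k = i ∧ k = 0 then ckCoeff t k else 0 := by
  have hcomm := fun (x : Cl (m + 1)) =>
    Function.Commute.iterate_left (fun s => dzP_leftMulP x (Fin.last m) s) i
  rw [ckTerm, ← Module.End.pow_apply, map_sub, Module.End.pow_apply, Module.End.pow_apply,
    (hcomm _).eq, map_sub, restrictP_dzP_iterate_liftP, leftMulP, restrictP_mapRange,
    restrictP_dzP_iterate_liftP]
  simp

lemma restrictP_dzcP_iterate_ckExt (a j : ℕ) (t : BiExp m →₀ Cl (m + 1)) :
    restrictP (Cl (m + 1)) m ((dzcP (Cl (m + 1)) (Fin.last m))^[j] (ckExt a t)) =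
      if j = 0 then t else
        if j = 1 then -leftMulP (ffd (m + 1) (Fin.last m)) (dzdTP m t) else 0 := by
  rw [ckExt, ← Module.End.pow_apply, map_sum, map_sum]
  simp only [Module.End.pow_apply, restrictP_dzcP_iterate_ckTerm]
  rw [Finset.sum_eq_single_of_mem 0 (by simp) fun k _ hk => by simp [hk]]
  rcases j with _ | _ | j <;> simp [ckCoeff_zero]

lemma restrictP_dzP_iterate_ckExt (a i : ℕ) (t : BiExp m →₀ Cl (m + 1)) :
    restrictP (Cl (m + 1)) m ((dzP (Cl (m + 1)) (Fin.last m))^[i] (ckExt a t)) =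
      if i = 0 then t else 0 := by
  rw [ckExt, ← Module.End.pow_apply, map_sum, map_sum]
  simp only [Module.End.pow_apply, restrictP_dzP_iterate_ckTerm]
  rw [Finset.sum_eq_single_of_mem 0 (by simp) fun k _ hk => by simp [hk]]
  cases i <;> simp [ckCoeff_zero]

end Extension

section Uniqueness

variable {m : ℕ}

lemma exists_add_single_last {α : Fin (m + 1) → ℕ} {i k : ℕ} (h : α (Fin.last m) = i + k) :
    ∃ α' : Fin (m + 1) → ℕ, α' (Fin.last m) = i ∧ α = α' + Pi.single (Fin.last m) k := by
  refine ⟨Fin.snoc (Fin.init α) i, by simp, funext fun l => ?_⟩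
  refine Fin.lastCases ?_ (fun l => ?_) l
  · simp [h]
  · simp [Fin.init, Fin.castSucc_ne_last]

lemma eq_zero_of_ff_mul_eq_zero {n : ℕ} (j : Fin n) {x : Cl n} (h : ff n j * x = 0)
    (h' : ffd n j * x = 0) : x = 0 := by
  have h1 := congrArg (· * x) (ff_mul_ffd n j j)
  simpa [add_mul, mul_assoc, h, h'] using h1.symm

/-- A Hermitean monogenic polynomial is determined by the restrictions to `z_{m+1} = 0` of its
pure derivatives in `z_{m+1}` and in `z_{m+1}^c`. -/
lemma eq_zero_of_diracP_eq_zero {a b : ℕ} {t : BiExp (m + 1) →₀ Cl (m + 1)}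
    (hmem : t ∈ bihomP (Cl (m + 1)) (m + 1) a b)
    (h1 : diracP (ffd (m + 1)) (dzP (Cl (m + 1))) t = 0)
    (h2 : diracP (ff (m + 1)) (dzcP (Cl (m + 1))) t = 0)
    (hz : ∀ i ≤ a, restrictP (Cl (m + 1)) m ((dzP (Cl (m + 1)) (Fin.last m))^[i] t) = 0)
    (hzc : ∀ j ≤ b, restrictP (Cl (m + 1)) m ((dzcP (Cl (m + 1)) (Fin.last m))^[j] t) = 0) :
    t = 0 := by
  have hlast : ∀ α : Fin (m + 1) → ℕ, α (Fin.last m) ≤ ∑ l, α l := fun α =>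
    Finset.single_le_sum (fun l _ => Nat.zero_le (α l)) (Finset.mem_univ _)
  suffices H : ∀ (i j : ℕ) (α β : Fin (m + 1) → ℕ), α (Fin.last m) = i → β (Fin.last m) = j →
      t (α, β) = 0 from Finsupp.ext fun ⟨α, β⟩ => H _ _ α β rfl rfl
  intro i
  induction i with
  | zero =>
    intro j α β hα hβ
    by_cases hj : j ≤ b
    · obtain ⟨β', hβ', rfl⟩ := exists_add_single_last (i := 0) (hβ.trans (zero_add j).symm)
      refine coeff_eq_zero_of_dzcP_iterate _ _ ?_
      rw [← restrictP_apply _ hα hβ', hzc j hj, Finsupp.zero_apply]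
    · by_contra hne
      have h3 := (mem_bihomP.1 hmem _ hne).2
      have h4 := hlast β
      simp only at h3
      omega
  | succ i ihi =>
    intro j
    induction j with
    | zero =>
      intro α β hα hβ
      by_cases hi : i + 1 ≤ a
      · obtain ⟨α', hα', rfl⟩ := exists_add_single_last (i := 0) (hα.trans (zero_add _).symm)
        refine coeff_eq_zero_of_dzP_iterate _ _ ?_
        rw [← restrictP_apply _ hα' hβ, hz _ hi, Finsupp.zero_apply]
      · by_contra hne
        have h3 := (mem_bihomP.1 hmem _ hne).1
        have h4 := hlast α
        simp only at h3
        omega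
    | succ j ihj =>
      intro α β hα hβ
      refine eq_zero_of_ff_mul_eq_zero (Fin.last m) ?_ ?_
      · obtain ⟨β', hβ', rfl⟩ := exists_add_single_last hβ
        have h3 := DFunLike.congr_fun h2 (α, β')
        rw [diracP_apply, Finsupp.finsetSum_apply, Fin.sum_univ_castSucc,
          Finset.sum_eq_zero fun k _ => ?_, zero_add, leftMulP_apply, dzcP_apply, mul_smul_comm,
          Finsupp.zero_apply] at h3
        · exact (smul_eq_zero.1 h3).resolve_left (Nat.cast_add_one_ne_zero _)
        · rw [leftMulP_apply, dzcP_apply, ihj _ _ hα (by simp [hβ', (Fin.castSucc_ne_last k).symm]),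
            smul_zero, mul_zero]
      · obtain ⟨α', hα', rfl⟩ := exists_add_single_last hα
        have h3 := DFunLike.congr_fun h1 (α', β)
        rw [diracP_apply, Finsupp.finsetSum_apply, Fin.sum_univ_castSucc,
          Finset.sum_eq_zero fun k _ => ?_, zero_add, leftMulP_apply, dzP_apply, mul_smul_comm,
          Finsupp.zero_apply] at h3
        · exact (smul_eq_zero.1 h3).resolve_left (Nat.cast_add_one_ne_zero _)
        · rw [leftMulP_apply, dzP_apply,
            ihi _ _ _ (by simp [hα', (Fin.castSucc_ne_last k).symm]) hβ, smul_zero, mul_zero]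

end Uniqueness

/-- **Hermitean CK-extension of a single initial polynomial `p⁰_{a,b}` (Corollary 4.1).**
Given a homogeneous polynomial `p⁰ : ℂ^{n-1} → (∧_{n-1}†)^{(r)} I` of bidegree `(a,b)` with
`∂_z̃ p⁰ = 0`, there is a unique Hermitean monogenic homogeneous polynomial
`M⁰ : ℂⁿ → (∧_n†)^{(r)} I` of bidegree `(a,b)` with `M⁰|_{z_n=0} = p⁰`,
`∂_{z_n^c} M⁰|_{z_n=0} = -𝔣_n† ∂_z̃† p⁰`, `∂_{z_n^c}^j M⁰|_{z_n=0} = 0` for `2 ≤ j ≤ b`,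
and `∂_{z_n}^i M⁰|_{z_n=0} = 0` for `1 ≤ i ≤ a`. -/
theorem ck_extension_p0 (n : ℕ) (hn : 2 ≤ n) (r : ℕ) (hr0 : 0 < r) (hrn : r < n) (a b : ℕ)
    (p0 : (Fin (n - 1) → ℂ) → Cl n)
    (hpoly : IsBihom n (n - 1) a b p0)
    (hval : ∀ x, p0 x ∈ LamT n r)
    (hcomp : ∀ x, dzT n p0 x = 0) :
    ∃! M : (Fin n → ℂ) → Cl n,
      IsBihom n n a b M ∧ (∀ z, M z ∈ Lam n r) ∧ HMonogenic n M ∧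
      (∀ x, M (embC n x) = p0 x) ∧
      (∀ x, pzc (⟨n - 1, by omega⟩ : Fin n) M (embC n x) =
        -(ffd n ⟨n - 1, by omega⟩ * dzdT n p0 x)) ∧
      (∀ j, 2 ≤ j → j ≤ b → ∀ x, (pzc (⟨n - 1, by omega⟩ : Fin n))^[j] M (embC n x) = 0) ∧
      (∀ i, 1 ≤ i → i ≤ a → ∀ x, (pz (⟨n - 1, by omega⟩ : Fin n))^[i] M (embC n x) = 0) := by
  obtain ⟨m, rfl⟩ : ∃ m, n = m + 1 := ⟨n - 1, by omega⟩
  obtain ⟨q, rfl⟩ : ∃ q, r = q + 1 := ⟨r - 1, by omega⟩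
  change (Fin m → ℂ) → Cl (m + 1) at p0
  change IsBihom (m + 1) m a b p0 at hpoly
  obtain ⟨t, ht, rfl⟩ := isBihom_iff_exists_evalP.1 hpoly
  have htval : ∀ p, t p ∈ LamT (m + 1) (q + 1) := coeff_mem_of_evalP_mem _ hval
  have htcomp : dzTP m t = 0 := evalP_injective m <| funext fun x => by
    rw [map_zero]
    exact (dzT_evalP t x).symm.trans (hcomp x)
  change ∃! M : (Fin (m + 1) → ℂ) → Cl (m + 1),
    IsBihom (m + 1) (m + 1) a b M ∧ (∀ z, M z ∈ Lam (m + 1) (q + 1)) ∧ HMonogenic (m + 1) M ∧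
      (∀ x : Fin m → ℂ, M (embC (m + 1) x) = evalP (Cl (m + 1)) m t x) ∧
      (∀ x : Fin m → ℂ, pzc (Fin.last m) M (embC (m + 1) x) =
        -(ffd (m + 1) (Fin.last m) * dzdT (m + 1) (evalP (Cl (m + 1)) m t) x)) ∧
      (∀ j, 2 ≤ j → j ≤ b → ∀ x : Fin m → ℂ, (pzc (Fin.last m))^[j] M (embC (m + 1) x) = 0) ∧
      (∀ i, 1 ≤ i → i ≤ a → ∀ x : Fin m → ℂ, (pz (Fin.last m))^[i] M (embC (m + 1) x) = 0)
  refine ⟨evalP (Cl (m + 1)) (m + 1) (ckExt a t), ⟨?_, ?_, ?_, ?_, ?_, ?_, ?_⟩, ?_⟩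
  · exact isBihom_iff_exists_evalP.2 ⟨_, ckExt_mem_bihomP ht, rfl⟩
  · exact evalP_mem_of_coeff_mem _ (coeff_ckExt_mem a htval)
  · refine (hMonogenic_evalP_iff _).2 ⟨diracP_dzP_ckExt ht htcomp, ?_⟩
    rw [ckExt, map_sum]
    exact Finset.sum_eq_zero fun k _ => diracP_dzcP_ckTerm htval k
  · intro x
    rw [evalP_embC]
    exact congrArg (fun s => evalP (Cl (m + 1)) m s x) (restrictP_dzcP_iterate_ckExt a 0 t)
  · intro x
    have h := restrictP_dzcP_iterate_ckExt a 1 t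
    rw [Function.iterate_one, if_neg one_ne_zero, if_pos rfl] at h
    rw [pzc_evalP, evalP_embC, h, dzdT_evalP, map_neg, Pi.neg_apply, leftMulP, evalP_mapRange]
    rfl
  · intro j hj _ x
    rw [pzc_iterate_evalP, evalP_embC, restrictP_dzcP_iterate_ckExt, if_neg (by omega),
      if_neg (by omega), map_zero, Pi.zero_apply]
  · intro i hi _ x
    rw [pz_iterate_evalP, evalP_embC, restrictP_dzP_iterate_ckExt, if_neg (by omega), map_zero,
      Pi.zero_apply]
  · rintro M ⟨hM, -, hmon, hM0, hM1, hMc, hMz⟩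
    obtain ⟨s, hs, rfl⟩ := isBihom_iff_exists_evalP.1 hM
    obtain ⟨hs1, hs2⟩ := (hMonogenic_evalP_iff s).1 hmon
    have hrestr : ∀ (s' : BiExp (m + 1) →₀ Cl (m + 1)) (t' : BiExp m →₀ Cl (m + 1)),
        (∀ x, evalP (Cl (m + 1)) (m + 1) s' (embC (m + 1) x) = evalP (Cl (m + 1)) m t' x) →
          restrictP (Cl (m + 1)) m s' = t' := fun s' t' h =>
      evalP_injective m (funext fun x => (evalP_embC s' x).symm.trans (h x))
    refine congrArg _ (sub_eq_zero.1 (eq_zero_of_diracP_eq_zero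
      (Submodule.sub_mem _ hs (ckExt_mem_bihomP ht)) ?_ ?_ ?_ ?_))
    · rw [map_sub, hs1, diracP_dzP_ckExt ht htcomp, sub_zero]
    · rw [map_sub, hs2, ckExt, map_sum, zero_sub, neg_eq_zero]
      exact Finset.sum_eq_zero fun k _ => diracP_dzcP_ckTerm htval k
    · intro i hi
      rw [← Module.End.pow_apply, map_sub, map_sub, Module.End.pow_apply, Module.End.pow_apply,
        restrictP_dzP_iterate_ckExt, sub_eq_zero]
      refine hrestr _ _ fun x => ?_
      rcases i with _ | i
      · exact hM0 x
      · rw [← pz_iterate_evalP, hMz _ (by omega) hi]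
        simp
    · intro j hj
      rw [← Module.End.pow_apply, map_sub, map_sub, Module.End.pow_apply, Module.End.pow_apply,
        restrictP_dzcP_iterate_ckExt, sub_eq_zero]
      refine hrestr _ _ fun x => ?_
      rcases j with _ | _ | j
      · exact hM0 x
      · rw [← pzc_iterate_evalP, zero_add, Function.iterate_one, hM1, dzdT_evalP,
          if_neg one_ne_zero, if_pos rfl, map_neg, Pi.neg_apply, leftMulP, evalP_mapRange]
        rfl
      · rw [← pzc_iterate_evalP, hMc _ (by omega) hj]
        simp
end
end
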